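/- Let n ≥ 2 and k ≥ 1 be integers, let A ⊆ ℂ be a set of n distinct points, and let x ∈ ℂ \ A. Suppose γ₁, …, γ_N are pairwise non-homotopic x-loops in the complement of A such that none of them passes through x, each has fewer than k self-intersections, and every pair of them cross fewer than k times. Then N < 2^{(2k)^{2n}}. -/

import Mathlib

open unitInterval

/-- `γ` does not pass through `x` : its interior avoids the basepoint. -/
def AvoidsBase {A : Set ℂ} {x : ℂ} {hx : x ∉ A}
    (γ : Path (X := {z : ℂ // z ∉ A}) ⟨x, hx⟩ ⟨x, hx⟩) : Prop :=
  ∀ t : I, t ≠ 0 → t ≠ 1 → (γ t : ℂ) ≠ x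

/-- `γ` has fewer than `k` self-intersections: the set
`{(s,t) : 0 < s < t < 1, γ s = γ t}` has fewer than `k` elements. -/
def SelfIntersLt {A : Set ℂ} {x : ℂ} {hx : x ∉ A}
    (γ : Path (X := {z : ℂ // z ∉ A}) ⟨x, hx⟩ ⟨x, hx⟩) (k : ℕ) : Prop :=
  {p : I × I | p.1 ≠ 0 ∧ p.2 ≠ 1 ∧ p.1 < p.2 ∧ γ p.1 = γ p.2}.encard < (k : ℕ∞)

/-- `γ` and `γ'` cross fewer than `k` times: the set
`{(s,t) ∈ (0,1)² : γ s = γ' t}` has fewer than `k` elements. -/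
def CrossingsLt {A : Set ℂ} {x : ℂ} {hx : x ∉ A}
    (γ γ' : Path (X := {z : ℂ // z ∉ A}) ⟨x, hx⟩ ⟨x, hx⟩) (k : ℕ) : Prop :=
  {p : I × I | p.1 ≠ 0 ∧ p.1 ≠ 1 ∧ p.2 ≠ 0 ∧ p.2 ≠ 1 ∧ γ p.1 = γ' p.2}.encard < (k : ℕ∞)

/-- `γ : I → ℂ` contracts rel endpoints to its starting point inside the complement of `B`. -/
def NullHomotopicAvoiding (γ : I → ℂ) (B : Set ℂ) : Prop :=
  ∃ F : I × I → ℂ, Continuous F ∧ (∀ t, F (0, t) = γ t) ∧ (∀ t, F (1, t) = γ 0) ∧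
    (∀ s, F (s, 0) = γ 0) ∧ (∀ s, F (s, 1) = γ 0) ∧ ∀ p, F p ∉ B

/-- A push of the plane supported in the ball of radius `ε` around `u` taking `u` to `u'`. -/
noncomputable def pushPoint (u u' : ℂ) (ε : ℝ) (z : ℂ) : ℂ :=
  z + (max 0 (1 - ‖z - u‖ / ε) : ℝ) * (u' - u)

lemma continuous_pushPoint (u u' : ℂ) (ε : ℝ) : Continuous (pushPoint u u' ε) := by
  unfold pushPoint
  fun_prop

lemma pushPoint_of_le {u u' z : ℂ} {ε : ℝ} (hε : 0 < ε) (hz : ε ≤ ‖z - u‖) :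
    pushPoint u u' ε z = z := by
  have : max 0 (1 - ‖z - u‖ / ε) = 0 := by
    apply max_eq_left
    rw [sub_nonpos, one_le_div hε]
    exact hz
  simp [pushPoint, this]

lemma pushPoint_of_lt {u u' z : ℂ} {ε : ℝ} (hε : 0 < ε) (hz : ‖z - u‖ < ε) :
    pushPoint u u' ε z = z + ((1 - ‖z - u‖ / ε : ℝ) : ℂ) * (u' - u) := by
  have : max 0 (1 - ‖z - u‖ / ε) = 1 - ‖z - u‖ / ε := by
    apply max_eq_right
    rw [sub_nonneg, div_le_one hε]
    exact hz.le
  rw [pushPoint, this]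

lemma norm_pushPoint_sub_lt {u u' z : ℂ} {ε : ℝ} (hε : 0 < ε) (hu : ‖u' - u‖ < ε)
    (hz : ‖z - u‖ < ε) : ‖pushPoint u u' ε z - u‖ < ε := by
  rw [pushPoint_of_lt hε hz]
  have h1 : 0 < 1 - ‖z - u‖ / ε := by rw [sub_pos, div_lt_one hε]; exact hz
  calc ‖z + ((1 - ‖z - u‖ / ε : ℝ) : ℂ) * (u' - u) - u‖
      = ‖(z - u) + ((1 - ‖z - u‖ / ε : ℝ) : ℂ) * (u' - u)‖ := by ring_nf
    _ ≤ ‖z - u‖ + (1 - ‖z - u‖ / ε) * ‖u' - u‖ := by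
        refine (norm_add_le _ _).trans ?_
        rw [norm_mul, Complex.norm_real, Real.norm_of_nonneg h1.le]
    _ < ‖z - u‖ + (1 - ‖z - u‖ / ε) * ε := by gcongr
    _ = ε := by field_simp; ring

lemma eq_of_pushPoint_eq {u u' z : ℂ} {ε : ℝ} (hε : 0 < ε) (hu : ‖u' - u‖ < ε)
    (h : pushPoint u u' ε z = u') : z = u := by
  rcases lt_or_ge ‖z - u‖ ε with hz | hz
  · rw [pushPoint_of_lt hε hz] at h
    have h2 : z - u = ((‖z - u‖ / ε : ℝ) : ℂ) * (u' - u) := by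
      have : z = u' - ((1 - ‖z - u‖ / ε : ℝ) : ℂ) * (u' - u) := by
        rw [eq_sub_iff_add_eq]; exact h
      push_cast at this ⊢
      linear_combination this
    have h3 := congrArg norm h2
    rw [norm_mul, Complex.norm_real, Real.norm_of_nonneg (by positivity)] at h3
    by_contra hne
    have hpos : 0 < ‖z - u‖ := norm_pos_iff.2 (sub_ne_zero.2 hne)
    have h4 : ‖z - u‖ / ε * ‖u' - u‖ < ‖z - u‖ / ε * ε := by gcongr
    rw [div_mul_cancel₀ _ hε.ne'] at h4
    linarith
  · rw [pushPoint_of_le hε hz] at h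
    subst h
    linarith

lemma NullHomotopicAvoiding.move {γ : I → ℂ} {B : Set ℂ} {u u' : ℂ} {ε : ℝ} (hε : 0 < ε)
    (hu : ‖u' - u‖ < ε) (hγ : ∀ t, ε ≤ ‖γ t - u‖) (hB : ∀ b ∈ B, ε ≤ ‖b - u‖)
    (h : NullHomotopicAvoiding γ (insert u B)) : NullHomotopicAvoiding γ (insert u' B) := by
  obtain ⟨F, hF, h0, h1, h2, h3, h4⟩ := h
  refine ⟨fun p => pushPoint u u' ε (F p), (continuous_pushPoint _ _ _).comp hF,
    fun t => ?_, fun t => ?_, fun t => ?_, fun t => ?_, fun p hp => ?_⟩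
  · beta_reduce
    rw [h0, pushPoint_of_le hε (hγ t)]
  · beta_reduce
    rw [h1, pushPoint_of_le hε (hγ 0)]
  · beta_reduce
    rw [h2, pushPoint_of_le hε (hγ 0)]
  · beta_reduce
    rw [h3, pushPoint_of_le hε (hγ 0)]
  · rcases hp with hp | hp
    · exact h4 p (Or.inl (eq_of_pushPoint_eq hε hu hp))
    · rcases lt_or_ge ‖F p - u‖ ε with hz | hz
      · exact absurd (hB _ hp) (not_le.2 (norm_pushPoint_sub_lt hε hu hz))
      · beta_reduce at hp
        rw [pushPoint_of_le hε hz] at hp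
        exact h4 p (Or.inr hp)

lemma NullHomotopicAvoiding.mono {γ : I → ℂ} {B B' : Set ℂ} (hB : B' ⊆ B)
    (h : NullHomotopicAvoiding γ B) : NullHomotopicAvoiding γ B' := by
  obtain ⟨F, hF, h0, h1, h2, h3, h4⟩ := h
  exact ⟨F, hF, h0, h1, h2, h3, fun p hp => h4 p (hB hp)⟩

lemma nullHomotopicAvoiding_empty {γ : I → ℂ} (hγ : Continuous γ) (hl : γ 1 = γ 0) :
    NullHomotopicAvoiding γ ∅ := by
  refine ⟨fun p => γ p.2 + (p.1 : ℝ) * (γ 0 - γ p.2), by fun_prop, ?_, ?_, ?_, ?_, ?_⟩ <;>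
    simp [hl]

lemma NullHomotopicAvoiding.isOpen {γ : I → ℂ} {B : Set ℂ} (h : NullHomotopicAvoiding γ B)  :
    ∃ D : Set ℂ, IsCompact D ∧ B ⊆ Dᶜ ∧ ∀ u ∉ D, NullHomotopicAvoiding γ (insert u B) := by
  obtain ⟨F, hF, h0, h1, h2, h3, h4⟩ := h
  refine ⟨Set.range F, isCompact_range hF, ?_, fun u hu => ⟨F, hF, h0, h1, h2, h3, ?_⟩⟩
  · rintro b hb ⟨p, rfl⟩
    exact h4 p hb
  · rintro p (hp | hp)
    · exact hu ⟨p, hp⟩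
    · exact h4 p hp

/-- A loop is contractible in the complement of a finite set lying in an unbounded connected
set that the loop does not meet. -/
theorem nullHomotopicAvoiding_of_isPreconnected {γ : I → ℂ} (hγ : Continuous γ)
    (hl : γ 1 = γ 0) {C A : Set ℂ} (hC : IsPreconnected C) (hA : A.Finite) (hAC : A ⊆ C)
    (hγC : ∀ t, γ t ∉ C) (hub : ∀ r : ℝ, ∃ c ∈ C, r < ‖c‖) : NullHomotopicAvoiding γ A := by
  induction A, hA using Set.Finite.induction_on with
  | empty => exact nullHomotopicAvoiding_empty hγ hl
  | @insert a B haB hB ih =>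
    have hPB := ih (fun b hb => hAC (Set.mem_insert_of_mem _ hb))
    obtain ⟨D, hD, hBD, hDu⟩ := hPB.isOpen
    have hrel : ∀ u ∈ C, ∀ v ∈ C, (NullHomotopicAvoiding γ (insert u B) ↔
        NullHomotopicAvoiding γ (insert v B)) := by
      intro u hu v hv
      refine hC.induction₂' (fun u v => NullHomotopicAvoiding γ (insert u B) ↔
        NullHomotopicAvoiding γ (insert v B)) (fun u hu => ?_) (fun _ _ _ _ _ _ h h' => h.trans h')
        hu hv
      suffices ∀ᶠ y in nhds u, (NullHomotopicAvoiding γ (insert u B) ↔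
          NullHomotopicAvoiding γ (insert y B)) by
        refine (this.filter_mono nhdsWithin_le_nhds).mono fun y hy => ⟨hy, hy.symm⟩
      by_cases huB : u ∈ B
      · filter_upwards [hD.isClosed.isOpen_compl.mem_nhds (hBD huB)] with y hy
        rw [Set.insert_eq_of_mem huB]
        exact ⟨fun _ => hDu y hy, fun h => h.mono (Set.subset_insert _ _)⟩
      · have hcl : IsClosed (Set.range γ ∪ B) := (isCompact_range hγ).isClosed.union hB.isClosed
        have hu' : u ∈ (Set.range γ ∪ B)ᶜ := by
          rintro (⟨t, rfl⟩ | h)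
          · exact hγC t hu
          · exact huB h
        obtain ⟨ε, hε, hball⟩ := Metric.isOpen_iff.1 hcl.isOpen_compl u hu'
        have key : ∀ w, ‖w - u‖ < ε / 2 → ∀ z ∈ Set.range γ ∪ B, ε / 2 ≤ ‖z - w‖ := by
          intro w hw z hz
          by_contra hlt
          refine hball (a := z) ?_ hz
          rw [Metric.mem_ball, dist_eq_norm]
          calc ‖z - u‖ = ‖(z - w) + (w - u)‖ := by ring_nf
            _ ≤ ‖z - w‖ + ‖w - u‖ := norm_add_le _ _
            _ < ε := by linarith
        filter_upwards [Metric.ball_mem_nhds u (half_pos hε)] with y hy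
        rw [Metric.mem_ball, dist_eq_norm] at hy
        have hu0 : ‖u - u‖ < ε / 2 := by simpa using half_pos hε
        constructor
        · exact NullHomotopicAvoiding.move (half_pos hε) hy (fun t => key u hu0 _ (Or.inl ⟨t, rfl⟩))
            (fun b hb => key u hu0 _ (Or.inr hb))
        · exact NullHomotopicAvoiding.move (half_pos hε) (by rwa [norm_sub_rev])
            (fun t => key y hy _ (Or.inl ⟨t, rfl⟩)) (fun b hb => key y hy _ (Or.inr hb))
    obtain ⟨r, hr⟩ := hD.isBounded.exists_norm_le
    obtain ⟨c, hc, hrc⟩ := hub r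
    exact (hrel c hc a (hAC (Set.mem_insert _ _))).1 (hDu c fun h => absurd (hr c h) (not_le.2 hrc))

/-- Path form of the filling lemma. -/
theorem Path.homotopic_refl_of_isPreconnected {A : Set ℂ} (hA : A.Finite) {z : {z : ℂ // z ∉ A}}
    (γ : Path z z) {C : Set ℂ} (hC : IsPreconnected C) (hAC : A ⊆ C)
    (hγC : ∀ t, (γ t : ℂ) ∉ C) (hub : ∀ r : ℝ, ∃ c ∈ C, r < ‖c‖) :
    γ.Homotopic (Path.refl z) := by
  obtain ⟨F, hF, h0, h1, h2, h3, h4⟩ := nullHomotopicAvoiding_of_isPreconnected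
    (γ := fun t => (γ t : ℂ)) (by fun_prop) (by simp) hC hA hAC hγC hub
  refine ⟨⟨⟨⟨fun p => ⟨F p, h4 p⟩, by fun_prop⟩, fun t => Subtype.ext (h0 t), fun t => ?_⟩, ?_⟩⟩
  · apply Subtype.ext
    simpa using h1 t
  · rintro s t (rfl | rfl)
    · apply Subtype.ext
      simpa using h2 s
    · apply Subtype.ext
      simpa using h3 s

lemma exists_continuous_log {X : Type*} [TopologicalSpace X] [LocallyPathConnectedSpace X]
    [SimplyConnectedSpace X] {f : X → ℂ} (hf : Continuous f) (h0 : ∀ x, f x ≠ 0) :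
    ∃ g : X → ℂ, Continuous g ∧ ∀ x, Complex.exp (g x) = f x := by
  have hU : IsSimplyConnected (Set.univ : Set X) :=
    (Homeomorph.Set.univ X).toHomotopyEquiv.simplyConnectedSpace
  obtain ⟨g, hg, he⟩ := Complex.exists_continuousOn_eqOn_exp_comp hU isOpen_univ hf.continuousOn
    (by rintro ⟨x, -, hx⟩; exact h0 x hx)
  exact ⟨g, continuousOn_univ.1 hg, fun x => he (Set.mem_univ x)⟩

lemma exists_log_ratio {K C : Set ℂ} (hK : IsClosed K) (hC : IsPreconnected C)
    (hCK : Disjoint C K) {b b' : ℂ} (hb : b ∈ C) (hb' : b' ∈ C) :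
    ∃ g : ℂ → ℂ, ContinuousOn g K ∧ ∀ z ∈ K, Complex.exp (g z) = (z - b) / (z - b') := by
  have hne : ∀ c ∈ C, ∀ z ∈ K, z - c ≠ 0 := fun c hc z hz h =>
    Set.disjoint_left.1 hCK hc (sub_eq_zero.1 h ▸ hz)
  have hsymm : ∀ b ∈ C, ∀ b' ∈ C, (∃ g : ℂ → ℂ, ContinuousOn g K ∧
      ∀ z ∈ K, Complex.exp (g z) = (z - b) / (z - b')) → (∃ g : ℂ → ℂ, ContinuousOn g K ∧
      ∀ z ∈ K, Complex.exp (g z) = (z - b') / (z - b)) := by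
    rintro b hb b' hb' ⟨g, hg, he⟩
    exact ⟨fun z => - g z, hg.neg, fun z hz => by rw [Complex.exp_neg, he z hz, inv_div]⟩
  refine hC.induction₂' (fun b b' => ∃ g : ℂ → ℂ, ContinuousOn g K ∧
    ∀ z ∈ K, Complex.exp (g z) = (z - b) / (z - b')) (fun u hu => ?_) ?_ hb hb'
  · obtain ⟨δ, hδ, hball⟩ := Metric.isOpen_iff.1 hK.isOpen_compl u
      (Set.disjoint_left.1 hCK hu)
    filter_upwards [self_mem_nhdsWithin, mem_nhdsWithin_of_mem_nhds (Metric.ball_mem_nhds u hδ)]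
      with y hyC hy
    suffices h : ∃ g : ℂ → ℂ, ContinuousOn g K ∧
        ∀ z ∈ K, Complex.exp (g z) = (z - y) / (z - u) from ⟨hsymm _ hyC _ hu h, h⟩
    have hslit : ∀ z ∈ K, (z - y) / (z - u) ∈ Complex.slitPlane := by
      intro z hz
      have h1 : (z - y) / (z - u) = 1 + (u - y) / (z - u) := by
        field_simp [hne u hu z hz]
        ring
      rw [h1]
      apply Complex.mem_slitPlane_of_norm_lt_one
      rw [norm_div, div_lt_one (norm_pos_iff.2 (hne u hu z hz))]
      have h2 : δ ≤ ‖z - u‖ := by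
        by_contra hlt
        exact hball (a := z) (by rw [Metric.mem_ball, dist_eq_norm]; linarith) hz
      rw [Metric.mem_ball, dist_eq_norm, norm_sub_rev] at hy
      linarith
    refine ⟨fun z => Complex.log ((z - y) / (z - u)), ?_, fun z hz => Complex.exp_log ?_⟩
    · refine ContinuousOn.clog (ContinuousOn.div (by fun_prop) (by fun_prop)
        fun z hz => hne u hu z hz) hslit
    · exact Complex.slitPlane_ne_zero (hslit z hz)
  · rintro a b c ha hb hc ⟨g, hg, he⟩ ⟨g', hg', he'⟩
    refine ⟨fun z => g z + g' z, hg.add hg', fun z hz => ?_⟩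
    rw [Complex.exp_add, he z hz, he' z hz]
    have := hne b hb z hz
    have := hne c hc z hz
    field_simp

lemma continuous_const_of_int_valued {f : ℝ → ℂ} (hf : Continuous f)
    (h : ∀ t, ∃ n : ℤ, f t = n * (2 * Real.pi * Complex.I)) (s t : ℝ) : f s = f t := by
  have h2 : (2 * Real.pi * Complex.I : ℂ) ≠ 0 := Complex.two_pi_I_ne_zero
  choose n hn using h
  have hcont : Continuous n := by
    have hc : Continuous fun t => ((n t : ℤ) : ℂ) := by
      have : (fun t => ((n t : ℤ) : ℂ)) = fun t => f t / (2 * Real.pi * Complex.I) := by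
        ext t; rw [hn, mul_div_cancel_right₀ _ h2]
      rw [this]
      exact hf.div_const _
    have hc' : Continuous fun t => ((n t : ℤ) : ℝ) := by
      have := Complex.continuous_re.comp hc
      simpa [Function.comp_def] using this
    exact Int.isClosedEmbedding_coe_real.isInducing.continuous_iff.2 hc'
  have := PreconnectedSpace.constant (α := ℝ) inferInstance hcont (x := s) (y := t)
  rw [hn, hn, this]

lemma zpow_eq_zero_of_log {Ψ L : ℂ → ℂ} (hL : Continuous L) (hLΨ : ∀ z, Complex.exp (L z) = Ψ z)
    {b : ℂ} {c : ℤ} {ρ : ℝ} (hρ : 0 < ρ) (h : ∀ z, ‖z - b‖ = ρ → Ψ z = (z - b) ^ c) : c = 0 := by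
  set w : ℝ → ℂ := fun t => (Real.log ρ : ℂ) + t * Complex.I
  have hw : ∀ t, Complex.exp (w t) = ρ * Complex.exp (t * Complex.I) := by
    intro t
    rw [Complex.exp_add, ← Complex.ofReal_exp, Real.exp_log hρ]
  have key : ∀ s t, (fun t : ℝ => L (b + Complex.exp (w t)) - c * w t) s =
      (fun t : ℝ => L (b + Complex.exp (w t)) - c * w t) t := by
    apply continuous_const_of_int_valued
    · fun_prop
    · intro t
      have h1 : Complex.exp (L (b + Complex.exp (w t))) = Complex.exp (c * w t) := by
        rw [hLΨ, h, Complex.exp_int_mul]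
        · congr 1; ring
        · rw [add_sub_cancel_left, hw, norm_mul, Complex.norm_exp_ofReal_mul_I, Complex.norm_real,
            Real.norm_of_nonneg hρ.le, mul_one]
      obtain ⟨n, hn⟩ := Complex.exp_eq_exp_iff_exists_int.1 h1
      exact ⟨n, by rw [hn]; ring⟩
  have h1 := key 0 (2 * Real.pi)
  have h2 : Complex.exp (w (2 * Real.pi)) = Complex.exp (w 0) := by
    rw [hw, hw]
    simp [Complex.exp_two_pi_mul_I]
  beta_reduce at h1
  rw [h2] at h1
  have h3 : (c : ℂ) * (2 * Real.pi * Complex.I) = 0 := by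
    have h4 : w (2 * Real.pi) = w 0 + 2 * Real.pi * Complex.I := by simp [w]
    rw [h4] at h1
    linear_combination h1
  rcases mul_eq_zero.1 h3 with h | h
  · exact_mod_cast h
  · exact absurd h Complex.two_pi_I_ne_zero

/-- A rational-type function with a zero or pole of order `c` inside a bounded open set and a
continuous logarithm on the frontier has `c = 0`. -/
lemma exponent_eq_zero {U : Set ℂ} (hU : IsOpen U) (hUb : Bornology.IsBounded U) {b : ℂ}
    (hb : b ∈ U) {Q : ℂ → ℂ} (hQ : ContinuousOn Q (closure U)) (hQ0 : ∀ z ∈ closure U, Q z ≠ 0)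
    {c : ℤ} {g : ℂ → ℂ} (hg : ContinuousOn g (frontier U))
    (he : ∀ z ∈ frontier U, Complex.exp (g z) = (z - b) ^ c * Q z) : c = 0 := by
  classical
  obtain ⟨G, hG⟩ := ContinuousMap.exists_restrict_eq (Y := ℂ) (isClosed_frontier (s := U))
    ⟨(frontier U).domRestrict g, hg.domRestrict⟩
  have hGg : ∀ z ∈ frontier U, G z = g z := fun z hz => by
    have := congrArg (fun f => f ⟨z, hz⟩) hG
    exact this
  set Ψ : ℂ → ℂ := fun z => if z ∈ closure U then Complex.exp (G z) / Q z else (z - b) ^ c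
  have hΨU : Set.EqOn Ψ (fun z => Complex.exp (G z) / Q z) (closure U) := fun z hz => by
    simp [Ψ, hz]
  have hΨU' : Set.EqOn Ψ (fun z => (z - b) ^ c) Uᶜ := fun z hz => by
    by_cases hz' : z ∈ closure U
    · have hzf : z ∈ frontier U := by rw [hU.frontier_eq]; exact ⟨hz', hz⟩
      simp only [Ψ, hz', if_true]
      rw [hGg z hzf, he z hzf, mul_div_cancel_right₀ _ (hQ0 z hz')]
    · simp [Ψ, hz']
  have hne : ∀ z ∈ Uᶜ, z - b ≠ 0 := fun z hz h => hz (sub_eq_zero.1 h ▸ hb)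
  have hΨc : Continuous Ψ := by
    rw [← continuousOn_univ]
    have : (Set.univ : Set ℂ) = closure U ∪ Uᶜ := by
      ext z
      by_cases h : z ∈ U
      · simp [subset_closure h]
      · simp [h]
    rw [this]
    refine ContinuousOn.union_of_isClosed ?_ ?_ isClosed_closure hU.isClosed_compl
    · refine ContinuousOn.congr ?_ hΨU
      exact (by fun_prop : ContinuousOn (fun z => Complex.exp (G z)) _).div hQ hQ0
    · refine ContinuousOn.congr ?_ hΨU'
      exact ContinuousOn.zpow₀ (by fun_prop) c fun z hz => Or.inl (hne z hz)
  have hΨ0 : ∀ z, Ψ z ≠ 0 := by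
    intro z
    by_cases h : z ∈ closure U
    · rw [hΨU h]
      exact div_ne_zero (Complex.exp_ne_zero _) (hQ0 z h)
    · have : z ∈ Uᶜ := fun h' => h (subset_closure h')
      rw [hΨU' this]
      exact zpow_ne_zero _ (hne z this)
  obtain ⟨L, hL, hLe⟩ := exists_continuous_log hΨc hΨ0
  obtain ⟨r, hr⟩ := hUb.exists_norm_le
  refine zpow_eq_zero_of_log hL hLe (b := b) (ρ := r + ‖b‖ + 1) ?_ fun z hz => hΨU' fun hzU => ?_
  · have := (norm_nonneg b).trans (hr b hb)
    positivity
  · have := norm_sub_le z b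
    have := hr z hzU
    linarith

lemma exists_glue {K₀ : Set ℂ} (hK₀ : IsClosed K₀) {e : ℝ → ℂ} (he : Continuous e)
    (hinj : Set.InjOn e (Set.Ioo 0 1)) (hdisj : ∀ t ∈ Set.Ioo (0 : ℝ) 1, e t ∉ K₀)
    (h0 : e 0 ∈ K₀) (h1 : e 1 ∈ K₀) {G : ℂ → ℂ} (hG : ContinuousOn G K₀) {L : ℝ → ℂ}
    (hL : Continuous L) (hL0 : L 0 = G (e 0)) (hL1 : L 1 = G (e 1)) :
    ∃ g : ℂ → ℂ, ContinuousOn g (K₀ ∪ e '' Set.Icc 0 1) ∧ Set.EqOn g G K₀ ∧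
      ∀ t ∈ Set.Icc (0 : ℝ) 1, g (e t) = L t := by
  classical
  set g : ℂ → ℂ := fun z => if z ∈ K₀ then G z else L (Function.invFunOn e (Set.Ioo 0 1) z)
  have hg0 : Set.EqOn g G K₀ := fun z hz => by simp [g, hz]
  have hge : ∀ t ∈ Set.Icc (0 : ℝ) 1, g (e t) = L t := by
    rintro t ⟨ht0, ht1⟩
    rcases ht0.eq_or_lt with rfl | ht0
    · rw [hg0 h0, hL0]
    rcases ht1.eq_or_lt with rfl | ht1
    · rw [hg0 h1, hL1]
    have ht : t ∈ Set.Ioo (0 : ℝ) 1 := ⟨ht0, ht1⟩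
    simp only [g, hdisj t ht, if_false]
    rw [hinj.leftInvOn_invFunOn ht]
  refine ⟨g, ContinuousOn.union_of_isClosed (hG.congr hg0) ?_ hK₀
    (isCompact_Icc.image he).isClosed, hg0, hge⟩
  rw [continuousOn_iff_isClosed]
  intro T hT
  refine ⟨e '' (Set.Icc 0 1 ∩ L ⁻¹' T),
    ((isCompact_Icc.inter_right (hT.preimage hL)).image he).isClosed, ?_⟩
  ext z
  constructor
  · rintro ⟨hz, t, ht, rfl⟩
    refine ⟨⟨t, ⟨ht, ?_⟩, rfl⟩, t, ht, rfl⟩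
    simpa [hge t ht] using hz
  · rintro ⟨⟨t, ⟨ht, htT⟩, rfl⟩, hz⟩
    refine ⟨?_, hz⟩
    simpa [hge t ht] using htT

lemma closure_connectedComponentIn_compl {K : Set ℂ} (hK : IsClosed K) {b z : ℂ}
    (hz : z ∈ closure (connectedComponentIn Kᶜ b)) (hzK : z ∉ K) :
    z ∈ connectedComponentIn Kᶜ b := by
  have ho : IsOpen (connectedComponentIn Kᶜ z) := hK.isOpen_compl.connectedComponentIn
  obtain ⟨w, hw, hw'⟩ := mem_closure_iff.1 hz _ ho (mem_connectedComponentIn hzK)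
  rw [connectedComponentIn_eq hw', ← connectedComponentIn_eq hw]
  exact mem_connectedComponentIn hzK

lemma frontier_connectedComponentIn_compl {K : Set ℂ} (hK : IsClosed K) {b : ℂ} :
    frontier (connectedComponentIn Kᶜ b) ⊆ K := by
  intro z hz
  by_contra hzK
  rw [hK.isOpen_compl.connectedComponentIn.frontier_eq] at hz
  exact hz.2 (closure_connectedComponentIn_compl hK hz.1 hzK)

lemma exists_log_along {e : ℝ → ℂ} (he : Continuous e) {b b' : ℂ}
    (hb : ∀ t ∈ Set.Icc (0 : ℝ) 1, e t ≠ b) (hb' : ∀ t ∈ Set.Icc (0 : ℝ) 1, e t ≠ b') {w : ℂ}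
    (hw : Complex.exp w = (e 0 - b) / (e 0 - b')) :
    ∃ L : ℝ → ℂ, Continuous L ∧ L 0 = w ∧
      ∀ t ∈ Set.Icc (0 : ℝ) 1, Complex.exp (L t) = (e t - b) / (e t - b') := by
  set p : ℝ → ℝ := fun t => Set.projIcc 0 1 zero_le_one t
  have hp : ∀ t, p t ∈ Set.Icc (0 : ℝ) 1 := fun t => Subtype.prop _
  have hpe : ∀ t ∈ Set.Icc (0 : ℝ) 1, p t = t := fun t ht => by
    simp [p, Set.projIcc_of_mem _ ht]
  have hpc : Continuous p := continuous_subtype_val.comp continuous_projIcc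
  have h0 : ∀ t, e (p t) - b ≠ 0 := fun t => sub_ne_zero.2 (hb _ (hp t))
  have h0' : ∀ t, e (p t) - b' ≠ 0 := fun t => sub_ne_zero.2 (hb' _ (hp t))
  obtain ⟨L, hL, hLe⟩ := exists_continuous_log (X := ℝ)
    (f := fun t => (e (p t) - b) / (e (p t) - b'))
    (Continuous.div (by fun_prop) (by fun_prop) h0') (fun t => div_ne_zero (h0 t) (h0' t))
  have h01 : (0 : ℝ) ∈ Set.Icc (0 : ℝ) 1 := by simp
  refine ⟨fun t => L t - L 0 + w, by fun_prop, by simp, fun t ht => ?_⟩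
  rw [Complex.exp_add, Complex.exp_sub, hLe, hLe, hw, hpe t ht, hpe 0 h01]
  have := h0 0
  have := h0' 0
  rw [hpe 0 h01] at *
  field_simp

/-- An open arc attached to a closed set is adjacent to at most two complementary components:
three points that are not separated by the closed set cannot lie in three different bounded
components once the arc is added. -/
theorem exists_connectedComponentIn_eq_of_arc {K₀ C : Set ℂ} (hK₀ : IsClosed K₀) {e : ℝ → ℂ}
    (he : Continuous e) (hinj : Set.InjOn e (Set.Ioo 0 1))
    (hdisj : ∀ t ∈ Set.Ioo (0 : ℝ) 1, e t ∉ K₀) (h0 : e 0 ∈ K₀) (h1 : e 1 ∈ K₀)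
    (hC : IsPreconnected C) (hCK : Disjoint C K₀) {K : Set ℂ} (hK : K = K₀ ∪ e '' Set.Icc 0 1)
    {b₁ b₂ b₃ : ℂ} (hb₁ : b₁ ∈ C) (hb₂ : b₂ ∈ C) (hb₃ : b₃ ∈ C)
    (hk₁ : b₁ ∉ K) (hk₂ : b₂ ∉ K) (hk₃ : b₃ ∉ K)
    (hbd₂ : Bornology.IsBounded (connectedComponentIn Kᶜ b₂))
    (hbd₃ : Bornology.IsBounded (connectedComponentIn Kᶜ b₃)) :
    b₁ ∈ connectedComponentIn Kᶜ b₂ ∨ b₁ ∈ connectedComponentIn Kᶜ b₃ ∨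
      b₂ ∈ connectedComponentIn Kᶜ b₃ := by
  by_contra! hcon
  obtain ⟨h12, h13, h23⟩ := hcon
  have hKc : IsClosed K := hK ▸ hK₀.union (isCompact_Icc.image he).isClosed
  have heK : ∀ t ∈ Set.Icc (0 : ℝ) 1, e t ∈ K := fun t ht => hK ▸ Or.inr ⟨t, ht, rfl⟩
  have hK₀K : K₀ ⊆ K := hK ▸ Set.subset_union_left
  have hne : ∀ b ∉ K, ∀ t ∈ Set.Icc (0 : ℝ) 1, e t ≠ b := fun b hb t ht h => hb (h ▸ heK t ht)
  obtain ⟨g₂, hg₂, hg₂e⟩ := exists_log_ratio hK₀ hC hCK hb₁ hb₂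
  obtain ⟨g₃, hg₃, hg₃e⟩ := exists_log_ratio hK₀ hC hCK hb₁ hb₃
  obtain ⟨l₂, hl₂, hl₂0, hl₂e⟩ := exists_log_along he (hne _ hk₁) (hne _ hk₂) (hg₂e _ h0)
  obtain ⟨l₃, hl₃, hl₃0, hl₃e⟩ := exists_log_along he (hne _ hk₁) (hne _ hk₃) (hg₃e _ h0)
  have h11 : (1 : ℝ) ∈ Set.Icc (0 : ℝ) 1 := by simp
  obtain ⟨j₂, hj₂⟩ := Complex.exp_eq_exp_iff_exists_int.1 ((hl₂e 1 h11).trans (hg₂e _ h1).symm)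
  obtain ⟨j₃, hj₃⟩ := Complex.exp_eq_exp_iff_exists_int.1 ((hl₃e 1 h11).trans (hg₃e _ h1).symm)
  have hcl : ∀ b b' : ℂ, b ∉ K → b ∉ connectedComponentIn Kᶜ b' →
      ∀ z ∈ closure (connectedComponentIn Kᶜ b'), z - b ≠ 0 := fun b b' hb hbb z hz h => by
    rw [sub_eq_zero.1 h] at hz
    exact hbb (closure_connectedComponentIn_compl hKc hz hb)
  have hKne : ∀ b ∉ K, ∀ z ∈ K, z - b ≠ 0 := fun b hb z hz h => hb (sub_eq_zero.1 h ▸ hz)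
  have hj₂0 : j₂ = 0 := by
    obtain ⟨g, hg, hg0, hge⟩ := exists_glue hK₀ he hinj hdisj h0 h1
      (G := fun z => j₃ * g₂ z - j₂ * g₃ z) (by fun_prop) (L := fun t => j₃ * l₂ t - j₂ * l₃ t)
      (by fun_prop) (by simp [hl₂0, hl₃0]) (by rw [hj₂, hj₃]; ring)
    rw [← hK] at hg
    have hgexp : ∀ z ∈ K, Complex.exp (g z) =
        ((z - b₁) / (z - b₂)) ^ j₃ / ((z - b₁) / (z - b₃)) ^ j₂ := by
      intro z hz
      rw [hK] at hz
      rcases hz with hz | ⟨t, ht, rfl⟩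
      · rw [hg0 hz, Complex.exp_sub, Complex.exp_int_mul, Complex.exp_int_mul, hg₂e z hz,
          hg₃e z hz]
      · rw [hge t ht, Complex.exp_sub, Complex.exp_int_mul, Complex.exp_int_mul, hl₂e t ht,
          hl₃e t ht]
    refine exponent_eq_zero (hKc.isOpen_compl.connectedComponentIn) hbd₃
      (mem_connectedComponentIn hk₃)
      (Q := fun z => ((z - b₁) / (z - b₂)) ^ j₃ / (z - b₁) ^ j₂) ?_ ?_ (hg.mono
        (frontier_connectedComponentIn_compl hKc)) fun z hz => ?_
    · have a1 := hcl _ _ hk₁ h13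
      have a2 := hcl _ _ hk₂ h23
      refine ContinuousOn.div (ContinuousOn.zpow₀ (ContinuousOn.div (by fun_prop) (by fun_prop) a2)
        _ fun z hz => Or.inl (div_ne_zero (a1 z hz) (a2 z hz)))
        (ContinuousOn.zpow₀ (by fun_prop) _ fun z hz => Or.inl (a1 z hz))
        fun z hz => zpow_ne_zero _ (a1 z hz)
    · have a1 := hcl _ _ hk₁ h13
      have a2 := hcl _ _ hk₂ h23
      exact fun z hz => div_ne_zero (zpow_ne_zero _ (div_ne_zero (a1 z hz) (a2 z hz)))
        (zpow_ne_zero _ (a1 z hz))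
    · have hzK := frontier_connectedComponentIn_compl hKc hz
      rw [hgexp z hzK, div_zpow _ (z - b₃)]
      have := zpow_ne_zero j₂ (hKne _ hk₁ z hzK)
      have := zpow_ne_zero j₂ (hKne _ hk₃ z hzK)
      field_simp
  subst hj₂0
  obtain ⟨g, hg, hg0, hge⟩ := exists_glue hK₀ he hinj hdisj h0 h1 hg₂ hl₂ hl₂0 (by simp [hj₂])
  rw [← hK] at hg
  have : (-1 : ℤ) = 0 := by
    refine exponent_eq_zero (hKc.isOpen_compl.connectedComponentIn) hbd₂
      (mem_connectedComponentIn hk₂) (Q := fun z => z - b₁) (by fun_prop) (hcl _ _ hk₁ h12)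
      (hg.mono (frontier_connectedComponentIn_compl hKc)) fun z hz => ?_
    have hzK := frontier_connectedComponentIn_compl hKc hz
    rw [zpow_neg_one, mul_comm, ← div_eq_mul_inv]
    rw [hK] at hzK
    rcases hzK with hz | ⟨t, ht, rfl⟩
    · rw [hg0 hz, hg₂e z hz]
    · rw [hge t ht, hl₂e t ht]
  omega

/-- Finitely many arcs with pairwise disjoint interiors attached to each other and to a compact
set `S`, such that removing the interior of one arc never disconnects the points of `A` from each
other nor from the enclosing circle of radius `R`. -/
structure ArcSystem (A : Set ℂ) (ι : Type) (R : ℝ) where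
  S : Set ℂ
  e : ι → ℝ → ℂ
  isCompact_S : IsCompact S
  continuous_e : ∀ i, Continuous (e i)
  injOn_e : ∀ i, Set.InjOn (e i) (Set.Ioo 0 1)
  e_notMem_S : ∀ i, ∀ t ∈ Set.Ioo (0 : ℝ) 1, e i t ∉ S
  e_ne : ∀ i j, i ≠ j → ∀ t ∈ Set.Ioo (0 : ℝ) 1, ∀ s ∈ Set.Icc (0 : ℝ) 1, e i t ≠ e j s
  e_zero : ∀ i, e i 0 ∈ S ∪ ⋃ j ∈ {j | j ≠ i}, e j '' Set.Icc 0 1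
  e_one : ∀ i, e i 1 ∈ S ∪ ⋃ j ∈ {j | j ≠ i}, e j '' Set.Icc 0 1
  sphere_subset : Metric.sphere 0 R ⊆ S
  subset_S : A ⊆ S
  exists_isPreconnected : ∀ i, ∃ C : Set ℂ, IsPreconnected C ∧
    C ⊆ (S ∪ ⋃ j, e j '' Set.Icc 0 1) \ e i '' Set.Ioo 0 1 ∧ A ⊆ C ∧ ∃ c ∈ C, ‖c‖ = R

lemma IsPreconnected.norm_lt {C : Set ℂ} (hC : IsPreconnected C) {R : ℝ}
    (hR : ∀ z ∈ C, ‖z‖ ≠ R) {z w : ℂ} (hz : z ∈ C) (hw : w ∈ C) (hzR : ‖z‖ < R) : ‖w‖ < R := by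
  by_contra h
  obtain ⟨v, hv, hvR⟩ := (hC.image norm continuous_norm.continuousOn).ordConnected.out
    ⟨z, hz, rfl⟩ ⟨w, hw, rfl⟩ ⟨hzR.le, not_lt.1 h⟩
  exact hR v hv hvR

lemma exists_path_of_mem_connectedComponentIn {A K : Set ℂ} (hK : IsClosed K) (hA : A ⊆ K)
    {z z' : {z : ℂ // z ∉ A}} (h : (z' : ℂ) ∈ connectedComponentIn Kᶜ z) :
    ∃ τ : Path z z', ∀ t, (τ t : ℂ) ∉ K := by
  have hzK : (z : ℂ) ∈ Kᶜ := connectedComponentIn_nonempty_iff.1 ⟨_, h⟩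
  have hpc : IsPathConnected (connectedComponentIn Kᶜ (z : ℂ)) :=
    (hK.isOpen_compl.connectedComponentIn.isConnected_iff_isPathConnected).1
      (isConnected_connectedComponentIn_iff.2 hzK)
  obtain ⟨p, hp⟩ := hpc.joinedIn z (mem_connectedComponentIn hzK) z' h
  have hpK : ∀ t, p t ∉ K := fun t => connectedComponentIn_subset _ _ (hp t)
  exact ⟨⟨⟨fun t => ⟨p t, fun ht => hpK t (hA ht)⟩, by fun_prop⟩, by simp, by simp⟩, hpK⟩

namespace ArcSystem

variable {A : Set ℂ} {ι : Type} {R : ℝ} (Γ : ArcSystem A ι R)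

/-- The union of all the arcs and the base set. -/
def carrier : Set ℂ := Γ.S ∪ ⋃ j, Γ.e j '' Set.Icc 0 1

/-- The union of the base set and all arcs except one. -/
def rest (i : ι) : Set ℂ := Γ.S ∪ ⋃ j ∈ {j | j ≠ i}, Γ.e j '' Set.Icc 0 1

/-- The interior of an arc. -/
def inner (i : ι) : Set ℂ := Γ.e i '' Set.Ioo 0 1

lemma carrier_eq (i : ι) : Γ.carrier = Γ.rest i ∪ Γ.e i '' Set.Icc 0 1 := by
  ext z
  simp only [carrier, rest, Set.mem_union, Set.mem_iUnion, Set.mem_ofPred_eq, exists_prop]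
  constructor
  · rintro (h | ⟨j, h⟩)
    · exact Or.inl (Or.inl h)
    · by_cases hj : j = i
      · exact Or.inr (hj ▸ h)
      · exact Or.inl (Or.inr ⟨j, hj, h⟩)
  · rintro ((h | ⟨j, -, h⟩) | h)
    · exact Or.inl h
    · exact Or.inr ⟨j, h⟩
    · exact Or.inr ⟨i, h⟩

lemma notMem_rest (i : ι) (t : ℝ) (ht : t ∈ Set.Ioo (0 : ℝ) 1) : Γ.e i t ∉ Γ.rest i := by
  simp only [rest, Set.mem_union, Set.mem_iUnion, Set.mem_ofPred_eq, exists_prop]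
  rintro (h | ⟨j, hj, s, hs, h⟩)
  · exact Γ.e_notMem_S i t ht h
  · exact Γ.e_ne i j (Ne.symm hj) t ht s hs h.symm

lemma S_subset_carrier : Γ.S ⊆ Γ.carrier := Set.subset_union_left

lemma subset_carrier : A ⊆ Γ.carrier := Γ.subset_S.trans Γ.S_subset_carrier

lemma notMem_S_of_mem_inner {i : ι} {z : ℂ} (hz : z ∈ Γ.inner i) : z ∉ Γ.S := by
  obtain ⟨t, ht, rfl⟩ := hz
  exact Γ.e_notMem_S i t ht

lemma disjoint_inner_rest (i : ι) {z : ℂ} (hz : z ∈ Γ.inner i) : z ∉ Γ.rest i := by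
  obtain ⟨t, ht, rfl⟩ := hz
  exact Γ.notMem_rest i t ht

lemma isPreconnected_inner (i : ι) : IsPreconnected (Γ.inner i) :=
  isPreconnected_Ioo.image _ (Γ.continuous_e i).continuousOn

lemma norm_ne_of_notMem_S {z : ℂ} (hz : z ∉ Γ.S) : ‖z‖ ≠ R := fun h =>
  hz (Γ.sphere_subset (by simpa using h))

lemma isBounded_connectedComponentIn {z : ℂ} (hz : ‖z‖ < R) :
    Bornology.IsBounded (connectedComponentIn Γ.carrierᶜ z) := by
  by_cases hzK : z ∈ Γ.carrierᶜ
  · refine (Metric.isBounded_ball (x := (0 : ℂ)) (r := R)).subset fun w hw => ?_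
    rw [mem_ball_zero_iff]
    exact isPreconnected_connectedComponentIn.norm_lt (fun v hv => Γ.norm_ne_of_notMem_S
      fun hvS => (connectedComponentIn_subset _ _ hv : v ∈ Γ.carrierᶜ) (Γ.S_subset_carrier hvS))
      (mem_connectedComponentIn hzK) hw hz
  · rw [connectedComponentIn_eq_empty hzK]
    exact Bornology.isBounded_empty

section Finite

variable [Finite ι]

lemma isClosed_carrier : IsClosed Γ.carrier := by
  refine Γ.isCompact_S.isClosed.union (isClosed_iUnion_of_finite fun i => ?_)
  exact (isCompact_Icc.image (Γ.continuous_e i)).isClosed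

lemma isClosed_rest (i : ι) : IsClosed (Γ.rest i) := by
  refine Γ.isCompact_S.isClosed.union (Set.Finite.isClosed_biUnion (Set.toFinite _) fun i _ => ?_)
  exact (isCompact_Icc.image (Γ.continuous_e i)).isClosed

end Finite

/-- The point `z` lies in a complementary component next to the arc `i`. -/
def Adj (i : ι) (z : ℂ) : Prop :=
  z ∉ Γ.carrier ∧ ‖z‖ < R ∧ ∃ C : Set ℂ, IsPreconnected C ∧ (∀ w ∈ C, w ∉ Γ.rest i) ∧ z ∈ C ∧
    (C ∩ Γ.inner i).Nonempty

lemma exists_eq_of_adj [Finite ι] {i : ι} {b₁ b₂ b₃ : ℂ} (h₁ : Γ.Adj i b₁) (h₂ : Γ.Adj i b₂)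
    (h₃ : Γ.Adj i b₃) : b₁ ∈ connectedComponentIn Γ.carrierᶜ b₂ ∨
      b₁ ∈ connectedComponentIn Γ.carrierᶜ b₃ ∨ b₂ ∈ connectedComponentIn Γ.carrierᶜ b₃ := by
  obtain ⟨hk₁, -, C₁, hC₁, hd₁, hb₁, w₁, hw₁, hi₁⟩ := h₁
  obtain ⟨hk₂, hR₂, C₂, hC₂, hd₂, hb₂, w₂, hw₂, hi₂⟩ := h₂
  obtain ⟨hk₃, hR₃, C₃, hC₃, hd₃, hb₃, w₃, hw₃, hi₃⟩ := h₃
  refine exists_connectedComponentIn_eq_of_arc (Γ.isClosed_rest i) (Γ.continuous_e i)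
    (Γ.injOn_e i) (Γ.notMem_rest i) (Γ.e_zero i) (Γ.e_one i)
    (C := C₁ ∪ (C₂ ∪ (C₃ ∪ Γ.inner i))) ?_ ?_ (Γ.carrier_eq i) (by simp [hb₁]) (by simp [hb₂])
    (by simp [hb₃]) hk₁ hk₂ hk₃ (Γ.isBounded_connectedComponentIn hR₂)
    (Γ.isBounded_connectedComponentIn hR₃)
  · refine IsPreconnected.union w₁ hw₁ (by simp [hi₁]) hC₁ ?_
    refine IsPreconnected.union w₂ hw₂ (by simp [hi₂]) hC₂ ?_
    exact IsPreconnected.union w₃ hw₃ hi₃ hC₃ (Γ.isPreconnected_inner i)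
  · rw [Set.disjoint_left]
    rintro z (h | h | h | h)
    · exact hd₁ z h
    · exact hd₂ z h
    · exact hd₃ z h
    · exact Γ.disjoint_inner_rest i h

lemma exists_code [Finite ι] : ∃ code : ι → ℂ → Bool, ∀ i z z', Γ.Adj i z → Γ.Adj i z' →
    code i z = code i z' → z' ∈ connectedComponentIn Γ.carrierᶜ z := by
  classical
  suffices ∀ i, ∃ code : ℂ → Bool, ∀ z z', Γ.Adj i z → Γ.Adj i z' →
      code z = code z' → z' ∈ connectedComponentIn Γ.carrierᶜ z by
    choose code hcode using this
    exact ⟨code, hcode⟩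
  intro i
  by_cases hex : ∃ b, Γ.Adj i b
  · obtain ⟨b, hb⟩ := hex
    refine ⟨fun z => decide (z ∈ connectedComponentIn Γ.carrierᶜ b), fun z z' hz hz' h => ?_⟩
    rw [decide_eq_decide] at h
    by_cases h1 : z ∈ connectedComponentIn Γ.carrierᶜ b
    · rw [← connectedComponentIn_eq h1]
      exact h.1 h1
    · rcases Γ.exists_eq_of_adj hz' hz hb with h2 | h2 | h2
      · exact h2
      · exact absurd (h.2 h2) h1
      · exact absurd h2 h1
  · exact ⟨fun _ => true, fun z z' hz => absurd ⟨z, hz⟩ hex⟩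

lemma path_norm_lt {z z' : {z : ℂ // z ∉ A}} (φ : Path z z') (hφ : ∀ t, (φ t : ℂ) ∉ Γ.S)
    (hz : ‖(z : ℂ)‖ < R) (t : I) : ‖(φ t : ℂ)‖ < R := by
  refine IsPreconnected.norm_lt (C := Set.range fun t => (φ t : ℂ))
    (isPreconnected_range (by fun_prop)) ?_ ⟨0, rfl⟩ ⟨t, rfl⟩ (by simpa using hz)
  rintro _ ⟨t, rfl⟩
  exact Γ.norm_ne_of_notMem_S (hφ t)

/-- A loop meeting the system inside a single arc is contractible. -/
lemma homotopic_refl (hA : A.Finite) (i : ι) {z : {z : ℂ // z ∉ A}} (L : Path z z)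
    (hL : ∀ t, (L t : ℂ) ∈ Γ.carrier → (L t : ℂ) ∈ Γ.inner i) (hz : ‖(z : ℂ)‖ < R) :
    L.Homotopic (Path.refl z) := by
  obtain ⟨C, hC, hCK, hAC, c, hcC, hcR⟩ := Γ.exists_isPreconnected i
  have hR : 0 < R := (norm_nonneg _).trans_lt hz
  have hLS : ∀ t, (L t : ℂ) ∉ Γ.S := fun t ht =>
    Γ.notMem_S_of_mem_inner (hL t (Γ.S_subset_carrier ht)) ht
  refine Path.homotopic_refl_of_isPreconnected hA L
    (C := C ∪ (fun s : ℝ => (s : ℂ) * c) '' Set.Ici 1) ?_ (fun a ha => Or.inl (hAC ha)) ?_ ?_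
  · exact IsPreconnected.union c hcC ⟨1, by simp, by simp⟩ hC
      (isPreconnected_Ici.image _ (by fun_prop))
  · rintro t (ht | ⟨s, hs, hst⟩)
    · exact (hCK ht).2 (hL t (hCK ht).1)
    · have h1 := Γ.path_norm_lt L hLS hz t
      rw [← hst, norm_mul, Complex.norm_real, Real.norm_of_nonneg (zero_le_one.trans hs), hcR] at h1
      have : (1 : ℝ) ≤ s := hs
      nlinarith
  · intro r
    refine ⟨_, Or.inr ⟨|r| / R + 1, ?_, rfl⟩, ?_⟩
    · have : 0 ≤ |r| / R := by positivity
      simpa using this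
    · rw [norm_mul, Complex.norm_real, Real.norm_of_nonneg (by positivity), hcR, add_mul,
        div_mul_cancel₀ _ hR.ne']
      have := le_abs_self r
      linarith

/-- The path `φ` crosses the system exactly in the interior of the arc `i`. -/
def Crosses (i : ι) {z z' : {z : ℂ // z ∉ A}} (φ : Path z z') : Prop :=
  (z : ℂ) ∉ Γ.carrier ∧ (z' : ℂ) ∉ Γ.carrier ∧
    (∀ t, (φ t : ℂ) ∈ Γ.carrier → (φ t : ℂ) ∈ Γ.inner i) ∧ ∃ t, (φ t : ℂ) ∈ Γ.inner i

/-- The class `c` is represented by a path from `x` to `z` with crossing word `l`. -/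
def Reach (code : ι → ℂ → Bool) (x : {z : ℂ // z ∉ A}) : List (ι × Bool) →
    (z : {z : ℂ // z ∉ A}) → Path.Homotopic.Quotient x z → Prop
  | [], z, c => ∃ τ : Path x z, (∀ t, (τ t : ℂ) ∉ Γ.carrier) ∧ c = .mk τ
  | a :: l, z, c => ∃ z₀ c₀, Reach code x l z₀ c₀ ∧ ∃ (z₁ : _) (φ : Path z₀ z₁) (τ : Path z₁ z),
      Γ.Crosses a.1 φ ∧ a.2 = code a.1 z₁ ∧ (∀ t, (τ t : ℂ) ∉ Γ.carrier) ∧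
        c = (c₀.trans (.mk φ)).trans (.mk τ)

variable {Γ} {code : ι → ℂ → Bool} {x : {z : ℂ // z ∉ A}}

lemma forall_trans {P : ℂ → Prop} {u v w : {z : ℂ // z ∉ A}} {p : Path u v} {q : Path v w}
    (hp : ∀ t, P (p t)) (hq : ∀ t, P (q t)) (t : I) : P (p.trans q t) := by
  have : p.trans q t ∈ Set.range (p.trans q) := ⟨t, rfl⟩
  rw [Path.trans_range] at this
  rcases this with ⟨s, hs⟩ | ⟨s, hs⟩
  · exact hs ▸ hp s
  · exact hs ▸ hq s

lemma notMem_trans {u v w : {z : ℂ // z ∉ A}} {p : Path u v} {q : Path v w} {K : Set ℂ}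
    (hp : ∀ t, (p t : ℂ) ∉ K) (hq : ∀ t, (q t : ℂ) ∉ K) (t : I) : (p.trans q t : ℂ) ∉ K :=
  forall_trans (P := fun w => w ∉ K) hp hq t

lemma Crosses.norm_lt {i : ι} {z z' : {z : ℂ // z ∉ A}} {φ : Path z z'} (h : Γ.Crosses i φ)
    (hz : ‖(z : ℂ)‖ < R) (t : I) : ‖(φ t : ℂ)‖ < R :=
  Γ.path_norm_lt φ (fun t ht => Γ.notMem_S_of_mem_inner (h.2.2.1 t (Γ.S_subset_carrier ht)) ht) hz t

lemma Crosses.adj {i : ι} {z z' : {z : ℂ // z ∉ A}} {φ : Path z z'} (h : Γ.Crosses i φ)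
    (hz : ‖(z : ℂ)‖ < R) : Γ.Adj i z' := by
  refine ⟨h.2.1, by simpa using h.norm_lt hz 1, Set.range fun t => (φ t : ℂ),
    isPreconnected_range (by fun_prop), ?_, ⟨1, by simp⟩, ?_⟩
  · rintro _ ⟨t, rfl⟩ ht
    refine Γ.disjoint_inner_rest i (h.2.2.1 t ?_) ht
    rw [Γ.carrier_eq i]
    exact Or.inl ht
  · obtain ⟨t, ht⟩ := h.2.2.2
    exact ⟨_, ⟨t, rfl⟩, ht⟩

lemma Reach.norm_lt (hx : ‖(x : ℂ)‖ < R) {l : List (ι × Bool)} {z : {z : ℂ // z ∉ A}}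
    {c : Path.Homotopic.Quotient x z} (h : Γ.Reach code x l z c) : ‖(z : ℂ)‖ < R := by
  induction l generalizing z with
  | nil =>
    obtain ⟨τ, hτ, -⟩ := h
    simpa using Γ.path_norm_lt τ (fun t ht => hτ t (Γ.S_subset_carrier ht)) hx 1
  | cons a l ih =>
    obtain ⟨z₀, c₀, h₀, z₁, φ, τ, hφ, -, hτ, -⟩ := h
    have h1 : ‖(z₁ : ℂ)‖ < R := by simpa using hφ.norm_lt (ih h₀) 1
    simpa using Γ.path_norm_lt τ (fun t ht => hτ t (Γ.S_subset_carrier ht)) h1 1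

lemma Reach.move {l : List (ι × Bool)} {z z' : {z : ℂ // z ∉ A}}
    {c : Path.Homotopic.Quotient x z} (h : Γ.Reach code x l z c) (τ : Path z z')
    (hτ : ∀ t, (τ t : ℂ) ∉ Γ.carrier) : Γ.Reach code x l z' (c.trans (.mk τ)) := by
  cases l with
  | nil =>
    obtain ⟨τ', hτ', rfl⟩ := h
    exact ⟨τ'.trans τ, notMem_trans hτ' hτ, rfl⟩
  | cons a l =>
    obtain ⟨z₀, c₀, h₀, z₁, φ, τ', hφ, ha, hτ', rfl⟩ := h
    refine ⟨z₀, c₀, h₀, z₁, φ, τ'.trans τ, hφ, ha, notMem_trans hτ' hτ, ?_⟩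
    rw [Path.Homotopic.Quotient.mk_trans]
    simp only [Path.Homotopic.Quotient.trans_assoc]

lemma Reach.cross {l : List (ι × Bool)} {z z' : {z : ℂ // z ∉ A}}
    {c : Path.Homotopic.Quotient x z} (h : Γ.Reach code x l z c) {i : ι} (φ : Path z z')
    (hφ : Γ.Crosses i φ) : Γ.Reach code x ((i, code i z') :: l) z' (c.trans (.mk φ)) := by
  refine ⟨z, c, h, z', φ, Path.refl z', hφ, rfl, fun t => hφ.2.1, ?_⟩
  simp

lemma Reach.exists_path [Finite ι] (hA : A.Finite) (hcode : ∀ i z z', Γ.Adj i z → Γ.Adj i z' →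
    code i z = code i z' → z' ∈ connectedComponentIn Γ.carrierᶜ z)
    (hx : ‖(x : ℂ)‖ < R) {l : List (ι × Bool)} {z z' : {z : ℂ // z ∉ A}}
    {c : Path.Homotopic.Quotient x z} {c' : Path.Homotopic.Quotient x z'}
    (h : Γ.Reach code x l z c) (h' : Γ.Reach code x l z' c') :
    ∃ τ : Path z z', (∀ t, (τ t : ℂ) ∉ Γ.carrier) ∧ c' = c.trans (.mk τ) := by
  induction l generalizing z z' with
  | nil =>
    obtain ⟨τ, hτ, rfl⟩ := h
    obtain ⟨τ', hτ', rfl⟩ := h'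
    refine ⟨τ.symm.trans τ', notMem_trans (fun t => hτ _) hτ', ?_⟩
    rw [Path.Homotopic.Quotient.mk_trans, Path.Homotopic.Quotient.mk_symm,
      ← Path.Homotopic.Quotient.trans_assoc]
    simp
  | cons a l ih =>
    obtain ⟨z₀, c₀, h₀, z₁, φ, τ, hφ, ha, hτ, rfl⟩ := h
    obtain ⟨z₀', c₀', h₀', z₁', φ', τ', hφ', ha', hτ', rfl⟩ := h'
    obtain ⟨τ₀, hτ₀, rfl⟩ := ih h₀ h₀'
    obtain ⟨ρ, hρ⟩ := exists_path_of_mem_connectedComponentIn Γ.isClosed_carrier Γ.subset_carrier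
      (hcode a.1 z₁ z₁' (hφ.adj (h₀.norm_lt hx)) (hφ'.adj (h₀'.norm_lt hx)) (ha ▸ ha'))
    have hnull := Γ.homotopic_refl hA a.1 (φ.symm.trans (τ₀.trans (φ'.trans ρ.symm)))
      (forall_trans (P := fun w => w ∈ Γ.carrier → w ∈ Γ.inner a.1)
        (fun t => hφ.2.2.1 _) (forall_trans (P := fun w => w ∈ Γ.carrier → w ∈ Γ.inner a.1)
        (fun t ht => absurd ht (hτ₀ t)) (forall_trans
          (P := fun w => w ∈ Γ.carrier → w ∈ Γ.inner a.1) hφ'.2.2.1 (fun t ht => absurd ht (hρ _)))))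
      (by simpa using hφ.norm_lt (h₀.norm_lt hx) 1)
    rw [← Path.Homotopic.Quotient.eq] at hnull
    simp only [Path.Homotopic.Quotient.mk_trans, Path.Homotopic.Quotient.mk_symm,
      Path.Homotopic.Quotient.mk_refl] at hnull
    have key : (Path.Homotopic.Quotient.mk τ₀).trans (.mk φ') = (Path.Homotopic.Quotient.mk φ).trans (.mk ρ) := by
      have := congrArg (fun q => ((Path.Homotopic.Quotient.mk φ).trans q).trans (.mk ρ)) hnull
      simp only [Path.Homotopic.Quotient.trans_assoc, Path.Homotopic.Quotient.symm_trans,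
        Path.Homotopic.Quotient.trans_refl] at this
      rw [← this, ← Path.Homotopic.Quotient.trans_assoc (Path.Homotopic.Quotient.mk φ),
        Path.Homotopic.Quotient.trans_symm, Path.Homotopic.Quotient.refl_trans]
    refine ⟨τ.symm.trans (ρ.trans τ'), notMem_trans (fun t => hτ _) (notMem_trans hρ hτ'), ?_⟩
    simp only [Path.Homotopic.Quotient.mk_trans, Path.Homotopic.Quotient.mk_symm]
    rw [Path.Homotopic.Quotient.trans_assoc c₀, key]
    simp only [Path.Homotopic.Quotient.trans_assoc]
    rw [← Path.Homotopic.Quotient.trans_assoc (Path.Homotopic.Quotient.mk τ),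
        Path.Homotopic.Quotient.trans_symm, Path.Homotopic.Quotient.refl_trans]

lemma Reach.eq [Finite ι] [Nonempty ι] (hA : A.Finite)
    (hcode : ∀ i z z', Γ.Adj i z → Γ.Adj i z' →
      code i z = code i z' → z' ∈ connectedComponentIn Γ.carrierᶜ z)
    (hx : ‖(x : ℂ)‖ < R) {l : List (ι × Bool)} {z : {z : ℂ // z ∉ A}}
    {c c' : Path.Homotopic.Quotient x z}
    (h : Γ.Reach code x l z c) (h' : Γ.Reach code x l z c') : c = c' := by
  obtain ⟨τ, hτ, rfl⟩ := h.exists_path hA hcode hx h'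
  have := Γ.homotopic_refl hA (Classical.arbitrary ι) τ (fun t ht => absurd ht (hτ t))
    (h.norm_lt hx)
  rw [← Path.Homotopic.Quotient.eq] at this
  simp [this]

end ArcSystem

lemma Path.homotopic_of_convex {A B : Set ℂ} (hB : Convex ℝ B) (hBA : ∀ z ∈ B, z ∉ A)
    {z z' : {z : ℂ // z ∉ A}} (p q : Path z z') (hp : ∀ t, (p t : ℂ) ∈ B)
    (hq : ∀ t, (q t : ℂ) ∈ B) : p.Homotopic q := by
  have hmem : ∀ s t : I, (1 - (s : ℝ)) • (p t : ℂ) + (s : ℝ) • (q t : ℂ) ∈ B := fun s t =>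
    hB (hp t) (hq t) (sub_nonneg.2 s.2.2) s.2.1 (by ring)
  refine ⟨⟨⟨⟨fun x => ⟨(1 - (x.1 : ℝ)) • (p x.2 : ℂ) + (x.1 : ℝ) • (q x.2 : ℂ),
    hBA _ (hmem x.1 x.2)⟩, by fun_prop⟩, fun t => ?_, fun t => ?_⟩, ?_⟩⟩
  · exact Subtype.ext (by simp)
  · exact Subtype.ext (by simp)
  · rintro s t (rfl | rfl)
    · refine Subtype.ext ?_
      simp [← add_mul]
    · refine Subtype.ext ?_
      simp [← add_mul]

lemma Path.subpath_mem_Icc {X : Type*} [TopologicalSpace X] {a b : X} (p : Path a b) {s t : I}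
    (hst : s ≤ t) {P : X → Prop} (h : ∀ q ∈ Set.Icc s t, P (p q)) (r : I) :
    P (p.subpath s t r) := by
  have : p.subpath s t r ∈ Set.range (p.subpath s t) := ⟨r, rfl⟩
  rw [Path.range_subpath_of_le _ _ _ hst] at this
  obtain ⟨q, hq, he⟩ := this
  exact he ▸ h q hq

lemma Path.mk_subpath_trans {X : Type*} [TopologicalSpace X] {a b : X} (p : Path a b)
    (s t u : I) : (Path.Homotopic.Quotient.mk (p.subpath s t)).trans (.mk (p.subpath t u)) =
      .mk (p.subpath s u) := by
  rw [← Path.Homotopic.Quotient.mk_trans, Path.Homotopic.Quotient.eq]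
  exact ⟨Path.Homotopy.subpathTransSubpath p s t u⟩

namespace ArcSystem

variable {A : Set ℂ} {ι : Type} {R : ℝ} {Γ : ArcSystem A ι R} {code : ι → ℂ → Bool}
  {x : {z : ℂ // z ∉ A}}

/-- A path with finitely many hits, all in the interiors of arcs, extends crossing words by at
most the number of hits. -/
lemma Reach.extend {y y' : {z : ℂ // z ∉ A}} (p : Path y y') (H : Finset I) {s t : I}
    (hst : s ≤ t) (hs : (p s : ℂ) ∉ Γ.carrier) (ht : (p t : ℂ) ∉ Γ.carrier)
    (hH : ∀ q ∈ Set.Icc s t, (p q : ℂ) ∈ Γ.carrier → q ∈ H ∧ ∃ i, (p q : ℂ) ∈ Γ.inner i)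
    {l : List (ι × Bool)} {c : Path.Homotopic.Quotient x (p s)}
    (h : Γ.Reach code x l (p s) c) :
    ∃ l', l'.length ≤ l.length + H.card ∧
      Γ.Reach code x l' (p t) (c.trans (.mk (p.subpath s t))) := by
  classical
  induction hn : H.card using Nat.strong_induction_on generalizing H s l with
  | _ n ih =>
  subst hn
  set H' := H.filter fun q => q ∈ Set.Icc s t ∧ (p q : ℂ) ∈ Γ.carrier with hH'
  have hH'mem : ∀ q ∈ Set.Icc s t, (p q : ℂ) ∈ Γ.carrier → q ∈ H' := fun q hq hqK =>
    Finset.mem_filter.2 ⟨(hH q hq hqK).1, hq, hqK⟩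
  rcases H'.eq_empty_or_nonempty with hemp | hne
  · refine ⟨l, by omega, h.move _ fun r => ?_⟩
    refine p.subpath_mem_Icc hst (P := fun w => (w : ℂ) ∉ Γ.carrier) (fun q hq hqK => ?_) r
    have := hH'mem q hq hqK
    rw [hemp] at this
    simp at this
  · set u := H'.min' hne
    have huH' : u ∈ H' := H'.min'_mem hne
    obtain ⟨huH, ⟨hsu, hut⟩, huK⟩ := Finset.mem_filter.1 huH'
    have hsu' : s < u := hsu.lt_of_ne (by rintro h; rw [← h] at huK; exact hs huK)
    have hut' : u < t := hut.lt_of_ne (by rintro h; rw [h] at huK; exact ht huK)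
    have hins : (insert t (H'.filter (u < ·))).Nonempty := Finset.insert_nonempty _ _
    have hv : u < (insert t (H'.filter (u < ·))).min' hins := by
      rw [Finset.lt_min'_iff]
      intro q hq
      rcases Finset.mem_insert.1 hq with rfl | hq
      · exact hut'
      · exact (Finset.mem_filter.1 hq).2
    obtain ⟨w, huw, hwv⟩ := exists_between hv
    rw [Finset.lt_min'_iff] at hwv
    have hwt : w < t := hwv t (Finset.mem_insert_self _ _)
    have honly : ∀ q ∈ Set.Icc s w, (p q : ℂ) ∈ Γ.carrier → q = u := by
      intro q hq hqK
      have hqH := hH'mem q ⟨hq.1, hq.2.trans hwt.le⟩ hqK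
      rcases (H'.min'_le q hqH).eq_or_lt with he | hlt
      · exact he.symm
      · have := hwv q (Finset.mem_insert_of_mem (Finset.mem_filter.2 ⟨hqH, hlt⟩))
        exact absurd hq.2 (not_le.2 this)
    have hwK : (p w : ℂ) ∉ Γ.carrier := fun hwK =>
      huw.ne' (honly w ⟨hsu.trans huw.le, le_rfl⟩ hwK)
    obtain ⟨i, hi⟩ := (hH u ⟨hsu, hut⟩ huK).2
    have hsw : s ≤ w := hsu.trans huw.le
    have hcross : Γ.Crosses i (p.subpath s w) := by
      refine ⟨hs, hwK, ?_, ?_⟩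
      · refine p.subpath_mem_Icc hsw (P := fun z => (z : ℂ) ∈ Γ.carrier → (z : ℂ) ∈ Γ.inner i)
          (fun q hq hqK => ?_)
        rw [honly q hq hqK]
        exact hi
      · have : p u ∈ Set.range (p.subpath s w) := by
          rw [Path.range_subpath_of_le _ _ _ hsw]
          exact ⟨u, ⟨hsu, huw.le⟩, rfl⟩
        obtain ⟨r, hr⟩ := this
        exact ⟨r, by rw [hr]; exact hi⟩
    have hcard := Finset.card_erase_lt_of_mem huH
    obtain ⟨l', hl', hreach⟩ := ih _ hcard (H.erase u) hwt.le hwK (fun q hq hqK => by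
      have := hH q ⟨hsw.trans hq.1, hq.2⟩ hqK
      exact ⟨Finset.mem_erase.2 ⟨(huw.trans_le hq.1).ne', this.1⟩, this.2⟩)
      (h.cross (p.subpath s w) hcross) rfl
    refine ⟨l', ?_, ?_⟩
    · simp only [List.length_cons] at hl'
      omega
    · rwa [Path.Homotopic.Quotient.trans_assoc, Path.mk_subpath_trans] at hreach

end ArcSystem

/-- Rotation of `u` about `v` by the angle `θ`. -/
noncomputable def rotAbout (v u : ℂ) (θ : ℝ) : ℂ := v + (u - v) * Complex.exp (θ * Complex.I)

lemma continuous_rotAbout (v u : ℂ) : Continuous (rotAbout v u) := by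
  unfold rotAbout
  fun_prop

lemma rotAbout_zero (v u : ℂ) : rotAbout v u 0 = u := by simp [rotAbout]

lemma rotAbout_two_pi (v u : ℂ) : rotAbout v u (2 * Real.pi) = u := by
  simp [rotAbout, Complex.exp_two_pi_mul_I]

lemma rotAbout_rotAbout (v u : ℂ) (α β : ℝ) :
    rotAbout v (rotAbout v u α) β = rotAbout v u (α + β) := by
  simp only [rotAbout, add_sub_cancel_left, mul_assoc, ← Complex.exp_add]
  push_cast
  ring_nf

lemma dist_rotAbout (v u : ℂ) (θ : ℝ) : dist (rotAbout v u θ) v = dist u v := by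
  rw [dist_eq_norm, rotAbout, add_sub_cancel_left, norm_mul, Complex.norm_exp_ofReal_mul_I,
    mul_one, dist_eq_norm]

lemma rotAbout_inj {v u : ℂ} (hu : u ≠ v) {α β : ℝ} (h : rotAbout v u α = rotAbout v u β)
    (h1 : α - β < 2 * Real.pi) (h2 : β - α < 2 * Real.pi) : α = β := by
  rw [rotAbout, rotAbout, add_right_inj] at h
  have h3 := mul_left_cancel₀ (sub_ne_zero.2 hu) h
  obtain ⟨n, hn⟩ := Complex.exp_eq_exp_iff_exists_int.1 h3
  have h4 : α = β + n * (2 * Real.pi) := by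
    have : (α : ℂ) = β + n * (2 * Real.pi) := by
      apply mul_right_cancel₀ Complex.I_ne_zero
      rw [hn]; ring
    exact_mod_cast this
  have hpi := Real.pi_pos
  have hn1 : (n : ℝ) < 1 := by
    by_contra hc
    have : (1 : ℝ) ≤ n := not_lt.1 hc
    nlinarith
  have hn2 : (-1 : ℝ) < n := by
    by_contra hc
    have : (n : ℝ) ≤ -1 := not_lt.1 hc
    nlinarith
  have hn0 : n = 0 := by
    have a1 : n < 1 := by exact_mod_cast hn1
    have a2 : -1 < n := by exact_mod_cast hn2
    omega
  simpa [hn0] using h4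

lemma exists_rotAbout_eq {v u w : ℂ} (hu : u ≠ v) (h : dist w v = dist u v) :
    ∃ θ : ℝ, 0 < θ ∧ θ ≤ 2 * Real.pi ∧ rotAbout v u θ = w := by
  have hpi := Real.pi_pos
  set q := (w - v) / (u - v)
  have hq : ‖q‖ = 1 := by
    rw [norm_div, ← dist_eq_norm, ← dist_eq_norm, h, div_self (dist_ne_zero.2 hu)]
  have hexp : Complex.exp (q.arg * Complex.I) = q := by
    have := Complex.norm_mul_exp_arg_mul_I q
    rwa [hq, Complex.ofReal_one, one_mul] at this
  have hrot : rotAbout v u q.arg = w := by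
    rw [rotAbout, hexp, mul_div_cancel₀ _ (sub_ne_zero.2 hu)]
    ring
  rcases lt_or_ge 0 q.arg with h0 | h0
  · exact ⟨q.arg, h0, by linarith [Complex.arg_le_pi q], hrot⟩
  · refine ⟨q.arg + 2 * Real.pi, by linarith [Complex.neg_pi_lt_arg q], by linarith, ?_⟩
    rw [← rotAbout_rotAbout, hrot, rotAbout_two_pi]

/-- A finite nonempty subset of a circle cuts it into arcs, one starting at each point. -/
lemma exists_circle_arcs {v : ℂ} {r : ℝ} (hr : 0 < r) (F : Finset ℂ) (hne : F.Nonempty)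
    (hF : ∀ u ∈ F, dist u v = r) : ∃ ℓ : ℂ → ℝ,
      (∀ u ∈ F, rotAbout v u (ℓ u) ∈ F ∧
        Set.InjOn (fun s => rotAbout v u (s * ℓ u)) (Set.Ioo 0 1) ∧
        (∀ s ∈ Set.Ioo (0 : ℝ) 1, rotAbout v u (s * ℓ u) ∉ F) ∧
        (∀ u' ∈ F, u ≠ u' → ∀ s ∈ Set.Ioo (0 : ℝ) 1, ∀ s' ∈ Set.Icc (0 : ℝ) 1,
          rotAbout v u (s * ℓ u) ≠ rotAbout v u' (s' * ℓ u')) ∧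
        IsPreconnected (Metric.sphere v r \ (fun s => rotAbout v u (s * ℓ u)) '' Set.Ioo 0 1)) ∧
      ∀ w, dist w v = r → w ∉ F → ∃ u ∈ F, ∃ s ∈ Set.Ioo (0 : ℝ) 1,
        rotAbout v u (s * ℓ u) = w := by
  classical
  have hpi := Real.pi_pos
  have huv : ∀ u, dist u v = r → u ≠ v := fun u hu h => by
    rw [h, dist_self] at hu
    exact hr.ne hu
  have hang : ∀ u w : ℂ, ∃ θ : ℝ, dist u v = r → dist w v = r →
      0 < θ ∧ θ ≤ 2 * Real.pi ∧ rotAbout v u θ = w := by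
    intro u w
    by_cases h : dist u v = r ∧ dist w v = r
    · obtain ⟨θ, hθ⟩ := exists_rotAbout_eq (huv u h.1) (h.2.trans h.1.symm)
      exact ⟨θ, fun _ _ => hθ⟩
    · exact ⟨0, fun h1 h2 => absurd ⟨h1, h2⟩ h⟩
  choose ang hang using hang
  have hmin : ∀ u, ∃ w ∈ F, ∀ w' ∈ F, ang u w ≤ ang u w' := fun u => F.exists_min_image _ hne
  choose nxt hnxt hnxtmin using hmin
  have hℓ : ∀ u ∈ F, 0 < ang u (nxt u) ∧ ang u (nxt u) ≤ 2 * Real.pi ∧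
      rotAbout v u (ang u (nxt u)) = nxt u := fun u hu => hang _ _ (hF u hu) (hF _ (hnxt u))
  have hpos : ∀ u ∈ F, ∀ s ∈ Set.Ioo (0 : ℝ) 1, 0 < s * ang u (nxt u) ∧
      s * ang u (nxt u) < ang u (nxt u) := fun u hu s hs => by
    have := (hℓ u hu).1
    exact ⟨mul_pos hs.1 this, by nlinarith [hs.2]⟩
  refine ⟨fun u => ang u (nxt u), fun u hu => ⟨?_, ?_, ?_, ?_, ?_⟩, ?_⟩
  · rw [(hℓ u hu).2.2]
    exact hnxt u
  · intro s hs s' hs' h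
    have a1 := hpos u hu s hs
    have a2 := hpos u hu s' hs'
    have a3 := (hℓ u hu).2.1
    have := rotAbout_inj (huv u (hF u hu)) h (by linarith) (by linarith)
    exact mul_right_cancel₀ (hℓ u hu).1.ne' this
  · intro s hs hsF
    have a1 := hpos u hu s hs
    have a2 := (hℓ u hu).2.1
    obtain ⟨b1, b2, b3⟩ := hang u _ (hF u hu) (hF _ hsF)
    have := rotAbout_inj (huv u (hF u hu)) b3 (by linarith) (by linarith)
    have := hnxtmin u _ hsF
    linarith
  · intro u' hu' huu' s hs s' hs' h
    have a1 := hpos u hu s hs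
    obtain ⟨b1, b2, b3⟩ := hang u u' (hF u hu) (hF u' hu')
    have b4 := hnxtmin u u' hu'
    have b5 : ang u u' < 2 * Real.pi := b2.lt_of_ne fun he => huu' (by
      rw [← b3, he, rotAbout_two_pi])
    have c1 : ang u' u = 2 * Real.pi - ang u u' := by
      obtain ⟨c1, c2, c3⟩ := hang u' u (hF u' hu') (hF u hu)
      refine rotAbout_inj (huv u' (hF u' hu')) ?_ (by linarith) (by linarith)
      have aux : ∀ α, rotAbout v (rotAbout v u α) (2 * Real.pi - α) = u := fun α => by
        rw [rotAbout_rotAbout, add_sub_cancel, rotAbout_two_pi]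
      have := aux (ang u u')
      rw [b3] at this
      rw [c3, this]
    have c2 := hnxtmin u' u hu
    have c3 : s' * ang u' (nxt u') ≤ ang u' (nxt u') := by
      have := (hℓ u' hu').1
      nlinarith [hs'.2]
    have c4 : 0 ≤ s' * ang u' (nxt u') := mul_nonneg hs'.1 (hℓ u' hu').1.le
    have h2 : rotAbout v u (s * ang u (nxt u) + 2 * Real.pi) =
        rotAbout v u (ang u u' + s' * ang u' (nxt u')) := by
      rw [← rotAbout_rotAbout v u (ang u u'), b3, ← h, ← rotAbout_rotAbout, rotAbout,
        Complex.ofReal_mul, Complex.ofReal_ofNat, Complex.exp_two_pi_mul_I]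
      ring
    have := rotAbout_inj (huv u (hF u hu)) h2 (by linarith) (by linarith)
    linarith
  · have himg : Metric.sphere v r \ (fun s => rotAbout v u (s * ang u (nxt u))) '' Set.Ioo 0 1 =
        rotAbout v u '' Set.Icc (ang u (nxt u)) (2 * Real.pi) := by
      ext w
      constructor
      · rintro ⟨hw, hw'⟩
        obtain ⟨b1, b2, b3⟩ := hang u w (hF u hu) hw
        refine ⟨ang u w, ⟨?_, b2⟩, b3⟩
        by_contra hlt
        have hlt := not_le.1 hlt
        refine hw' ⟨ang u w / ang u (nxt u), ⟨by have := (hℓ u hu).1; positivity, ?_⟩, ?_⟩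
        · rwa [div_lt_one (hℓ u hu).1]
        · beta_reduce
          rw [div_mul_cancel₀ _ (hℓ u hu).1.ne', b3]
      · rintro ⟨θ, hθ, rfl⟩
        refine ⟨by rw [Metric.mem_sphere, dist_rotAbout, hF u hu], ?_⟩
        rintro ⟨s, hs, h⟩
        have a1 := hpos u hu s hs
        have := rotAbout_inj (huv u (hF u hu)) h (by linarith [hθ.1]) (by linarith [hθ.2])
        linarith [hθ.1]
    rw [himg]
    exact isPreconnected_Icc.image _ (continuous_rotAbout v u).continuousOn
  · intro w hw hwF
    obtain ⟨u, hu, humin⟩ := F.exists_min_image (fun u => ang u w) hne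
    obtain ⟨b1, b2, b3⟩ := hang u w (hF u hu) hw
    have b4 : ang u w < ang u (nxt u) := by
      by_contra hlt
      have hle := not_lt.1 hlt
      obtain ⟨c1, c2, c3⟩ := hℓ u hu
      have hlt : ang u (nxt u) < ang u w := hle.lt_of_ne fun he => hwF (by
        rw [← b3, ← he, c3]; exact hnxt u)
      obtain ⟨d1, d2, d3⟩ := hang (nxt u) w (hF _ (hnxt u)) hw
      have : ang (nxt u) w = ang u w - ang u (nxt u) := by
        refine rotAbout_inj (huv _ (hF _ (hnxt u))) ?_ (by linarith) (by linarith)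
        rw [d3]
        nth_rewrite 1 [← c3]
        rw [rotAbout_rotAbout, add_sub_cancel, b3]
      have := humin _ (hnxt u)
      linarith
    refine ⟨u, hu, ang u w / ang u (nxt u), ⟨by have := (hℓ u hu).1; positivity, ?_⟩, ?_⟩
    · rwa [div_lt_one (hℓ u hu).1]
    · rw [div_mul_cancel₀ _ (hℓ u hu).1.ne', b3]

/-- A planar skeleton: disjoint circles of radius `r` around the vertices `V`, arcs `c k` between
the circles, and segments joining the circles to the points `a i`. -/
structure Skeleton (A : Set ℂ) (κ α : Type) (R : ℝ) where
  r : ℝ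
  V : Set ℂ
  c : κ → ℝ → ℂ
  p : κ → ℂ
  q : κ → ℂ
  a : α → ℂ
  g : α → ℂ
  u : α → ℂ
  r_pos : 0 < r
  norm_lt_of_dist : ∀ v ∈ V, ∀ z, dist z v = r → ‖z‖ < R
  disjoint : ∀ v ∈ V, ∀ v' ∈ V, v ≠ v' → ∀ z, dist z v = r → dist z v' ≠ r
  continuous_c : ∀ k, Continuous (c k)
  injOn_c : ∀ k, Set.InjOn (c k) (Set.Ioo 0 1)
  lt_dist_c : ∀ k, ∀ t ∈ Set.Ioo (0 : ℝ) 1, ∀ v ∈ V, r < dist (c k t) v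
  norm_c : ∀ k, ∀ t ∈ Set.Ioo (0 : ℝ) 1, ‖c k t‖ < R
  c_notMem_segment : ∀ k, ∀ t ∈ Set.Ioo (0 : ℝ) 1, ∀ i, c k t ∉ segment ℝ (a i) (u i)
  c_ne : ∀ k k', k ≠ k' → ∀ t ∈ Set.Ioo (0 : ℝ) 1, ∀ s ∈ Set.Icc (0 : ℝ) 1, c k t ≠ c k' s
  p_mem : ∀ k, p k ∈ V
  q_mem : ∀ k, q k ∈ V
  dist_c_zero : ∀ k, dist (c k 0) (p k) = r
  dist_c_one : ∀ k, dist (c k 1) (q k) = r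
  g_mem : ∀ i, g i ∈ V
  dist_u : ∀ i, dist (u i) (g i) = r
  eq_u : ∀ i, ∀ z ∈ segment ℝ (a i) (u i), ∀ v ∈ V, dist z v = r → z = u i
  subset_range_a : A ⊆ Set.range a
  exists_norm_a : ∃ i, ‖a i‖ = R
  exists_arc : ∀ v ∈ V, ∃ k, p k = v ∨ q k = v
  x : ℂ
  x_mem : x ∈ V
  connected : ∀ k₀ i, Relation.ReflTransGen
    (fun v w => ∃ k, k ≠ k₀ ∧ (p k = v ∧ q k = w ∨ p k = w ∧ q k = v)) x (g i)

namespace Skeleton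

variable {A : Set ℂ} {κ α : Type} {R : ℝ} (Θ : Skeleton A κ α R)

theorem exists_arcSystem [Fintype κ] [Fintype α] : ∃ (F : Finset ℂ) (Γ : ArcSystem A (κ ⊕ F) R),
    F.card ≤ 2 * Fintype.card κ + Fintype.card α ∧
    (∀ z ∈ Γ.carrier, ‖z‖ < R → (∃ i, z ∈ segment ℝ (Θ.a i) (Θ.u i)) ∨
      (∃ k, z ∈ Θ.c k '' Set.Ioo 0 1 ∧ z ∈ Γ.inner (Sum.inl k)) ∨ ∃ v ∈ Θ.V, dist z v = Θ.r) ∧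
    (∀ v ∈ Θ.V, ∀ z, dist z v = Θ.r → z ∉ F → ∃ i, z ∈ Γ.inner i) ∧
    (∀ z ∈ F, (∃ k, z = Θ.c k 0 ∨ z = Θ.c k 1) ∨ ∃ i, z = Θ.u i) := by
  classical
  set F : Finset ℂ := (Finset.univ.image (fun k => Θ.c k 0) ∪
    Finset.univ.image (fun k => Θ.c k 1)) ∪ Finset.univ.image Θ.u with hF
  have hmemF : ∀ z, z ∈ F ↔ (∃ k, z = Θ.c k 0 ∨ z = Θ.c k 1) ∨ ∃ i, z = Θ.u i := by
    intro z
    simp only [hF, Finset.mem_union, Finset.mem_image, Finset.mem_univ, true_and, exists_or,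
      eq_comm]
  have hcardF : F.card ≤ 2 * Fintype.card κ + Fintype.card α := by
    have h1 : (Finset.univ.image (fun k => Θ.c k 0)).card ≤ Fintype.card κ :=
      Finset.card_image_le
    have h2 : (Finset.univ.image (fun k => Θ.c k 1)).card ≤ Fintype.card κ :=
      Finset.card_image_le
    have h3 : (Finset.univ.image Θ.u).card ≤ Fintype.card α := Finset.card_image_le
    have h4 := Finset.card_union_le (Finset.univ.image (fun k => Θ.c k 0) ∪
      Finset.univ.image (fun k => Θ.c k 1)) (Finset.univ.image Θ.u)
    have h5 := Finset.card_union_le (Finset.univ.image (fun k => Θ.c k 0))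
      (Finset.univ.image (fun k => Θ.c k 1))
    rw [← hF] at h4
    omega
  have hcentre : ∀ z ∈ F, ∃ v ∈ Θ.V, dist z v = Θ.r := by
    intro z hz
    rcases (hmemF z).1 hz with ⟨k, rfl | rfl⟩ | ⟨i, rfl⟩
    · exact ⟨_, Θ.p_mem k, Θ.dist_c_zero k⟩
    · exact ⟨_, Θ.q_mem k, Θ.dist_c_one k⟩
    · exact ⟨_, Θ.g_mem i, Θ.dist_u i⟩
  choose! ctr hctr hdist using hcentre
  have hctr_eq : ∀ z ∈ F, ∀ v ∈ Θ.V, dist z v = Θ.r → ctr z = v := by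
    intro z hz v hv h
    by_contra hne
    exact Θ.disjoint _ (hctr z hz) v hv hne z (hdist z hz) h
  have hFv : ∀ v ∈ Θ.V, (F.filter fun z => dist z v = Θ.r).Nonempty := by
    intro v hv
    obtain ⟨k, rfl | rfl⟩ := Θ.exists_arc v hv
    · exact ⟨Θ.c k 0, Finset.mem_filter.2
        ⟨(hmemF _).2 (Or.inl ⟨k, Or.inl rfl⟩), Θ.dist_c_zero k⟩⟩
    · exact ⟨Θ.c k 1, Finset.mem_filter.2
        ⟨(hmemF _).2 (Or.inl ⟨k, Or.inr rfl⟩), Θ.dist_c_one k⟩⟩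
  have harcs := fun v (hv : v ∈ Θ.V) => exists_circle_arcs (v := v) Θ.r_pos
    (F.filter fun z => dist z v = Θ.r) (hFv v hv) (fun z hz => (Finset.mem_filter.1 hz).2)
  choose! ℓ hℓ hcover using harcs
  set e : κ ⊕ F → ℝ → ℂ := Sum.elim Θ.c
    (fun u s => rotAbout (ctr u) u (s * ℓ (ctr u) u)) with he
  have hedist : ∀ (u : F) s, dist (e (Sum.inr u) s) (ctr u) = Θ.r := fun u s => by
    simp only [he, Sum.elim_inr, dist_rotAbout]
    exact hdist u u.2
  have hufilt : ∀ u : F, (u : ℂ) ∈ F.filter fun z => dist z (ctr u) = Θ.r := fun u =>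
    Finset.mem_filter.2 ⟨u.2, hdist u u.2⟩
  have hℓu := fun u : F => hℓ (ctr u) (hctr u u.2) u (hufilt u)
  have heF : ∀ (u : F), ∀ s ∈ Set.Ioo (0 : ℝ) 1, e (Sum.inr u) s ∉ F := fun u s hs h =>
    (hℓu u).2.2.1 s hs (Finset.mem_filter.2 ⟨h, hedist u s⟩)
  have he0 : ∀ u : F, e (Sum.inr u) 0 = u := fun u => by
    simp [he, rotAbout_zero]
  have he1 : ∀ u : F, e (Sum.inr u) 1 ∈ F := fun u => by
    have := (Finset.mem_filter.1 (hℓu u).1).1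
    simpa [he] using this
  set S : Set ℂ := Metric.sphere 0 R ∪ ⋃ i, segment ℝ (Θ.a i) (Θ.u i) with hS
  have hFrest : ∀ u : F, ∀ z ∈ F,
      z ∈ S ∪ ⋃ j ∈ {j | j ≠ Sum.inr u}, e j '' Set.Icc 0 1 := by
    intro u z hz
    rcases (hmemF z).1 hz with ⟨k, h⟩ | ⟨i, rfl⟩
    · refine Or.inr (Set.mem_iUnion₂.2 ⟨Sum.inl k, Sum.inl_ne_inr, ?_⟩)
      rcases h with rfl | rfl
      · exact ⟨0, by simp, rfl⟩
      · exact ⟨1, by simp, rfl⟩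
    · exact Or.inl (Or.inr (Set.mem_iUnion.2 ⟨i, right_mem_segment _ _ _⟩))
  have hene : ∀ i j, i ≠ j → ∀ t ∈ Set.Ioo (0 : ℝ) 1, ∀ s ∈ Set.Icc (0 : ℝ) 1, e i t ≠ e j s := by
    rintro (k | u) (k' | u') hij t ht s hs h
    · exact Θ.c_ne k k' (fun h => hij (by rw [h])) t ht s hs h
    · have h1 := Θ.lt_dist_c k t ht _ (hctr u' u'.2)
      have h2 := hedist u' s
      rw [← h] at h2
      exact h1.ne' h2
    · rcases hs.1.eq_or_lt with rfl | h0
      · exact heF u t ht (h ▸ (hmemF _).2 (Or.inl ⟨k', Or.inl rfl⟩))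
      · rcases hs.2.eq_or_lt with rfl | h1
        · exact heF u t ht (h ▸ (hmemF _).2 (Or.inl ⟨k', Or.inr rfl⟩))
        · have h1 := Θ.lt_dist_c k' s ⟨h0, h1⟩ _ (hctr u u.2)
          have h2 := hedist u t
          rw [h] at h2
          exact h1.ne' h2
    · have huu : (u : ℂ) ≠ u' := fun h => hij (by rw [Subtype.ext h])
      by_cases hc : ctr u = ctr u'
      · have := (hℓu u).2.2.2.1 u' (hc ▸ hufilt u') huu t ht s hs
        rw [hc] at this
        simp only [he, Sum.elim_inr, hc] at h
        exact this h
      · refine Θ.disjoint _ (hctr u u.2) _ (hctr u' u'.2) hc _ (hedist u t) ?_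
        rw [h]
        exact hedist u' s
  have heS : ∀ i, ∀ t ∈ Set.Ioo (0 : ℝ) 1, e i t ∉ S := by
    rintro (k | u) t ht (h | h)
    · rw [mem_sphere_zero_iff_norm] at h
      exact (Θ.norm_c k t ht).ne h
    · obtain ⟨i, hi⟩ := Set.mem_iUnion.1 h
      exact Θ.c_notMem_segment k t ht i hi
    · rw [mem_sphere_zero_iff_norm] at h
      exact (Θ.norm_lt_of_dist _ (hctr u u.2) _ (hedist u t)).ne h
    · obtain ⟨i, hi⟩ := Set.mem_iUnion.1 h
      have := Θ.eq_u i _ hi _ (hctr u u.2) (hedist u t)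
      exact heF u t ht (this ▸ (hmemF _).2 (Or.inr ⟨i, rfl⟩))
  have hcont : ∀ i, Continuous (e i) := by
    rintro (k | u)
    · exact Θ.continuous_c k
    · exact (continuous_rotAbout _ _).comp (continuous_id.mul continuous_const)
  have hcover' : ∀ v ∈ Θ.V, ∀ z, dist z v = Θ.r → z ∉ F →
      ∃ i, z ∈ e i '' Set.Ioo 0 1 := by
    intro v hv z hz hzF
    obtain ⟨u, hu, s, hs, h⟩ := hcover v hv z hz
      (fun h => hzF (Finset.mem_filter.1 h).1)
    have huF := (Finset.mem_filter.1 hu).1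
    refine ⟨Sum.inr ⟨u, huF⟩, s, hs, ?_⟩
    simp only [he, Sum.elim_inr, hctr_eq u huF v hv (Finset.mem_filter.1 hu).2]
    exact h
  have hpre : ∀ i, ∃ C : Set ℂ, IsPreconnected C ∧
      C ⊆ (S ∪ ⋃ j, e j '' Set.Icc 0 1) \ e i '' Set.Ioo 0 1 ∧ A ⊆ C ∧ ∃ c ∈ C, ‖c‖ = R := by
    intro i
    set K := (S ∪ ⋃ j, e j '' Set.Icc 0 1) with hK
    have hSK : S ⊆ K \ e i '' Set.Ioo 0 1 := fun z hz => ⟨Or.inl hz, by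
      rintro ⟨t, ht, rfl⟩; exact heS i t ht hz⟩
    have hjK : ∀ j, j ≠ i → e j '' Set.Icc 0 1 ⊆ K \ e i '' Set.Ioo 0 1 := by
      rintro j hj _ ⟨s, hs, rfl⟩
      refine ⟨Or.inr (Set.mem_iUnion.2 ⟨j, s, hs, rfl⟩), ?_⟩
      rintro ⟨t, ht, h⟩
      exact hene i j hj.symm t ht s hs h
    have hFi : ∀ z ∈ F, z ∉ e i '' Set.Ioo 0 1 := by
      rintro z hz ⟨t, ht, rfl⟩
      rcases i with k | u
      · have h1 := Θ.lt_dist_c k t ht _ (hctr _ hz)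
        exact h1.ne' (hdist _ hz)
      · exact heF u t ht hz
    set D : ℂ → Set ℂ := fun v => Metric.sphere v Θ.r \ e i '' Set.Ioo 0 1 with hD
    have hFD : ∀ v ∈ Θ.V, ∀ z ∈ F, dist z v = Θ.r → z ∈ D v := fun v hv z hz h =>
      ⟨h, hFi z hz⟩
    have hDK : ∀ v ∈ Θ.V, D v ⊆ K \ e i '' Set.Ioo 0 1 := by
      intro v hv z hz
      refine ⟨?_, hz.2⟩
      by_cases hzF : z ∈ F
      · exact Or.inr (Set.mem_iUnion.2 ⟨Sum.inr ⟨z, hzF⟩, 0, by simp, he0 _⟩)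
      · obtain ⟨j, s, hs, h⟩ := hcover' v hv z hz.1 hzF
        exact Or.inr (Set.mem_iUnion.2 ⟨j, s, Set.Ioo_subset_Icc_self hs, h⟩)
    have hDpre : ∀ v ∈ Θ.V, IsPreconnected (D v) := by
      intro v hv
      have hsph : IsPreconnected (Metric.sphere v Θ.r) :=
        isPreconnected_sphere (by rw [Complex.rank_real_complex]; norm_num) _ _
      rcases i with k | u
      · have : D v = Metric.sphere v Θ.r := by
          refine sdiff_eq_left.2 (Set.disjoint_left.2 ?_)
          rintro z hz ⟨t, ht, rfl⟩
          exact (Θ.lt_dist_c k t ht v hv).ne' hz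
        rwa [this]
      · by_cases hc : ctr u = v
        · have := (hℓu u).2.2.2.2
          rw [hc] at this
          simp only [hD, he, Sum.elim_inr, hc]
          exact this
        · have : D v = Metric.sphere v Θ.r := by
            refine sdiff_eq_left.2 (Set.disjoint_left.2 ?_)
            rintro z hz ⟨t, ht, rfl⟩
            exact Θ.disjoint _ (hctr u u.2) v hv hc _ (hedist u t) hz
          rwa [this]
    have hconn : ∀ j, Relation.ReflTransGen (fun v w => ∃ k, Sum.inl k ≠ i ∧
        (Θ.p k = v ∧ Θ.q k = w ∨ Θ.p k = w ∧ Θ.q k = v)) Θ.x (Θ.g j) := by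
      intro j
      rcases i with k₀ | u
      · refine Relation.ReflTransGen.mono ?_ _ _ (Θ.connected k₀ j)
        exact fun v w ⟨k, hk, h⟩ =>
          ⟨k, fun h => hk (Sum.inl.inj h), h⟩
      · obtain ⟨k₀, -⟩ := Θ.exists_arc _ Θ.x_mem
        refine Relation.ReflTransGen.mono ?_ _ _ (Θ.connected k₀ j)
        exact fun v w ⟨k, hk, h⟩ =>
          ⟨k, Sum.inl_ne_inr, h⟩
    have hreach : ∀ w, Relation.ReflTransGen (fun v w => ∃ k, Sum.inl k ≠ i ∧
        (Θ.p k = v ∧ Θ.q k = w ∨ Θ.p k = w ∧ Θ.q k = v)) Θ.x w → w ∈ Θ.V ∧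
        ∃ C, IsPreconnected C ∧ C ⊆ K \ e i '' Set.Ioo 0 1 ∧ D Θ.x ⊆ C ∧ D w ⊆ C := by
      intro w hw
      induction hw with
      | refl => exact ⟨Θ.x_mem, _, hDpre _ Θ.x_mem, hDK _ Θ.x_mem, subset_rfl, subset_rfl⟩
      | @tail v w _ hvw ih =>
        obtain ⟨hv, C, hC1, hC2, hC3, hC4⟩ := ih
        obtain ⟨k, hki, hk⟩ := hvw
        have hkc : IsPreconnected (e (Sum.inl k) '' Set.Icc 0 1) :=
          isPreconnected_Icc.image _ (hcont _).continuousOn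
        have hend : ∃ z₁ ∈ e (Sum.inl k) '' Set.Icc 0 1, ∃ z₂ ∈ e (Sum.inl k) '' Set.Icc 0 1,
            z₁ ∈ D v ∧ z₂ ∈ D w ∧ w ∈ Θ.V := by
          have m0 : Θ.c k 0 ∈ D (Θ.p k) := hFD _ (Θ.p_mem k) _
            ((hmemF _).2 (Or.inl ⟨k, Or.inl rfl⟩)) (Θ.dist_c_zero k)
          have m1 : Θ.c k 1 ∈ D (Θ.q k) := hFD _ (Θ.q_mem k) _
            ((hmemF _).2 (Or.inl ⟨k, Or.inr rfl⟩)) (Θ.dist_c_one k)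
          rcases hk with ⟨rfl, rfl⟩ | ⟨rfl, rfl⟩
          · exact ⟨_, ⟨0, by simp, rfl⟩, _, ⟨1, by simp, rfl⟩, m0, m1, Θ.q_mem k⟩
          · exact ⟨_, ⟨1, by simp, rfl⟩, _, ⟨0, by simp, rfl⟩, m1, m0, Θ.p_mem k⟩
        obtain ⟨z₁, hz₁, z₂, hz₂, hz₁D, hz₂D, hw⟩ := hend
        refine ⟨hw, (C ∪ e (Sum.inl k) '' Set.Icc 0 1) ∪ D w, ?_, ?_, ?_, ?_⟩
        · exact (hC1.union z₁ (hC4 hz₁D) hz₁ hkc).union z₂ (Or.inr hz₂) hz₂D (hDpre w hw)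
        · exact Set.union_subset (Set.union_subset hC2 (hjK _ hki)) (hDK w hw)
        · exact fun z hz => Or.inl (Or.inl (hC3 hz))
        · exact Set.subset_union_right
    have hx0 : (D Θ.x).Nonempty := by
      obtain ⟨z, hz⟩ := hFv _ Θ.x_mem
      exact ⟨z, hFD _ Θ.x_mem z (Finset.mem_filter.1 hz).1 (Finset.mem_filter.1 hz).2⟩
    obtain ⟨x₀, hx₀⟩ := hx0
    choose C hC1 hC2 hC3 hC4 using fun j => (hreach _ (hconn j)).2
    have ha : ∀ j, Θ.a j ∈ ⋃ j, (C j ∪ segment ℝ (Θ.a j) (Θ.u j)) := fun j =>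
      Set.mem_iUnion.2 ⟨j, Or.inr (left_mem_segment _ _ _)⟩
    refine ⟨⋃ j, (C j ∪ segment ℝ (Θ.a j) (Θ.u j)), ?_, ?_, ?_, ?_⟩
    · refine isPreconnected_iUnion ⟨x₀, Set.mem_iInter.2 fun j => Or.inl (hC3 j hx₀)⟩ fun j => ?_
      refine (hC1 j).union (Θ.u j) (hC4 j ?_) (right_mem_segment _ _ _)
        (convex_segment _ _).isPreconnected
      exact hFD _ (Θ.g_mem j) _ ((hmemF _).2 (Or.inr ⟨j, rfl⟩)) (Θ.dist_u j)
    · refine Set.iUnion_subset fun j => Set.union_subset (hC2 j) fun z hz => hSK ?_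
      exact Or.inr (Set.mem_iUnion.2 ⟨j, hz⟩)
    · intro z hz
      obtain ⟨j, rfl⟩ := Θ.subset_range_a hz
      exact ha j
    · obtain ⟨j, hj⟩ := Θ.exists_norm_a
      exact ⟨_, ha j, hj⟩
  let Γ : ArcSystem A (κ ⊕ F) R :=
    { S := S
      e := e
      isCompact_S := (isCompact_sphere 0 R).union (isCompact_iUnion fun i => by
        rw [← convexHull_pair]
        exact (Set.toFinite {Θ.a i, Θ.u i}).isCompact_convexHull ℝ)
      continuous_e := hcont
      injOn_e := by
        rintro (k | u)
        · exact Θ.injOn_c k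
        · exact (hℓu u).2.1
      e_notMem_S := heS
      e_ne := hene
      e_zero := by
        rintro (k | u)
        · refine Or.inr (Set.mem_iUnion₂.2 ⟨Sum.inr ⟨Θ.c k 0,
            (hmemF _).2 (Or.inl ⟨k, Or.inl rfl⟩)⟩, Sum.inr_ne_inl, 0, by simp, he0 _⟩)
        · exact hFrest u _ (by rw [he0]; exact u.2)
      e_one := by
        rintro (k | u)
        · refine Or.inr (Set.mem_iUnion₂.2 ⟨Sum.inr ⟨Θ.c k 1,
            (hmemF _).2 (Or.inl ⟨k, Or.inr rfl⟩)⟩, Sum.inr_ne_inl, 0, by simp, he0 _⟩)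
        · exact hFrest u _ (he1 u)
      sphere_subset := Set.subset_union_left
      subset_S := fun z hz => by
        obtain ⟨i, rfl⟩ := Θ.subset_range_a hz
        exact Or.inr (Set.mem_iUnion.2 ⟨i, left_mem_segment _ _ _⟩)
      exists_isPreconnected := hpre }
  refine ⟨F, Γ, hcardF, ?_, hcover', fun z => (hmemF z).1⟩
  rintro z ((h | h) | h) hzR
  · exact absurd (mem_sphere_zero_iff_norm.1 h) hzR.ne
  · exact Or.inl (Set.mem_iUnion.1 h)
  · obtain ⟨k | u, s, hs, rfl⟩ := Set.mem_iUnion.1 h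
    · rcases hs.1.eq_or_lt with rfl | h0
      · exact Or.inr (Or.inr ⟨_, Θ.p_mem k, Θ.dist_c_zero k⟩)
      · rcases hs.2.eq_or_lt with rfl | h1
        · exact Or.inr (Or.inr ⟨_, Θ.q_mem k, Θ.dist_c_one k⟩)
        · exact Or.inr (Or.inl ⟨k, ⟨s, ⟨h0, h1⟩, rfl⟩, ⟨s, ⟨h0, h1⟩, rfl⟩⟩)
    · exact Or.inr (Or.inr ⟨_, hctr u u.2, hedist u s⟩)

end Skeleton

section Order

lemma Finset.induction_consecutive {α : Type*} [LinearOrder α] (T : Finset α) (b : α) (hb : b ∈ T)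
    (hbT : ∀ t ∈ T, b ≤ t) (P : α → Prop) (h0 : P b)
    (hstep : ∀ t ∈ T, ∀ t' ∈ T, t < t' → (∀ s ∈ T, ¬ (t < s ∧ s < t')) → P t → P t') :
    ∀ t ∈ T, P t := by
  intro t ht
  induction hn : (T.filter (· < t)).card using Nat.strong_induction_on generalizing t with
  | _ n ih =>
  subst hn
  rcases (hbT t ht).eq_or_lt with rfl | hlt
  · exact h0
  · have hne : (T.filter (· < t)).Nonempty := ⟨b, Finset.mem_filter.2 ⟨hb, hlt⟩⟩
    have hm := Finset.mem_filter.1 ((T.filter (· < t)).max'_mem hne)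
    set u := (T.filter (· < t)).max' hne
    refine hstep u hm.1 t ht hm.2 ?_ (ih _ ?_ u hm.1 rfl)
    · rintro s hs ⟨h1, h2⟩
      exact absurd ((T.filter (· < t)).le_max' s (Finset.mem_filter.2 ⟨hs, h2⟩)) (not_le.2 h1)
    · refine Finset.card_lt_card ⟨fun s hs => ?_, fun hsub => ?_⟩
      · rw [Finset.mem_filter] at hs ⊢
        exact ⟨hs.1, hs.2.trans hm.2⟩
      · exact lt_irrefl u (Finset.mem_filter.1 (hsub (Finset.mem_filter.2 hm))).2

lemma Finset.exists_Ioc_disjoint {α : Type*} [LinearOrder α] [DenselyOrdered α] (X : Finset α)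
    {a b : α} (hab : a < b) : ∃ c, a < c ∧ c < b ∧ ∀ s, a < s → s ≤ c → s ∉ X := by
  have hins : (insert b (X.filter (a < ·))).Nonempty := Finset.insert_nonempty _ _
  have hlt : a < (insert b (X.filter (a < ·))).min' hins := by
    rw [Finset.lt_min'_iff]
    intro s hs
    rcases Finset.mem_insert.1 hs with rfl | hs
    · exact hab
    · exact (Finset.mem_filter.1 hs).2
  obtain ⟨c, hac, hc⟩ := _root_.exists_between hlt
  rw [Finset.lt_min'_iff] at hc
  refine ⟨c, hac, hc b (Finset.mem_insert_self _ _), fun s has hsc hsX => ?_⟩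
  exact absurd hsc (not_le.2 (hc s (Finset.mem_insert_of_mem (Finset.mem_filter.2 ⟨hsX, has⟩))))

lemma Finset.exists_Ico_disjoint {α : Type*} [LinearOrder α] [DenselyOrdered α] (X : Finset α)
    {a b : α} (hab : a < b) : ∃ c, a < c ∧ c < b ∧ ∀ s, c ≤ s → s < b → s ∉ X := by
  obtain ⟨c, h1, h2, h3⟩ := Finset.exists_Ioc_disjoint (α := αᵒᵈ) X (a := OrderDual.toDual b)
    (b := OrderDual.toDual a) hab
  exact ⟨c, h2, h1, fun s hs1 hs2 => h3 s hs2 hs1⟩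

variable {α : Type*} [LinearOrder α] [TopologicalSpace α] [OrderTopology α] [DenselyOrdered α]
  [CompactIccSpace α]

lemma exists_last_eq {g : α → ℝ} (hg : Continuous g) {t u : α} (htu : t < u) {r : ℝ}
    (ht : g t < r) (hu : r < g u) :
    ∃ a, t < a ∧ a < u ∧ g a = r ∧ ∀ s, a < s → s ≤ u → r < g s := by
  have hcpt : IsCompact (Set.Icc t u ∩ {s | g s ≤ r}) :=
    isCompact_Icc.inter_right (isClosed_le hg continuous_const)
  obtain ⟨a, ⟨⟨hta, hau⟩, hga⟩, hmax⟩ := hcpt.exists_isGreatest ⟨t, ⟨le_rfl, htu.le⟩, ht.le⟩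
  have hgt : ∀ s, a < s → s ≤ u → r < g s := fun s has hsu => by
    by_contra hlt
    exact absurd (hmax ⟨⟨hta.trans has.le, hsu⟩, not_lt.1 hlt⟩) (not_le.2 has)
  have hau' : a < u := hau.lt_of_ne (by rintro rfl; exact absurd hga (not_le.2 hu))
  have hra : r ≤ g a := by
    have : a ∈ closure (Set.Ioo a u) := by
      rw [closure_Ioo hau'.ne]
      exact ⟨le_rfl, hau'.le⟩
    exact closure_minimal (fun s hs => (hgt s hs.1 hs.2.le).le)
      (isClosed_le continuous_const hg) this
  have he : g a = r := le_antisymm hga hra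
  exact ⟨a, hta.lt_of_ne (by rintro rfl; exact ht.ne he), hau', he, hgt⟩

lemma exists_first_eq {g : α → ℝ} (hg : Continuous g) {u t : α} (hut : u < t) {r : ℝ}
    (ht : g t < r) (hu : r < g u) :
    ∃ b, u < b ∧ b < t ∧ g b = r ∧ ∀ s, u ≤ s → s < b → r < g s := by
  obtain ⟨b, h1, h2, h3, h4⟩ := exists_last_eq (α := αᵒᵈ) (g := g) hg (t := OrderDual.toDual t)
    (u := OrderDual.toDual u) hut ht hu
  exact ⟨b, h2, h1, h3, fun s hs1 hs2 => h4 s hs2 hs1⟩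

end Order

lemma exists_radius_of_gap {f : I → ℂ} (hf : Continuous f) {V : Set ℂ} (hV : V.Finite) {t t' : I}
    (htt : t < t') (ht : f t ∈ V) (ht' : f t' ∈ V) (hgap : ∀ s, t < s → s < t' → f s ∉ V)
    {ρ : ℝ} (hρ : 0 < ρ) (hsep : ∀ v ∈ V, ∀ v' ∈ V, v ≠ v' → 2 * ρ ≤ dist v v') :
    ∃ r₀ > 0, ∀ r, 0 < r → r < r₀ → ∃ a b : I, t < a ∧ a < b ∧ b < t' ∧ dist (f a) (f t) = r ∧
      dist (f b) (f t') = r ∧ (∀ s, t ≤ s → s ≤ a → dist (f s) (f t) < ρ) ∧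
      (∀ s, b ≤ s → s ≤ t' → dist (f s) (f t') < ρ) ∧
      ∀ s, a < s → s < b → ∀ v ∈ V, r < dist (f s) v := by
  have hnear : ∀ t₀ : I, ∀ᶠ s in nhds t₀, dist (f s) (f t₀) < ρ := fun t₀ =>
    (hf.tendsto t₀).eventually (Metric.ball_mem_nhds _ hρ)
  obtain ⟨m, htm, hmt⟩ := exists_between htt
  obtain ⟨t₁, ht₁m, ht₁⟩ : ∃ t₁, (t < t₁ ∧ t₁ < m) ∧ ∀ s, t ≤ s → s ≤ t₁ →
      dist (f s) (f t) < ρ := by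
    obtain ⟨w, hw, hwsub⟩ := exists_Ico_subset_of_mem_nhds (hnear t) ⟨m, htm⟩
    obtain ⟨t₁, h1, h2⟩ := exists_between (lt_min hw htm)
    exact ⟨t₁, ⟨h1, h2.trans_le (min_le_right _ _)⟩,
      fun s hs1 hs2 => hwsub ⟨hs1, hs2.trans_lt (h2.trans_le (min_le_left _ _))⟩⟩
  obtain ⟨t₂, ht₂m, ht₂⟩ : ∃ t₂, (m < t₂ ∧ t₂ < t') ∧ ∀ s, t₂ ≤ s → s ≤ t' →
      dist (f s) (f t') < ρ := by
    obtain ⟨w, hw, hwsub⟩ := exists_Ioc_subset_of_mem_nhds (hnear t') ⟨m, hmt⟩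
    obtain ⟨t₂, h1, h2⟩ := exists_between (max_lt hw hmt)
    exact ⟨t₂, ⟨(le_max_right _ _).trans_lt h1, h2⟩,
      fun s hs1 hs2 => hwsub ⟨((le_max_left _ _).trans_lt h1).trans_le hs1, hs2⟩⟩
  obtain ⟨δ, hδ, hδV⟩ : ∃ δ > 0, ∀ s, t₁ ≤ s → s ≤ t₂ → ∀ v ∈ V, δ < dist (f s) v := by
    have hd : Disjoint (f '' Set.Icc t₁ t₂) V := by
      rw [Set.disjoint_left]
      rintro _ ⟨s, hs, rfl⟩
      exact hgap s (ht₁m.1.trans_le hs.1) (hs.2.trans_lt ht₂m.2)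
    obtain ⟨δ, hδ, h⟩ := Metric.exists_pos_forall_lt_edist (isCompact_Icc.image hf) hV.isClosed hd
    refine ⟨δ, hδ, fun s h1 h2 v hv => ?_⟩
    have := h (f s) ⟨s, ⟨h1, h2⟩, rfl⟩ v hv
    rw [edist_nndist] at this
    exact_mod_cast this
  refine ⟨min ρ δ, lt_min hρ hδ, fun r hr hr' => ?_⟩
  have hrρ := hr'.trans_le (min_le_left _ _)
  have hrδ := hr'.trans_le (min_le_right _ _)
  have hlt : t₁ ≤ t₂ := (ht₁m.2.trans ht₂m.1).le
  obtain ⟨a, a1, a2, a3, a4⟩ := exists_last_eq (g := fun s => dist (f s) (f t)) (by fun_prop)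
    ht₁m.1 (r := r) (by simpa using hr) (hrδ.trans (hδV t₁ le_rfl hlt _ ht))
  obtain ⟨b, b1, b2, b3, b4⟩ := exists_first_eq (g := fun s => dist (f s) (f t')) (by fun_prop)
    ht₂m.2 (r := r) (by simpa using hr) (hrδ.trans (hδV t₂ hlt le_rfl _ ht'))
  refine ⟨a, b, a1, a2.trans_le (hlt.trans b1.le), b2, a3, b3,
    fun s h1 h2 => ht₁ s h1 (h2.trans a2.le), fun s h1 h2 => ht₂ s (b1.le.trans h1) h2,
    fun s h1 h2 v hv => ?_⟩
  have hfar : ∀ w ∈ V, dist (f s) w < ρ → r < dist (f s) w → r < dist (f s) v := by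
    intro w hw hsw hrw
    by_cases hvw : w = v
    · rwa [← hvw]
    · have := hsep w hw v hv hvw
      have := dist_triangle_left w v (f s)
      linarith
  rcases le_or_gt s t₁ with h3 | h3
  · exact hfar _ ht (ht₁ s (a1.le.trans h1.le) h3) (a4 s h1 h3)
  · rcases le_or_gt t₂ s with h4 | h4
    · exact hfar _ ht' (ht₂ s h4 (h2.le.trans b2.le)) (b4 s h4 h2)
    · exact hrδ.trans (hδV s h3.le h4.le v hv)

/-- The straight path between two points of a convex set avoiding `A`. -/
noncomputable def Path.straight {A B : Set ℂ} (hB : Convex ℝ B) (hBA : ∀ z ∈ B, z ∉ A) (z w : {z : ℂ // z ∉ A})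
    (hz : (z : ℂ) ∈ B) (hw : (w : ℂ) ∈ B) : Path z w where
  toFun s := ⟨(1 - (s : ℝ)) • (z : ℂ) + (s : ℝ) • (w : ℂ),
    hBA _ (hB hz hw (sub_nonneg.2 s.2.2) s.2.1 (by ring))⟩
  continuous_toFun := by fun_prop
  source' := Subtype.ext (by simp)
  target' := Subtype.ext (by simp)

lemma Path.straight_mem_segment {A B : Set ℂ} (hB : Convex ℝ B) (hBA : ∀ z ∈ B, z ∉ A)
    (z w : {z : ℂ // z ∉ A}) (hz : (z : ℂ) ∈ B) (hw : (w : ℂ) ∈ B) (s : I) :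
    (Path.straight hB hBA z w hz hw s : ℂ) ∈ segment ℝ (z : ℂ) w :=
  ⟨1 - s, s, sub_nonneg.2 s.2.2, s.2.1, by ring, rfl⟩

namespace ArcSystem

variable {A : Set ℂ} {ι : Type} {R : ℝ} {Γ : ArcSystem A ι R} {code : ι → ℂ → Bool}
  {x : {z : ℂ // z ∉ A}}

/-- Crossing words along a stretch of a path that leaves a disc, runs through arc interiors, and
enters another disc. -/
lemma Reach.gap {y y' : {z : ℂ // z ∉ A}} (p : Path y y') (X : Finset I) {t a b t' : I}
    (hta : t < a) (hab : a < b) (hbt : b < t') (ht : (p t : ℂ) ∉ Γ.carrier)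
    (ht' : (p t' : ℂ) ∉ Γ.carrier) {B B' : Set ℂ} (hB : Convex ℝ B) (hBA : ∀ z ∈ B, z ∉ A)
    (hB' : Convex ℝ B') (hBA' : ∀ z ∈ B', z ∉ A) (hpB : ∀ s ∈ Set.Icc t a, (p s : ℂ) ∈ B)
    (hpB' : ∀ s ∈ Set.Icc b t', (p s : ℂ) ∈ B') (hpa : ∃ i, (p a : ℂ) ∈ Γ.inner i)
    (hpb : ∃ i, (p b : ℂ) ∈ Γ.inner i)
    (hseg : ∀ z ∈ segment ℝ (p t : ℂ) (p a), z ∈ Γ.carrier → z = p a)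
    (hseg' : ∀ z ∈ segment ℝ (p b : ℂ) (p t'), z ∈ Γ.carrier → z = p b)
    (hX : ∀ s, a < s → s < b → (p s : ℂ) ∈ Γ.carrier → s ∈ X ∧ ∃ i, (p s : ℂ) ∈ Γ.inner i)
    {l : List (ι × Bool)} {c : Path.Homotopic.Quotient x (p t)}
    (h : Γ.Reach code x l (p t) c) :
    ∃ l', l'.length ≤ l.length + 2 + (X.filter fun s => a < s ∧ s < b).card ∧
      Γ.Reach code x l' (p t') (c.trans (.mk (p.subpath t t'))) := by
  classical
  obtain ⟨a', haa', ha'b, ha'X⟩ := X.exists_Ioc_disjoint hab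
  obtain ⟨b', ha'b', hb'b, hb'X⟩ := X.exists_Ico_disjoint ha'b
  obtain ⟨i, hi⟩ := hpa
  obtain ⟨i', hi'⟩ := hpb
  have hmt : (p t : ℂ) ∈ B := hpB t ⟨le_rfl, hta.le⟩
  have hma : (p a : ℂ) ∈ B := hpB a ⟨hta.le, le_rfl⟩
  have hmb : (p b : ℂ) ∈ B' := hpB' b ⟨le_rfl, hbt.le⟩
  have hmt' : (p t' : ℂ) ∈ B' := hpB' t' ⟨hbt.le, le_rfl⟩
  set τ₁ := Path.straight hB hBA (p t) (p a) hmt hma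
  set τ₂ := Path.straight hB' hBA' (p b) (p t') hmb hmt'
  have hτ₁ : Path.Homotopic.Quotient.mk τ₁ = .mk (p.subpath t a) := by
    rw [Path.Homotopic.Quotient.eq]
    exact Path.homotopic_of_convex hB hBA _ _
      (fun s => hB.segment_subset hmt hma (Path.straight_mem_segment hB hBA _ _ hmt hma s))
      (fun s => p.subpath_mem_Icc hta.le (P := fun z => (z : ℂ) ∈ B) hpB s)
  have hτ₂ : Path.Homotopic.Quotient.mk τ₂ = .mk (p.subpath b t') := by
    rw [Path.Homotopic.Quotient.eq]
    exact Path.homotopic_of_convex hB' hBA' _ _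
      (fun s => hB'.segment_subset hmb hmt' (Path.straight_mem_segment hB' hBA' _ _ hmb hmt' s))
      (fun s => p.subpath_mem_Icc hbt.le (P := fun z => (z : ℂ) ∈ B') hpB' s)
  have ha'K : (p a' : ℂ) ∉ Γ.carrier := fun hK =>
    ha'X a' haa' le_rfl (hX a' haa' ha'b hK).1
  have hb'K : (p b' : ℂ) ∉ Γ.carrier := fun hK =>
    hb'X b' le_rfl hb'b (hX b' (haa'.trans ha'b') hb'b hK).1
  have hcross₁ : Γ.Crosses i (τ₁.trans (p.subpath a a')) := by
    refine ⟨ht, ha'K, ?_, ?_⟩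
    · refine forall_trans (P := fun z => z ∈ Γ.carrier → z ∈ Γ.inner i) (fun s hs => ?_) ?_
      · rw [hseg _ (Path.straight_mem_segment hB hBA _ _ hmt hma s) hs]
        exact hi
      · refine p.subpath_mem_Icc haa'.le (P := fun z => (z : ℂ) ∈ Γ.carrier → (z : ℂ) ∈ Γ.inner i)
          fun q hq hqK => ?_
        rcases hq.1.eq_or_lt with rfl | hlt
        · exact hi
        · exact absurd (hX q hlt (hq.2.trans_lt ha'b) hqK).1 (ha'X q hlt hq.2)
    · have : p a ∈ Set.range (τ₁.trans (p.subpath a a')) := by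
        rw [Path.trans_range]
        exact Or.inl ⟨1, τ₁.target⟩
      obtain ⟨s, hs⟩ := this
      exact ⟨s, by rw [hs]; exact hi⟩
  have hcross₂ : Γ.Crosses i' ((p.subpath b' b).trans τ₂) := by
    refine ⟨hb'K, ht', ?_, ?_⟩
    · refine forall_trans (P := fun z => z ∈ Γ.carrier → z ∈ Γ.inner i') ?_ (fun s hs => ?_)
      · refine p.subpath_mem_Icc hb'b.le (P := fun z => (z : ℂ) ∈ Γ.carrier → (z : ℂ) ∈ Γ.inner i')
          fun q hq hqK => ?_
        rcases hq.2.eq_or_lt with rfl | hlt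
        · exact hi'
        · exact absurd (hX q ((haa'.trans ha'b').trans_le hq.1) hlt hqK).1 (hb'X q hq.1 hlt)
      · rw [hseg' _ (Path.straight_mem_segment hB' hBA' _ _ hmb hmt' s) hs]
        exact hi'
    · have : p b ∈ Set.range ((p.subpath b' b).trans τ₂) := by
        rw [Path.trans_range]
        exact Or.inr ⟨0, τ₂.source⟩
      obtain ⟨s, hs⟩ := this
      exact ⟨s, by rw [hs]; exact hi'⟩
  obtain ⟨l', hl', hr⟩ := (h.cross _ hcross₁).extend p (X.filter fun s => a < s ∧ s < b)
    ha'b'.le ha'K hb'K fun q hq hqK => by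
      have h1 := haa'.trans_le hq.1
      have h2 := hq.2.trans_lt hb'b
      have := hX q h1 h2 hqK
      exact ⟨Finset.mem_filter.2 ⟨this.1, h1, h2⟩, this.2⟩
  have hlast := hr.cross _ hcross₂
  rw [Path.Homotopic.Quotient.mk_trans, Path.Homotopic.Quotient.mk_trans, hτ₁, hτ₂,
    Path.mk_subpath_trans, Path.mk_subpath_trans, Path.Homotopic.Quotient.trans_assoc,
    Path.Homotopic.Quotient.trans_assoc, Path.mk_subpath_trans, Path.mk_subpath_trans] at hlast
  refine ⟨_, ?_, hlast⟩
  simp only [List.length_cons] at hl' ⊢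
  omega

end ArcSystem

/-- A finite family of closed curves `f j : I → ℂ` based at `x`, not passing through `x`, with
fewer than `k` self-intersections each and fewer than `k` crossings for each pair. -/
structure LoopFamily (J : Type) (x : ℂ) (k : ℕ) where
  f : J → I → ℂ
  continuous_f : ∀ j, Continuous (f j)
  f_zero : ∀ j, f j 0 = x
  f_one : ∀ j, f j 1 = x
  f_ne : ∀ j t, t ≠ 0 → t ≠ 1 → f j t ≠ x
  self_lt : ∀ j, {p : I × I | p.1 ≠ 0 ∧ p.2 ≠ 1 ∧ p.1 < p.2 ∧ f j p.1 = f j p.2}.encard < k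
  cross_lt : ∀ i j, i ≠ j → {p : I × I | p.1 ≠ 0 ∧ p.1 ≠ 1 ∧ p.2 ≠ 0 ∧ p.2 ≠ 1 ∧
    f i p.1 = f j p.2}.encard < k

namespace LoopFamily

lemma finite_and_ncard_of_encard_lt {α : Type*} {s : Set α} {k : ℕ} (h : s.encard < k) :
    s.Finite ∧ s.ncard ≤ k - 1 := by
  have hfin : s.Finite := Set.encard_lt_top_iff.1 (h.trans (ENat.natCast_lt_top k))
  refine ⟨hfin, ?_⟩
  rw [← hfin.cast_ncard_eq] at h
  have : s.ncard < k := by exact_mod_cast h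
  omega

variable {J : Type} {x : ℂ} {k : ℕ} (L : LoopFamily J x k)

/-- The parameters in the open interval at which a curve meets the interior of another one. -/
def hits (j h : J) : Set I :=
  {t | t ≠ 0 ∧ t ≠ 1 ∧ ∃ s, s ≠ 0 ∧ s ≠ 1 ∧ (h, s) ≠ (j, t) ∧ L.f j t = L.f h s}

lemma hits_of_ne {j h : J} (hjh : j ≠ h) : (L.hits j h).Finite ∧ (L.hits j h).ncard ≤ k - 1 := by
  obtain ⟨hfin, hcard⟩ := finite_and_ncard_of_encard_lt (L.cross_lt j h hjh)
  have hsub : L.hits j h ⊆ Prod.fst '' {p : I × I | p.1 ≠ 0 ∧ p.1 ≠ 1 ∧ p.2 ≠ 0 ∧ p.2 ≠ 1 ∧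
      L.f j p.1 = L.f h p.2} := by
    rintro t ⟨h0, h1, s, s0, s1, -, he⟩
    exact ⟨(t, s), ⟨h0, h1, s0, s1, he⟩, rfl⟩
  exact ⟨(hfin.image _).subset hsub, (Set.ncard_le_ncard hsub (hfin.image _)).trans
    ((Set.ncard_image_le hfin).trans hcard)⟩

lemma hits_self (j : J) : (L.hits j j).Finite ∧ (L.hits j j).ncard ≤ 2 * (k - 1) := by
  obtain ⟨hfin, hcard⟩ := finite_and_ncard_of_encard_lt (L.self_lt j)
  set Q := {p : I × I | p.1 ≠ 0 ∧ p.2 ≠ 1 ∧ p.1 < p.2 ∧ L.f j p.1 = L.f j p.2}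
  have hsub : L.hits j j ⊆ Prod.fst '' Q ∪ Prod.snd '' Q := by
    rintro t ⟨h0, h1, s, s0, s1, hne, he⟩
    have hst : s ≠ t := fun h => hne (by rw [h])
    rcases lt_or_gt_of_ne hst with h | h
    · exact Or.inr ⟨(s, t), ⟨s0, h1, h, he.symm⟩, rfl⟩
    · exact Or.inl ⟨(t, s), ⟨h0, s1, h, he⟩, rfl⟩
  have hfin' := (hfin.image Prod.fst).union (hfin.image Prod.snd)
  refine ⟨hfin'.subset hsub, (Set.ncard_le_ncard hsub hfin').trans
    ((Set.ncard_union_le _ _).trans ?_)⟩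
  have h1 := Set.ncard_image_le (f := Prod.fst) hfin
  have h2 := Set.ncard_image_le (f := Prod.snd) hfin
  omega

lemma finite_hits (j h : J) : (L.hits j h).Finite := by
  by_cases hjh : j = h
  · exact hjh ▸ (L.hits_self j).1
  · exact (L.hits_of_ne hjh).1

lemma fiber (hk : 1 ≤ k) (j : J) (v : ℂ) : {t | t ≠ 0 ∧ t ≠ 1 ∧ L.f j t = v}.Finite ∧
    {t | t ≠ 0 ∧ t ≠ 1 ∧ L.f j t = v}.ncard ≤ 2 * k := by
  set T := {t | t ≠ 0 ∧ t ≠ 1 ∧ L.f j t = v}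
  rcases T.eq_empty_or_nonempty with h | ⟨t₀, h0, h1, ht₀⟩
  · rw [h]; simp
  · obtain ⟨hfin, hcard⟩ := L.hits_self j
    have hsub : T ⊆ insert t₀ (L.hits j j) := by
      rintro t ⟨h0', h1', ht⟩
      by_cases htt : t = t₀
      · exact Or.inl htt
      · exact Or.inr ⟨h0', h1', t₀, h0, h1, fun h => htt (Prod.mk.inj h).2.symm, by
          rw [ht, ht₀]⟩
    refine ⟨(hfin.insert _).subset hsub, (Set.ncard_le_ncard hsub (hfin.insert _)).trans
      ((Set.ncard_insert_le _ _).trans ?_)⟩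
    omega

/-- The basepoint, the points `g i`, and the multiple points of the curves indexed by `H`. -/
def vertices {α : Type} (H : Finset J) (g : α → ℂ) : Set ℂ :=
  insert x (Set.range g ∪ ⋃ h ∈ H, ⋃ h' ∈ H, L.f h '' L.hits h h')

lemma finite_vertices {α : Type} [Finite α] (H : Finset J) (g : α → ℂ) :
    (L.vertices H g).Finite := by
  refine ((Set.finite_range g).union ?_).insert x
  exact Set.Finite.biUnion H.finite_toSet fun h _ => Set.Finite.biUnion H.finite_toSet
    fun h' _ => (L.finite_hits h h').image _

lemma finite_preimage (hk : 1 ≤ k) (j : J) {V : Set ℂ} (hV : V.Finite) :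
    {t | L.f j t ∈ V}.Finite := by
  have : {t | L.f j t ∈ V} ⊆ {0, 1} ∪ ⋃ v ∈ V, {t | t ≠ 0 ∧ t ≠ 1 ∧ L.f j t = v} := by
    intro t ht
    by_cases h0 : t = 0
    · exact Or.inl (Or.inl h0)
    · by_cases h1 : t = 1
      · exact Or.inl (Or.inr h1)
      · exact Or.inr (Set.mem_iUnion₂.2 ⟨_, ht, h0, h1, rfl⟩)
  exact ((Set.toFinite _).union (hV.biUnion fun v _ => (L.fiber hk j v).1)).subset this

lemma mem_vertices_iff {α : Type} {H : Finset J} {g : α → ℂ} {h : J} (hh : h ∈ H) {t : I}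
    (h0 : t ≠ 0) (h1 : t ≠ 1) : L.f h t ∈ L.vertices H g ↔
      (∃ i, L.f h t = g i) ∨ ∃ h' ∈ H, t ∈ L.hits h h' := by
  constructor
  · rintro (hx | ⟨i, hi⟩ | hm)
    · exact absurd hx (L.f_ne h t h0 h1)
    · exact Or.inl ⟨i, hi.symm⟩
    · obtain ⟨h₁, hh₁, hm⟩ := Set.mem_iUnion₂.1 hm
      obtain ⟨h₂, hh₂, s, hs, he⟩ := Set.mem_iUnion₂.1 hm
      obtain ⟨s0, s1, s', s0', s1', hne, he'⟩ := hs
      by_cases hc : (h₁, s) = (h, t)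
      · obtain ⟨rfl, rfl⟩ := Prod.mk.inj hc
        exact Or.inr ⟨h₂, hh₂, h0, h1, s', s0', s1', hne, he'⟩
      · exact Or.inr ⟨h₁, hh₁, h0, h1, s, s0, s1, hc, he.symm⟩
  · rintro (⟨i, hi⟩ | ⟨h', hh', ht⟩)
    · exact Or.inr (Or.inl ⟨i, hi.symm⟩)
    · exact Or.inr (Or.inr (Set.mem_iUnion₂.2 ⟨h, hh, Set.mem_iUnion₂.2 ⟨h', hh', t, ht, rfl⟩⟩))

lemma ncard_preimage_vertices_le (hk : 1 ≤ k) {α : Type} [Fintype α] (H : Finset J) (g : α → ℂ)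
    {h : J} (hh : h ∈ H) : {t | t ≠ 1 ∧ L.f h t ∈ L.vertices H g}.ncard ≤
      1 + Fintype.card α * (2 * k) + (H.card + 1) * (k - 1) := by
  classical
  have hsub : {t | t ≠ 1 ∧ L.f h t ∈ L.vertices H g} ⊆
      ({0} ∪ ⋃ i, {t | t ≠ 0 ∧ t ≠ 1 ∧ L.f h t = g i}) ∪
        (L.hits h h ∪ ⋃ h' ∈ H.erase h, L.hits h h') := by
    rintro t ⟨h1, ht⟩
    by_cases h0 : t = 0
    · exact Or.inl (Or.inl h0)
    · rcases (L.mem_vertices_iff hh h0 h1).1 ht with ⟨i, hi⟩ | ⟨h', hh', ht⟩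
      · exact Or.inl (Or.inr (Set.mem_iUnion.2 ⟨i, h0, h1, hi⟩))
      · by_cases hc : h' = h
        · exact Or.inr (Or.inl (hc ▸ ht))
        · exact Or.inr (Or.inr (Set.mem_iUnion₂.2 ⟨h', Finset.mem_erase.2 ⟨hc, hh'⟩, ht⟩))
  have hfin1 : (⋃ i, {t | t ≠ 0 ∧ t ≠ 1 ∧ L.f h t = g i}).Finite :=
    Set.finite_iUnion fun i => (L.fiber hk h (g i)).1
  have hfin2 : (⋃ h' ∈ H.erase h, L.hits h h').Finite :=
    Set.Finite.biUnion (H.erase h).finite_toSet fun h' _ => L.finite_hits h h'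
  have hc1 : (⋃ i, {t | t ≠ 0 ∧ t ≠ 1 ∧ L.f h t = g i}).ncard ≤ Fintype.card α * (2 * k) := by
    have := Finset.card_biUnion_le_card_mul (Finset.univ : Finset α)
      (fun i => (L.fiber hk h (g i)).1.toFinset) (2 * k) (fun i _ => by
        rw [← Set.ncard_eq_toFinset_card _ (L.fiber hk h (g i)).1]; exact (L.fiber hk h (g i)).2)
    rw [Finset.card_univ] at this
    refine le_trans (le_of_eq ?_) this
    rw [Set.ncard_eq_toFinset_card _ hfin1]
    congr 1
    ext t
    simp
  have hc2 : (⋃ h' ∈ H.erase h, L.hits h h').ncard ≤ (H.erase h).card * (k - 1) := by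
    have := Finset.card_biUnion_le_card_mul (H.erase h)
      (fun h' => (L.finite_hits h h').toFinset) (k - 1) (fun h' hh' => by
        rw [← Set.ncard_eq_toFinset_card _ (L.finite_hits h h')]
        exact (L.hits_of_ne (Finset.ne_of_mem_erase hh').symm).2)
    refine le_trans (le_of_eq ?_) this
    rw [Set.ncard_eq_toFinset_card _ hfin2]
    congr 1
    ext t
    simp
  have hHc := Finset.card_erase_add_one hh
  have hself := L.hits_self h
  have hall := Set.ncard_le_ncard hsub ((((Set.finite_singleton 0).union hfin1)).union
    (hself.1.union hfin2))
  have u1 := Set.ncard_union_le ({0} ∪ ⋃ i, {t | t ≠ 0 ∧ t ≠ 1 ∧ L.f h t = g i})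
    (L.hits h h ∪ ⋃ h' ∈ H.erase h, L.hits h h')
  have u2 := Set.ncard_union_le ({0} : Set I) (⋃ i, {t | t ≠ 0 ∧ t ≠ 1 ∧ L.f h t = g i})
  have u3 := Set.ncard_union_le (L.hits h h) (⋃ h' ∈ H.erase h, L.hits h h')
  rw [Set.ncard_singleton] at u2
  have : (H.card + 1) * (k - 1) = (H.erase h).card * (k - 1) + 2 * (k - 1) := by
    rw [← hHc]; ring
  omega

lemma biUnion_hits (H : Finset J) {j : J} (hj : j ∉ H) : (⋃ h ∈ H, L.hits j h).Finite ∧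
    (⋃ h ∈ H, L.hits j h).ncard ≤ H.card * (k - 1) := by
  classical
  have hfin2 : (⋃ h ∈ H, L.hits j h).Finite :=
    Set.Finite.biUnion H.finite_toSet fun h' _ => L.finite_hits j h'
  refine ⟨hfin2, ?_⟩
  have := Finset.card_biUnion_le_card_mul H
    (fun h' => (L.finite_hits j h').toFinset) (k - 1) (fun h' hh' => by
      rw [← Set.ncard_eq_toFinset_card _ (L.finite_hits j h')]
      exact (L.hits_of_ne (by rintro rfl; exact hj hh')).2)
  refine le_trans (le_of_eq ?_) this
  rw [Set.ncard_eq_toFinset_card _ hfin2]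
  congr 1
  ext t
  simp

end LoopFamily

lemma IsCompact.exists_nearest {G : Set ℂ} (hG : IsCompact G) (hne : G.Nonempty) (a : ℂ) :
    ∃ g ∈ G, ∀ z ∈ G, z ∈ segment ℝ a g → z = g := by
  obtain ⟨g, hg, hmin⟩ := hG.exists_isMinOn hne
    (Continuous.dist (continuous_const (y := a)) continuous_id).continuousOn
  refine ⟨g, hg, fun z hz hzs => ?_⟩
  have h1 : dist a g ≤ dist a z := hmin hz
  have h2 := dist_add_dist_of_mem_segment hzs
  exact dist_le_zero.1 (by linarith)

lemma Set.Finite.exists_separation {V : Set ℂ} (hV : V.Finite) {U : Set ℂ} (hU : IsOpen U)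
    (hVU : V ⊆ U) : ∃ ρ > 0, (∀ v ∈ V, ∀ v' ∈ V, v ≠ v' → 2 * ρ ≤ dist v v') ∧
      ∀ v ∈ V, ∀ z, dist z v < ρ → z ∈ U := by
  have hlt : ∀ d : ℝ, 0 < d → ∀ᶠ ρ in nhdsWithin (0 : ℝ) (Set.Ioi 0), ρ < d := fun d hd =>
    Filter.mem_of_superset (Ioo_mem_nhdsGT hd) fun ρ hρ => hρ.2
  have h1 : ∀ᶠ ρ in nhdsWithin (0 : ℝ) (Set.Ioi 0),
      ∀ v ∈ V, ∀ v' ∈ V, v ≠ v' → 2 * ρ ≤ dist v v' := by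
    refine (Filter.eventually_all_finite hV).2 fun v _ =>
      (Filter.eventually_all_finite hV).2 fun v' _ => ?_
    by_cases hvv : v = v'
    · exact Filter.Eventually.of_forall fun _ h => absurd hvv h
    · filter_upwards [hlt (dist v v' / 2) (half_pos (dist_pos.2 hvv))] with ρ hρ _
      linarith
  have h2 : ∀ᶠ ρ in nhdsWithin (0 : ℝ) (Set.Ioi 0), ∀ v ∈ V, ∀ z, dist z v < ρ → z ∈ U := by
    refine (Filter.eventually_all_finite hV).2 fun v hv => ?_
    obtain ⟨ε, hε, hball⟩ := Metric.isOpen_iff.1 hU v (hVU hv)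
    filter_upwards [hlt ε hε] with ρ hρ z hz
    exact hball (Metric.mem_ball.2 (hz.trans hρ))
  obtain ⟨ρ, ⟨h1, h2⟩, h3⟩ := ((h1.and h2).and self_mem_nhdsWithin).exists
  exact ⟨ρ, h3, h1, h2⟩

/-- The parameters `a`, `b` cut the stretch of `f` from `t` to `t'` into a start close to `f t`, a
middle part at distance more than `r` from `V`, and an end close to `f t'`. -/
structure GapCut (f : I → ℂ) (V : Set ℂ) (ρ r : ℝ) (t t' a b : I) : Prop where
  lt_a : t < a
  a_lt_b : a < b
  b_lt : b < t'
  dist_a : dist (f a) (f t) = r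
  dist_b : dist (f b) (f t') = r
  near_left : ∀ s, t ≤ s → s ≤ a → dist (f s) (f t) < ρ
  near_right : ∀ s, b ≤ s → s ≤ t' → dist (f s) (f t') < ρ
  far : ∀ s, a < s → s < b → ∀ v ∈ V, r < dist (f s) v

/-- Consecutive parameters at which `f` visits `V`. -/
structure Consecutive (f : I → ℂ) (V : Set ℂ) (t t' : I) : Prop where
  lt : t < t'
  left : f t ∈ V
  right : f t' ∈ V
  notMem : ∀ s, t < s → s < t' → f s ∉ V

namespace LoopFamily

variable {J : Type} {x : ℂ} {k : ℕ} (L : LoopFamily J x k)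

/-- The points to be connected to the curves: the points of `A`, and one point of norm `R`. -/
def anchor (A : Set ℂ) (R : ℝ) (i : Option A) : ℂ := i.elim (R : ℂ) (↑)

theorem exists_parameters [Fintype J] [DecidableEq J] [Nonempty J] (hk : 1 ≤ k) {A : Set ℂ}
    [Fintype A] (hA : ∀ j t, L.f j t ∉ A) :
    ∃ (R : ℝ) (hl : Option A → J) (ts : Option A → I) (ρ r : ℝ), ∀ (H : Finset J) (g : Option A → ℂ)
      (V : Set ℂ), H = Finset.univ.image hl → g = (fun i => L.f (hl i) (ts i)) →
      V = L.vertices H g →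
      0 < r ∧ r < ρ ∧ (∀ j t, ‖L.f j t‖ < R) ∧ (∀ v ∈ V, ∀ z, dist z v < ρ → z ∉ A ∧ ‖z‖ < R) ∧
      (∀ v ∈ V, ∀ v' ∈ V, v ≠ v' → 2 * ρ ≤ dist v v') ∧
      (∀ i j t, L.f j t ∈ segment ℝ (anchor A R i) (g i) → L.f j t = g i) ∧
      (∀ i, r < dist (anchor A R i) (g i)) ∧
      (∀ i, ∀ v ∈ V, v ≠ g i → ∀ z ∈ segment ℝ (anchor A R i) (g i), r < dist z v) ∧
      (∀ j h, j ≠ h → ∀ s ∈ L.hits j h, ∀ v ∈ V, dist (L.f j s) v ≠ r) ∧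
      ∀ j t t', Consecutive (L.f j) V t t' → ∃ a b, GapCut (L.f j) V ρ r t t' a b := by
  classical
  have hGc : IsCompact (⋃ j, Set.range (L.f j)) := isCompact_iUnion fun j =>
    isCompact_range (L.continuous_f j)
  have hGne : (⋃ j, Set.range (L.f j)).Nonempty := by
    obtain ⟨j⟩ := ‹Nonempty J›
    exact ⟨_, Set.mem_iUnion.2 ⟨j, 0, rfl⟩⟩
  obtain ⟨R, hR⟩ : ∃ R : ℝ, ∀ z ∈ ⋃ j, Set.range (L.f j), ‖z‖ < R := by
    obtain ⟨R, hR⟩ := hGc.isBounded.exists_norm_le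
    exact ⟨R + 1, fun z hz => (hR z hz).trans_lt (by linarith)⟩
  have hfR : ∀ j t, ‖L.f j t‖ < R := fun j t => hR _ (Set.mem_iUnion.2 ⟨j, t, rfl⟩)
  have hR0 : 0 < R := by
    obtain ⟨z, hz⟩ := hGne
    exact (norm_nonneg z).trans_lt (hR z hz)
  have hnear : ∀ i : Option A, ∃ (j : J) (t : I), ∀ j' t',
      L.f j' t' ∈ segment ℝ (anchor A R i) (L.f j t) → L.f j' t' = L.f j t := by
    intro i
    obtain ⟨g, hg, h⟩ := hGc.exists_nearest hGne (anchor A R i)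
    obtain ⟨j, t, rfl⟩ := Set.mem_iUnion.1 hg
    exact ⟨j, t, fun j' t' => h _ (Set.mem_iUnion.2 ⟨j', t', rfl⟩)⟩
  choose hl ts hseg using hnear
  have hne : ∀ i j t, anchor A R i ≠ L.f j t := by
    rintro (_ | a) j t h
    · have := hfR j t
      rw [← h] at this
      simp [anchor, abs_of_pos hR0] at this
    · exact hA j t (h ▸ a.2)
  set g : Option A → ℂ := fun i => L.f (hl i) (ts i) with hg
  set V := L.vertices (Finset.univ.image hl) g with hVdef
  have hV : V.Finite := L.finite_vertices _ _
  have hVG : ∀ v ∈ V, ∃ j t, L.f j t = v := by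
    rintro v (rfl | ⟨i, rfl⟩ | hm)
    · exact ⟨Classical.arbitrary J, 0, L.f_zero _⟩
    · exact ⟨_, _, rfl⟩
    · obtain ⟨h₁, hh₁, hm⟩ := Set.mem_iUnion₂.1 hm
      obtain ⟨h₂, hh₂, s, hs, he⟩ := Set.mem_iUnion₂.1 hm
      exact ⟨_, _, he⟩
  have hAfin : A.Finite := Set.toFinite A
  obtain ⟨ρ, hρ, hsep, hU⟩ := hV.exists_separation (U := Aᶜ ∩ {z | ‖z‖ < R})
    (hAfin.isClosed.isOpen_compl.inter (isOpen_lt continuous_norm continuous_const))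
    (by rintro v hv; obtain ⟨j, t, rfl⟩ := hVG v hv; exact ⟨hA j t, hfR j t⟩)
  have hlt : ∀ d : ℝ, 0 < d → ∀ᶠ r in nhdsWithin (0 : ℝ) (Set.Ioi 0), r < d := fun d hd =>
    Filter.mem_of_superset (Ioo_mem_nhdsGT hd) fun r hr => hr.2
  have e1 := hlt ρ hρ
  have e2 : ∀ᶠ r in nhdsWithin (0 : ℝ) (Set.Ioi 0), ∀ i, r < dist (anchor A R i) (g i) :=
    Filter.eventually_all.2 fun i => hlt _ (dist_pos.2 (hne i _ _))
  have e3 : ∀ᶠ r in nhdsWithin (0 : ℝ) (Set.Ioi 0), ∀ i, ∀ v ∈ V, v ≠ g i →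
      ∀ z ∈ segment ℝ (anchor A R i) (g i), r < dist z v := by
    refine Filter.eventually_all.2 fun i => (Filter.eventually_all_finite hV).2 fun v hv => ?_
    by_cases hvg : v = g i
    · exact Filter.Eventually.of_forall fun _ h => absurd hvg h
    · obtain ⟨j, t, rfl⟩ := hVG v hv
      have hcpt : IsCompact (segment ℝ (anchor A R i) (g i)) := by
        rw [← convexHull_pair]
        exact (Set.toFinite _).isCompact_convexHull ℝ
      have hnot : L.f j t ∉ segment ℝ (anchor A R i) (g i) := fun h => hvg (hseg i j t h)
      have hpos := (hcpt.isClosed.notMem_iff_infDist_pos ⟨_, left_mem_segment _ _ _⟩).1 hnot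
      filter_upwards [hlt _ hpos] with r hr _ z hz
      rw [dist_comm]
      exact hr.trans_le (Metric.infDist_le_dist_of_mem hz)
  have e4 : ∀ᶠ r in nhdsWithin (0 : ℝ) (Set.Ioi 0), ∀ j h, j ≠ h → ∀ s ∈ L.hits j h,
      ∀ v ∈ V, dist (L.f j s) v ≠ r := by
    refine Filter.eventually_all.2 fun j => Filter.eventually_all.2 fun h => ?_
    by_cases hjh : j = h
    · exact Filter.Eventually.of_forall fun _ h => absurd hjh h
    refine Filter.Eventually.mono ?_ (fun r hr _ => hr)
    refine (Filter.eventually_all_finite (L.finite_hits j h)).2 fun s _ =>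
      (Filter.eventually_all_finite hV).2 fun v _ => ?_
    rcases (dist_nonneg (x := L.f j s) (y := v)).eq_or_lt with h0 | h0
    · filter_upwards [self_mem_nhdsWithin] with r hr
      rw [← h0]
      exact (Set.mem_Ioi.1 hr).ne
    · filter_upwards [hlt _ h0] with r hr using hr.ne'
  have e5 : ∀ᶠ r in nhdsWithin (0 : ℝ) (Set.Ioi 0), ∀ j, ∀ t ∈ {t | L.f j t ∈ V},
      ∀ t' ∈ {t | L.f j t ∈ V}, Consecutive (L.f j) V t t' →
        ∃ a b, GapCut (L.f j) V ρ r t t' a b := by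
    refine Filter.eventually_all.2 fun j =>
      (Filter.eventually_all_finite (L.finite_preimage hk j hV)).2 fun t _ =>
      (Filter.eventually_all_finite (L.finite_preimage hk j hV)).2 fun t' _ => ?_
    by_cases hc : Consecutive (L.f j) V t t'
    · obtain ⟨r₀, hr₀, h⟩ := exists_radius_of_gap (L.continuous_f j) hV hc.lt hc.left hc.right
        hc.notMem hρ hsep
      filter_upwards [hlt r₀ hr₀, self_mem_nhdsWithin] with r h1 h2 _
      obtain ⟨a, b, h1, h2, h3, h4, h5, h6, h7, h8⟩ := h r h2 h1
      exact ⟨a, b, h1, h2, h3, h4, h5, h6, h7, h8⟩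
    · exact Filter.Eventually.of_forall fun _ h => absurd h hc
  obtain ⟨r, ⟨⟨⟨⟨⟨e1, e2⟩, e3⟩, e4⟩, e5⟩, hr⟩⟩ :=
    (((((e1.and e2).and e3).and e4).and e5).and self_mem_nhdsWithin).exists
  refine ⟨R, hl, ts, ρ, r, ?_⟩
  rintro H g' V' rfl rfl rfl
  exact ⟨hr, e1, hfR, hU, hsep, hseg, e2, e3, e4, fun j t t' hc => e5 j t hc.left t' hc.right hc⟩

end LoopFamily

/-- The affine parametrization of the interval between two elements of the unit interval. -/
noncomputable def stretch (a b : I) (s : ℝ) : I :=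
  Set.projIcc 0 1 zero_le_one ((a : ℝ) + s * (b - a))

lemma continuous_stretch (a b : I) : Continuous (stretch a b) := by
  unfold stretch
  exact continuous_projIcc.comp (by fun_prop)

lemma coe_stretch (a b : I) {s : ℝ} (hs : s ∈ Set.Icc (0 : ℝ) 1) :
    (stretch a b s : ℝ) = a + s * (b - a) := by
  have hmem : (a : ℝ) + s * (b - a) ∈ Set.Icc (0 : ℝ) 1 := by
    have h1 := a.2.1
    have h2 := a.2.2
    have h3 := b.2.1
    have h4 := b.2.2
    have h5 := hs.1
    have h6 := hs.2
    constructor <;> nlinarith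
  rw [stretch, Set.projIcc_of_mem _ hmem]

lemma stretch_zero (a b : I) : stretch a b 0 = a :=
  Subtype.ext (by rw [coe_stretch a b (by simp)]; ring)

lemma stretch_one (a b : I) : stretch a b 1 = b :=
  Subtype.ext (by rw [coe_stretch a b (by simp)]; ring)

lemma stretch_mem_Icc {a b : I} (hab : a < b) {s : ℝ} (hs : s ∈ Set.Icc (0 : ℝ) 1) :
    a ≤ stretch a b s ∧ stretch a b s ≤ b := by
  have h : (0 : ℝ) < b - a := sub_pos.2 hab
  have := hs.1
  have := hs.2
  constructor
  · rw [← Subtype.coe_le_coe, coe_stretch a b hs]; nlinarith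
  · rw [← Subtype.coe_le_coe, coe_stretch a b hs]; nlinarith

lemma stretch_mem_Ioo {a b : I} (hab : a < b) {s : ℝ} (hs : s ∈ Set.Ioo (0 : ℝ) 1) :
    a < stretch a b s ∧ stretch a b s < b := by
  have h : (0 : ℝ) < b - a := sub_pos.2 hab
  have := hs.1
  have := hs.2
  constructor
  · rw [← Subtype.coe_lt_coe, coe_stretch a b (Set.Ioo_subset_Icc_self hs)]; nlinarith
  · rw [← Subtype.coe_lt_coe, coe_stretch a b (Set.Ioo_subset_Icc_self hs)]; nlinarith

lemma stretch_injOn {a b : I} (hab : a < b) : Set.InjOn (stretch a b) (Set.Icc 0 1) := by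
  intro s hs s' hs' h
  have h' := congrArg (fun t : I => (t : ℝ)) h
  simp only [coe_stretch a b hs, coe_stretch a b hs'] at h'
  exact mul_right_cancel₀ (sub_pos.2 (Subtype.coe_lt_coe.2 hab)).ne' (add_left_cancel h')

namespace LoopFamily

variable {J : Type} {x : ℂ} {k : ℕ} (L : LoopFamily J x k)

lemma Consecutive.eq_right {f : I → ℂ} {V : Set ℂ} {t t' t'' : I} (h : Consecutive f V t t')
    (h' : Consecutive f V t t'') : t' = t'' := by
  rcases lt_trichotomy t' t'' with hlt | he | hlt
  · exact absurd h.right (h'.notMem t' h.lt hlt)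
  · exact he
  · exact absurd h'.right (h.notMem t'' h'.lt hlt)

lemma card_consecutive_le (hk : 1 ≤ k) {α : Type} [Fintype α] (H : Finset J) (g : α → ℂ) :
    Finite {p : J × I × I // p.1 ∈ H ∧ Consecutive (L.f p.1) (L.vertices H g) p.2.1 p.2.2} ∧
    Nat.card {p : J × I × I // p.1 ∈ H ∧ Consecutive (L.f p.1) (L.vertices H g) p.2.1 p.2.2} ≤
      H.card * (1 + Fintype.card α * (2 * k) + (H.card + 1) * (k - 1)) := by
  classical
  have hfin : ∀ h, {t | t ≠ 1 ∧ L.f h t ∈ L.vertices H g}.Finite := fun h =>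
    (L.finite_preimage hk h (L.finite_vertices H g)).subset fun t ht => ht.2
  set D : Finset (Σ _ : J, I) := H.sigma fun h => (hfin h).toFinset
  have hD : D.card ≤ H.card * (1 + Fintype.card α * (2 * k) + (H.card + 1) * (k - 1)) := by
    rw [Finset.card_sigma]
    refine (Finset.sum_le_card_nsmul _ _ _ fun h hh => ?_).trans (by rw [smul_eq_mul])
    rw [← Set.ncard_eq_toFinset_card _ (hfin h)]
    exact L.ncard_preimage_vertices_le hk H g hh
  let φ : {p : J × I × I // p.1 ∈ H ∧ Consecutive (L.f p.1) (L.vertices H g) p.2.1 p.2.2} → D :=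
    fun p => ⟨⟨p.1.1, p.1.2.1⟩, Finset.mem_sigma.2 ⟨p.2.1, (hfin _).mem_toFinset.2
      ⟨(p.2.2.lt.trans_le p.1.2.2.2.2).ne, p.2.2.left⟩⟩⟩
  have hφ : Function.Injective φ := by
    rintro ⟨⟨h, t, t'⟩, hh, hc⟩ ⟨⟨h₁, t₁, t₁'⟩, hh₁, hc₁⟩ he
    have he' := congrArg Subtype.val he
    simp only [φ] at he'
    cases he'
    have : t' = t₁' := Consecutive.eq_right hc hc₁
    subst this
    rfl
  refine ⟨Finite.of_injective φ hφ, ?_⟩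
  refine (Nat.card_le_card_of_injective φ hφ).trans ?_
  simpa using hD

end LoopFamily

lemma Consecutive.eq_of_mem {f : I → ℂ} {V : Set ℂ} {t t' s s' τ : I} (h : Consecutive f V t t')
    (h' : Consecutive f V s s') (h1 : t < τ) (h2 : τ < t') (h3 : s < τ) (h4 : τ < s') :
    t = s ∧ t' = s' := by
  have hts : t = s := by
    rcases lt_trichotomy t s with hlt | he | hlt
    · exact absurd h'.left (h.notMem s hlt (h3.trans h2))
    · exact he
    · exact absurd h.left (h'.notMem t hlt (h1.trans h4))
  subst hts
  exact ⟨rfl, LoopFamily.Consecutive.eq_right h h'⟩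

lemma Finset.induction_consecutive_down {α : Type*} [LinearOrder α] (T : Finset α) (b : α)
    (hb : b ∈ T) (hbT : ∀ t ∈ T, t ≤ b) (P : α → Prop) (h0 : P b)
    (hstep : ∀ t ∈ T, ∀ t' ∈ T, t < t' → (∀ s ∈ T, ¬ (t < s ∧ s < t')) → P t' → P t) :
    ∀ t ∈ T, P t :=
  Finset.induction_consecutive (α := αᵒᵈ) T b hb hbT P h0 fun t ht t' ht' hlt hno =>
    hstep t' ht' t ht hlt fun s hs h => hno s hs ⟨h.2, h.1⟩

namespace LoopFamily

variable {J : Type} {x : ℂ} {k : ℕ}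

/-- A choice of finitely many loops, of points on them to be joined to the points of `A`, and of
radii which are small compared to everything else. -/
structure Parameters (L : LoopFamily J x k) (A : Set ℂ) where
  R : ℝ
  ρ : ℝ
  r : ℝ
  H : Finset J
  hl : Option A → J
  ts : Option A → I
  hl_mem : ∀ i, hl i ∈ H
  card_H : H.card ≤ A.ncard + 1
  r_pos : 0 < r
  r_lt : r < ρ
  norm_lt : ∀ j t, ‖L.f j t‖ < R
  ball : ∀ v ∈ L.vertices H (fun i => L.f (hl i) (ts i)), ∀ z, dist z v < ρ → z ∉ A ∧ ‖z‖ < R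
  le_dist : ∀ v ∈ L.vertices H (fun i => L.f (hl i) (ts i)),
    ∀ v' ∈ L.vertices H (fun i => L.f (hl i) (ts i)), v ≠ v' → 2 * ρ ≤ dist v v'
  eq_of_mem_segment : ∀ i j t, L.f j t ∈ segment ℝ (anchor A R i) (L.f (hl i) (ts i)) →
    L.f j t = L.f (hl i) (ts i)
  lt_dist_anchor : ∀ i, r < dist (anchor A R i) (L.f (hl i) (ts i))
  lt_dist_segment : ∀ i, ∀ v ∈ L.vertices H (fun i => L.f (hl i) (ts i)), v ≠ L.f (hl i) (ts i) →
    ∀ z ∈ segment ℝ (anchor A R i) (L.f (hl i) (ts i)), r < dist z v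
  dist_ne : ∀ j h, j ≠ h → ∀ s ∈ L.hits j h, ∀ v ∈ L.vertices H (fun i => L.f (hl i) (ts i)),
    dist (L.f j s) v ≠ r
  exists_gapCut : ∀ j t t', Consecutive (L.f j) (L.vertices H (fun i => L.f (hl i) (ts i))) t t' →
    ∃ a b, GapCut (L.f j) (L.vertices H (fun i => L.f (hl i) (ts i))) ρ r t t' a b

variable (L : LoopFamily J x k)

theorem nonempty_parameters [Finite J] [Nonempty J] (hk : 1 ≤ k) {A : Set ℂ} (hAfin : A.Finite)
    (hA : ∀ j t, L.f j t ∉ A) : Nonempty (L.Parameters A) := by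
  classical
  have := Fintype.ofFinite J
  have := hAfin.fintype
  obtain ⟨R, hl, ts, ρ, r, h⟩ := L.exists_parameters hk hA
  obtain ⟨h1, h2, h3, h4, h5, h6, h7, h8, h9, h10⟩ := h _ _ _ rfl rfl rfl
  refine ⟨⟨R, ρ, r, Finset.univ.image hl, hl, ts, fun i => Finset.mem_image_of_mem _ (by simp), ?_,
    h1, h2, h3, h4, h5, h6, h7, h8, h9, h10⟩⟩
  refine Finset.card_image_le.trans ?_
  rw [Finset.card_univ, Fintype.card_option, Set.ncard_eq_toFinset_card', Set.toFinset_card]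

namespace Parameters

variable {L} {A : Set ℂ} (P : L.Parameters A)

/-- The point of the curves which is joined to `anchor A P.R i`. -/
def g (i : Option A) : ℂ := L.f (P.hl i) (P.ts i)

/-- The base point, the crossings of the chosen loops, and the points joined to `A`. -/
def V : Set ℂ := L.vertices P.H P.g

/-- The index type of the pieces of the chosen loops between visits of `P.V`. -/
def Gap : Type := {p : J × I × I // p.1 ∈ P.H ∧ Consecutive (L.f p.1) P.V p.2.1 p.2.2}

lemma x_mem : x ∈ P.V := Set.mem_insert _ _

lemma g_mem (i : Option A) : P.g i ∈ P.V := Or.inr (Or.inl ⟨i, rfl⟩)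

lemma exists_of_mem {v : ℂ} (hv : v ∈ P.V) :
    v = x ∨ ∃ h ∈ P.H, ∃ t, t ≠ 0 ∧ t ≠ 1 ∧ v = L.f h t := by
  rcases hv with rfl | ⟨i, rfl⟩ | hv
  · exact Or.inl rfl
  · by_cases h0 : P.ts i = 0
    · exact Or.inl (by rw [g, h0, L.f_zero])
    by_cases h1 : P.ts i = 1
    · exact Or.inl (by rw [g, h1, L.f_one])
    exact Or.inr ⟨_, P.hl_mem i, _, h0, h1, rfl⟩
  · simp only [Set.mem_iUnion] at hv
    obtain ⟨h, hh, h', hh', t, ht, rfl⟩ := hv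
    exact Or.inr ⟨h, hh, t, ht.1, ht.2.1, rfl⟩

lemma eq_of_notMem {h h' : J} {t t' : I} (hh : h ∈ P.H) (hh' : h' ∈ P.H) (ht : L.f h t ∉ P.V)
    (he : L.f h t = L.f h' t') : h = h' ∧ t = t' := by
  have h0 : ∀ j s, L.f j s ∉ P.V → s ≠ 0 ∧ s ≠ 1 := by
    intro j s hs
    constructor
    · rintro rfl
      exact hs (by rw [L.f_zero]; exact P.x_mem)
    · rintro rfl
      exact hs (by rw [L.f_one]; exact P.x_mem)
  obtain ⟨ht0, ht1⟩ := h0 _ _ ht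
  obtain ⟨ht0', ht1'⟩ := h0 _ _ (he ▸ ht)
  by_contra hne
  refine ht ((L.mem_vertices_iff hh ht0 ht1).2 (Or.inr ⟨h', hh', ht0, ht1, t', ht0', ht1', ?_, he⟩))
  intro hp
  exact hne ⟨(congrArg Prod.fst hp).symm, (congrArg Prod.snd hp).symm⟩

lemma notMem_of_lt_dist {z : ℂ} (hz : ∀ v ∈ P.V, P.r < dist z v) : z ∉ P.V := fun h => by
  have := hz z h
  rw [dist_self] at this
  exact this.not_ge P.r_pos.le

/-- The point where the segment to `P.g i` enters the disc around `P.g i`. -/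
noncomputable def u (i : Option A) : ℂ :=
  P.g i + ((P.r / dist (anchor A P.R i) (P.g i) : ℝ) : ℂ) * (anchor A P.R i - P.g i)

lemma dist_anchor_pos (i : Option A) : 0 < dist (anchor A P.R i) (P.g i) :=
  P.r_pos.trans (P.lt_dist_anchor i)

lemma dist_u (i : Option A) : dist (P.u i) (P.g i) = P.r := by
  have h := P.dist_anchor_pos i
  rw [u, dist_eq_norm, add_sub_cancel_left, norm_mul, Complex.norm_real, ← dist_eq_norm,
    Real.norm_of_nonneg (div_nonneg P.r_pos.le h.le), div_mul_cancel₀ _ h.ne']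

lemma u_mem_segment (i : Option A) : P.u i ∈ segment ℝ (anchor A P.R i) (P.g i) := by
  have h := P.dist_anchor_pos i
  have hr := P.r_pos.le
  have h' : P.r / dist (anchor A P.R i) (P.g i) ≤ 1 := (div_le_one h).2 (P.lt_dist_anchor i).le
  refine ⟨P.r / dist (anchor A P.R i) (P.g i), 1 - P.r / dist (anchor A P.R i) (P.g i),
    by positivity, by linarith, by ring, ?_⟩
  simp only [u, Complex.real_smul]
  push_cast
  ring

lemma segment_subset (i : Option A) :
    segment ℝ (anchor A P.R i) (P.u i) ⊆ segment ℝ (anchor A P.R i) (P.g i) :=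
  (convex_segment _ _).segment_subset (left_mem_segment _ _ _) (P.u_mem_segment i)

lemma dist_eq_add {i : Option A} {z : ℂ} (hz : z ∈ segment ℝ (anchor A P.R i) (P.u i)) :
    dist z (P.g i) = dist z (P.u i) + P.r := by
  have h1 := dist_add_dist_of_mem_segment hz
  have h2 := dist_add_dist_of_mem_segment (P.u_mem_segment i)
  have h3 := dist_add_dist_of_mem_segment (P.segment_subset i hz)
  rw [P.dist_u] at h2
  linarith

lemma le_dist_of_mem_segment {i : Option A} {z v : ℂ}
    (hz : z ∈ segment ℝ (anchor A P.R i) (P.u i)) (hv : v ∈ P.V) : P.r ≤ dist z v := by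
  by_cases h : v = P.g i
  · rw [h, P.dist_eq_add hz]
    linarith [dist_nonneg (x := z) (y := P.u i)]
  · exact (P.lt_dist_segment i v hv h z (P.segment_subset i hz)).le

lemma eq_u {i : Option A} {z v : ℂ} (hz : z ∈ segment ℝ (anchor A P.R i) (P.u i)) (hv : v ∈ P.V)
    (hd : dist z v = P.r) : z = P.u i := by
  by_cases h : v = P.g i
  · rw [h, P.dist_eq_add hz] at hd
    exact dist_le_zero.1 (by linarith)
  · exact absurd hd (P.lt_dist_segment i v hv h z (P.segment_subset i hz)).ne'

lemma f_notMem_segment (j : J) (t : I) (i : Option A) :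
    L.f j t ∉ segment ℝ (anchor A P.R i) (P.u i) := by
  intro h
  have h1 := P.eq_of_mem_segment i j t (P.segment_subset i h)
  have h2 := P.le_dist_of_mem_segment h (P.g_mem i)
  rw [h1] at h2
  exact (P.r_pos.trans_le h2).ne' (dist_self _)

variable [Finite A]

lemma finite_preimage_V (hk : 1 ≤ k) (j : J) : {t | L.f j t ∈ P.V}.Finite :=
  L.finite_preimage hk j (L.finite_vertices _ _)

lemma reflTransGen (hk : 1 ≤ k) {h : J} (hh : h ∈ P.H) (k₀ : P.Gap) {t : I}
    (ht : L.f h t ∈ P.V) :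
    Relation.ReflTransGen (fun v w => ∃ k : P.Gap, k ≠ k₀ ∧
      (L.f k.1.1 k.1.2.1 = v ∧ L.f k.1.1 k.1.2.2 = w ∨
        L.f k.1.1 k.1.2.1 = w ∧ L.f k.1.1 k.1.2.2 = v)) x (L.f h t) := by
  classical
  have hfin := P.finite_preimage_V hk h
  by_cases hc : k₀.1.1 = h ∧ t < k₀.1.2.2
  · refine Finset.induction_consecutive (hfin.toFinset.filter fun s => s ≤ t) (0 : I) ?_
      (fun s _ => unitInterval.nonneg') (fun s => Relation.ReflTransGen _ x (L.f h s))
      (by rw [L.f_zero]) ?_ t (by simpa using ht)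
    · simpa [L.f_zero] using P.x_mem
    · simp only [Finset.mem_filter, Set.Finite.mem_toFinset, Set.mem_ofPred_eq]
      intro s hs s' hs' hlt hno hp
      have hcons : Consecutive (L.f h) P.V s s' := ⟨hlt, hs.1, hs'.1, fun w hw hw' hm =>
        hno w ⟨hm, hw'.le.trans hs'.2⟩ ⟨hw, hw'⟩⟩
      refine hp.tail ⟨⟨(h, s, s'), hh, hcons⟩, ?_, Or.inl ⟨rfl, rfl⟩⟩
      rintro rfl
      exact hs'.2.not_gt hc.2
  · refine Finset.induction_consecutive_down (hfin.toFinset.filter fun s => t ≤ s) (1 : I) ?_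
      (fun s _ => unitInterval.le_one') (fun s => Relation.ReflTransGen _ x (L.f h s))
      (by rw [L.f_one]) ?_ t (by simpa using ht)
    · simpa [L.f_one, unitInterval.le_one'] using P.x_mem
    · simp only [Finset.mem_filter, Set.Finite.mem_toFinset, Set.mem_ofPred_eq]
      intro s hs s' hs' hlt hno hp
      have hcons : Consecutive (L.f h) P.V s s' := ⟨hlt, hs.1, hs'.1, fun w hw hw' hm =>
        hno w ⟨hm, hs.2.trans hw.le⟩ ⟨hw, hw'⟩⟩
      refine hp.tail ⟨⟨(h, s, s'), hh, hcons⟩, ?_, Or.inr ⟨rfl, rfl⟩⟩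
      rintro rfl
      exact hc ⟨rfl, hs.2.trans_lt hlt⟩

lemma exists_consecutive (hk : 1 ≤ k) (h : J) {t : I} (ht : L.f h t ∈ P.V) (ht1 : t ≠ 1) :
    ∃ t', Consecutive (L.f h) P.V t t' := by
  classical
  have hfin := P.finite_preimage_V hk h
  have hne : (hfin.toFinset.filter fun s => t < s).Nonempty :=
    ⟨1, by simpa [L.f_one, P.x_mem] using unitInterval.lt_one_iff_ne_one.2 ht1⟩
  have hmin := Finset.min'_mem _ hne
  simp only [Finset.mem_filter, Set.Finite.mem_toFinset, Set.mem_ofPred_eq] at hmin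
  refine ⟨_, hmin.2, ht, hmin.1, fun s hs hs' hm => ?_⟩
  exact hs'.not_ge (Finset.min'_le _ _ (by simpa using ⟨hm, hs⟩))

theorem exists_skeleton (hk : 1 ≤ k) : ∃ (a b : P.Gap → I) (Θ : Skeleton A P.Gap (Option A) P.R),
    (∀ e, e.1.2.1 < a e ∧ a e < b e ∧ b e < e.1.2.2) ∧
    Θ.V = P.V ∧ Θ.r = P.r ∧ Θ.a = anchor A P.R ∧ Θ.u = P.u ∧
    Θ.c = fun e s => L.f e.1.1 (stretch (a e) (b e) s) := by
  choose a b hab using fun e : P.Gap => P.exists_gapCut e.1.1 e.1.2.1 e.1.2.2 e.2.2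
  have hV : ∀ e : P.Gap, ∀ s ∈ Set.Ioo (0 : ℝ) 1, ∀ v ∈ P.V,
      P.r < dist (L.f e.1.1 (stretch (a e) (b e) s)) v := fun e s hs =>
    (hab e).far _ (stretch_mem_Ioo (hab e).a_lt_b hs).1 (stretch_mem_Ioo (hab e).a_lt_b hs).2
  have hV' : ∀ e : P.Gap, ∀ s ∈ Set.Ioo (0 : ℝ) 1, L.f e.1.1 (stretch (a e) (b e) s) ∉ P.V :=
    fun e s hs => P.notMem_of_lt_dist (hV e s hs)
  obtain ⟨i₀⟩ : Nonempty (Option A) := ⟨none⟩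
  refine ⟨a, b,
    { r := P.r
      V := P.V
      c := fun e s => L.f e.1.1 (stretch (a e) (b e) s)
      p := fun e => L.f e.1.1 e.1.2.1
      q := fun e => L.f e.1.1 e.1.2.2
      a := anchor A P.R
      g := P.g
      u := P.u
      r_pos := P.r_pos
      norm_lt_of_dist := fun v hv z hz => (P.ball v hv z (hz ▸ P.r_lt)).2
      disjoint := ?_
      continuous_c := fun e => (L.continuous_f _).comp (continuous_stretch _ _)
      injOn_c := ?_
      lt_dist_c := hV
      norm_c := fun e s _ => P.norm_lt _ _
      c_notMem_segment := fun e s _ i => P.f_notMem_segment _ _ i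
      c_ne := ?_
      p_mem := fun e => e.2.2.left
      q_mem := fun e => e.2.2.right
      dist_c_zero := fun e => by rw [stretch_zero]; exact (hab e).dist_a
      dist_c_one := fun e => by rw [stretch_one]; exact (hab e).dist_b
      g_mem := P.g_mem
      dist_u := P.dist_u
      eq_u := fun i z hz v hv hd => P.eq_u hz hv hd
      subset_range_a := fun z hz => ⟨some ⟨z, hz⟩, rfl⟩
      exists_norm_a := ⟨none, ?_⟩
      exists_arc := ?_
      x := x
      x_mem := P.x_mem
      connected := fun e i => P.reflTransGen hk (P.hl_mem i) e (P.g_mem i) },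
    fun e => ⟨(hab e).lt_a, (hab e).a_lt_b, (hab e).b_lt⟩, rfl, rfl, rfl, rfl, rfl⟩
  · intro v hv v' hv' hne z hz hz'
    have h1 := P.le_dist v hv v' hv' hne
    have h2 := dist_triangle_left v v' z
    have h3 := P.r_lt
    linarith
  · intro e s hs s' hs' he
    have := (P.eq_of_notMem e.2.1 e.2.1 (hV' e s hs) he).2
    exact stretch_injOn (hab e).a_lt_b (Set.Ioo_subset_Icc_self hs) (Set.Ioo_subset_Icc_self hs')
      this
  · intro e e' hne s hs s' hs' he
    obtain ⟨h1, h2⟩ := P.eq_of_notMem e.2.1 e'.2.1 (hV' e s hs) he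
    have m := stretch_mem_Ioo (hab e).a_lt_b hs
    have m' := stretch_mem_Icc (hab e').a_lt_b hs'
    rw [← h2] at m'
    obtain ⟨⟨h, t, t'⟩, hh, hc⟩ := e
    obtain ⟨⟨h₁, t₁, t₁'⟩, hh₁, hc₁⟩ := e'
    obtain rfl : h = h₁ := h1
    obtain ⟨rfl, rfl⟩ := hc.eq_of_mem hc₁ ((hab _).lt_a.trans m.1) (m.2.trans (hab _).b_lt)
      ((hab _).lt_a.trans_le m'.1) (m'.2.trans_lt (hab _).b_lt)
    exact hne rfl
  · have h1 := P.norm_lt (P.hl none) 0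
    simp [anchor, abs_of_pos ((norm_nonneg _).trans_lt h1)]
  · intro v hv
    have key : ∀ h ∈ P.H, ∀ t, t ≠ 1 → v = L.f h t →
        ∃ e : P.Gap, L.f e.1.1 e.1.2.1 = v ∨ L.f e.1.1 e.1.2.2 = v := by
      rintro h hh t ht1 rfl
      obtain ⟨t', ht'⟩ := P.exists_consecutive hk h hv ht1
      exact ⟨⟨(h, t, t'), hh, ht'⟩, Or.inl rfl⟩
    rcases P.exists_of_mem hv with rfl | ⟨h, hh, t, -, ht1, rfl⟩
    · exact key _ (P.hl_mem none) 0 zero_ne_one (L.f_zero _).symm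
    · exact key h hh t ht1 rfl

end Parameters

end LoopFamily

lemma Path.mk_cast_trans {X : Type*} [TopologicalSpace X] {y y₀ y₁ : X} (p : Path y y)
    (h₀ : y₀ = y) (h₁ : y₁ = y) :
    ((Path.Homotopic.Quotient.mk ((Path.refl y).cast rfl h₀)).trans (.mk (p.cast h₀ h₁))).trans
      (.mk ((Path.refl y).cast h₁ rfl)) = .mk p := by
  subst h₀ h₁
  simp

namespace LoopFamily

namespace Parameters

variable {J : Type} {x : ℂ} {k : ℕ} {L : LoopFamily J x k} {A : Set ℂ} (P : L.Parameters A)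

/-- The chosen loops, without small discs, are part of the arc system. -/
structure Compatible {ι : Type} (Γ : ArcSystem A ι P.R) : Prop where
  carrier : ∀ z ∈ Γ.carrier, ‖z‖ < P.R →
    (∃ i, z ∈ segment ℝ (anchor A P.R i) (P.u i)) ∨
    ((∃ h ∈ P.H, ∃ t, t ≠ 0 ∧ t ≠ 1 ∧ z = L.f h t) ∧ (∀ v ∈ P.V, P.r < dist z v) ∧
      ∃ i, z ∈ Γ.inner i) ∨ ∃ v ∈ P.V, dist z v = P.r
  sphere : ∀ v ∈ P.V, ∀ z, dist z v = P.r → (∃ i, z ∈ Γ.inner i) ∨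
    (∃ h ∈ P.H, ∃ t, t ≠ 0 ∧ t ≠ 1 ∧ z = L.f h t) ∨ ∃ i, z = P.u i

theorem exists_compatible [Finite A] (hk : 1 ≤ k) :
    ∃ (ι : Type) (_ : Finite ι) (_ : Nonempty ι) (Γ : ArcSystem A ι P.R),
      Nat.card ι ≤ 3 * (P.H.card * (1 + (A.ncard + 1) * (2 * k) + (P.H.card + 1) * (k - 1))) +
        (A.ncard + 1) ∧ P.Compatible Γ := by
  have := Fintype.ofFinite A
  obtain ⟨hfin, hcard⟩ := L.card_consecutive_le hk P.H P.g
  have hfin' : Finite P.Gap := hfin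
  change Nat.card P.Gap ≤ _ at hcard
  have := Fintype.ofFinite P.Gap
  have hA : Fintype.card (Option A) = A.ncard + 1 := by
    rw [Fintype.card_option, Set.ncard_eq_toFinset_card', Set.toFinset_card]
  obtain ⟨a, b, Θ, hab, hV, hr, ha, hu, hc⟩ := P.exists_skeleton hk
  obtain ⟨F, Γ, hF, h1, h2, h3⟩ := Θ.exists_arcSystem
  rw [hA] at hF hcard
  rw [hV, hr, ha, hu] at h1
  rw [hV, hr] at h2
  rw [hu] at h3
  have hIcc : ∀ e, ∀ s ∈ Set.Icc (0 : ℝ) 1, ∃ h ∈ P.H, ∃ t, t ≠ 0 ∧ t ≠ 1 ∧ Θ.c e s = L.f h t := by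
    intro e s hs
    obtain ⟨m1, m2⟩ := stretch_mem_Icc (hab e).2.1 hs
    refine ⟨e.1.1, e.2.1, stretch (a e) (b e) s, ?_, ?_, by rw [hc]⟩
    · exact (unitInterval.nonneg'.trans_lt ((hab e).1.trans_le m1)).ne'
    · exact ((m2.trans_lt (hab e).2.2).trans_le unitInterval.le_one').ne
  refine ⟨P.Gap ⊕ F, inferInstance, ?_, Γ, ?_, ?_, ?_⟩
  · obtain ⟨e, -⟩ := Θ.exists_arc x (hV ▸ P.x_mem)
    exact ⟨Sum.inl e⟩
  · rw [Nat.card_sum, Nat.card_eq_fintype_card (α := F), Fintype.card_coe]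
    rw [← Nat.card_eq_fintype_card (α := P.Gap)] at hF
    omega
  · intro z hz hzR
    rcases h1 z hz hzR with h | ⟨e, ⟨s, hs, rfl⟩, hi⟩ | h
    · exact Or.inl h
    · refine Or.inr (Or.inl ⟨hIcc e s (Set.Ioo_subset_Icc_self hs), ?_, _, hi⟩)
      have := Θ.lt_dist_c e s hs
      rwa [hV, hr] at this
    · exact Or.inr (Or.inr h)
  · intro v hv z hz
    by_cases hzF : z ∈ F
    · rcases h3 z hzF with ⟨e, rfl | rfl⟩ | h
      · exact Or.inr (Or.inl (hIcc e 0 (by simp)))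
      · exact Or.inr (Or.inl (hIcc e 1 (by simp)))
      · exact Or.inr (Or.inr h)
    · exact Or.inl (h2 v hv z hz hzF)

variable {P} {ι : Type} {Γ : ArcSystem A ι P.R}

lemma Compatible.le_dist (hΓ : P.Compatible Γ) {v z : ℂ} (hv : v ∈ P.V) (hz : z ∈ Γ.carrier) :
    P.r ≤ dist z v := by
  by_contra! hlt
  rcases hΓ.carrier z hz (P.ball v hv z (hlt.trans P.r_lt)).2 with ⟨i, hi⟩ | ⟨-, h, -⟩ |
    ⟨v', hv', h⟩
  · exact (P.le_dist_of_mem_segment hi hv).not_gt hlt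
  · exact lt_asymm (h v hv) hlt
  · by_cases hne : v = v'
    · exact hlt.ne (hne ▸ h)
    · have h1 := P.le_dist v hv v' hv' hne
      have h2 := dist_triangle_left v v' z
      have h3 := P.r_lt
      linarith

lemma Compatible.notMem (hΓ : P.Compatible Γ) {v : ℂ} (hv : v ∈ P.V) : v ∉ Γ.carrier := fun h =>
  P.r_pos.not_ge (by simpa using hΓ.le_dist hv h)

lemma Compatible.eq_of_mem_segment (hΓ : P.Compatible Γ) {v w z : ℂ} (hv : v ∈ P.V)
    (hw : dist w v = P.r) (hz : z ∈ segment ℝ v w) (hzΓ : z ∈ Γ.carrier) : z = w := by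
  have h1 := dist_add_dist_of_mem_segment hz
  have h2 := hΓ.le_dist hv hzΓ
  rw [dist_comm v z, dist_comm v w, hw] at h1
  exact dist_le_zero.1 (by linarith)

lemma Compatible.exists_inner (hΓ : P.Compatible Γ) {j : J} (hj : j ∉ P.H) {v : ℂ} (hv : v ∈ P.V)
    {t : I} (h0 : t ≠ 0) (h1 : t ≠ 1) (ht : dist (L.f j t) v = P.r) :
    ∃ i, L.f j t ∈ Γ.inner i := by
  rcases hΓ.sphere v hv _ ht with h | ⟨h, hh, s, s0, s1, he⟩ | ⟨i, hi⟩
  · exact h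
  · have hne : j ≠ h := fun h => hj (h ▸ hh)
    exact absurd ht (P.dist_ne j h hne t
      ⟨h0, h1, s, s0, s1, fun h => hne (congrArg Prod.fst h).symm, he⟩ v hv)
  · exact absurd (hi ▸ right_mem_segment ℝ (anchor A P.R i) (P.u i)) (P.f_notMem_segment j t i)

theorem Compatible.exists_reach [Finite A] (hk : 1 ≤ k) (hΓ : P.Compatible Γ) {j : J}
    (hj : j ∉ P.H) {y : {z : ℂ // z ∉ A}} (p : Path y y) (hp : ∀ t, (p t : ℂ) = L.f j t)
    (code : ι → ℂ → Bool) :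
    ∃ l, l.length ≤ 2 + 2 * (P.H.card * (k - 1)) ∧ Γ.Reach code y l y (.mk p) := by
  classical
  have hy : (y : ℂ) = x := by rw [← p.source, hp, L.f_zero]
  have hyΓ : (y : ℂ) ∉ Γ.carrier := by
    rw [hy]
    exact hΓ.notMem P.x_mem
  have hfin := P.finite_preimage_V hk j
  obtain ⟨hXfin, hXcard⟩ := L.biUnion_hits P.H hj
  set X : Finset I := hXfin.toFinset with hX
  have hmemX : ∀ s : I, s ≠ 0 → s ≠ 1 → (∃ h ∈ P.H, ∃ t, t ≠ 0 ∧ t ≠ 1 ∧ L.f j s = L.f h t) →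
      s ∈ X := by
    rintro s s0 s1 ⟨h, hh, t, t0, t1, he⟩
    rw [hX, Set.Finite.mem_toFinset]
    exact Set.mem_iUnion₂.2 ⟨h, hh, s0, s1, t, t0, t1,
      fun h' => hj ((Prod.mk.inj h').1 ▸ hh), he⟩
  have hcardX : X.card ≤ P.H.card * (k - 1) := by
    rwa [Set.ncard_eq_toFinset_card _ hXfin] at hXcard
  have key : ∀ t ∈ hfin.toFinset, ∃ l, l.length ≤ 2 * ((insert 0 X).filter fun s => s < t).card ∧
      Γ.Reach code y l (p t) ((Path.Homotopic.Quotient.mk ((Path.refl y).cast rfl p.source)).trans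
        (.mk (p.subpath 0 t))) := by
    refine Finset.induction_consecutive _ 0 ?_ (fun _ _ => unitInterval.nonneg') _ ?_ ?_
    · simpa [L.f_zero] using P.x_mem
    · refine ⟨[], by simp, (Path.refl y).cast rfl p.source, fun t => hyΓ, ?_⟩
      simp
    · simp only [Set.Finite.mem_toFinset, Set.mem_ofPred_eq]
      rintro t ht t' ht' hlt hno ⟨l, hl, hreach⟩
      obtain ⟨a, b, hab⟩ := P.exists_gapCut j t t'
        ⟨hlt, ht, ht', fun s hs hs' hm => hno s hm ⟨hs, hs'⟩⟩
      have hne0 : ∀ s, t < s → s ≠ 0 := fun s hs => (unitInterval.nonneg'.trans_lt hs).ne'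
      have hne1 : ∀ s, s < t' → s ≠ 1 := fun s hs => (hs.trans_le unitInterval.le_one').ne
      have hta := hab.lt_a
      have hbt := hab.b_lt
      have hlab := hab.a_lt_b
      obtain ⟨l', hl', hreach'⟩ := hreach.gap p X hta hlab hbt
        (by rw [hp]; exact hΓ.notMem ht) (by rw [hp]; exact hΓ.notMem ht')
        (convex_ball (L.f j t) P.ρ) (fun z hz => (P.ball _ ht z hz).1)
        (convex_ball (L.f j t') P.ρ) (fun z hz => (P.ball _ ht' z hz).1)
        (fun s hs => by rw [hp]; exact hab.near_left s hs.1 hs.2)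
        (fun s hs => by rw [hp]; exact hab.near_right s hs.1 hs.2)
        (by rw [hp]; exact hΓ.exists_inner hj ht (hne0 _ hta) (hne1 _ (hlab.trans hbt)) hab.dist_a)
        (by rw [hp]; exact hΓ.exists_inner hj ht' (hne0 _ (hta.trans hlab)) (hne1 _ hbt) hab.dist_b)
        (by rw [hp, hp]; exact fun z hz => hΓ.eq_of_mem_segment ht hab.dist_a hz)
        (by rw [hp, hp, segment_symm]; exact fun z hz => hΓ.eq_of_mem_segment ht' hab.dist_b hz)
        (by
          intro s hs hs' hm
          rw [hp] at hm ⊢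
          rcases hΓ.carrier _ hm (P.norm_lt j s) with ⟨i, hi⟩ | ⟨h, -, hi⟩ | ⟨v, hv, hd⟩
          · exact absurd hi (P.f_notMem_segment j s i)
          · exact ⟨hmemX s (hne0 s (hta.trans hs)) (hne1 s (hs'.trans hbt)) h, hi⟩
          · exact absurd hd (hab.far s hs hs' v hv).ne')
      refine ⟨l', hl'.trans ?_, ?_⟩
      · have htX : t ∈ insert 0 X := by
          by_cases t0 : t = 0
          · simp [t0]
          refine Finset.mem_insert_of_mem (hmemX t t0 (hne1 t hlt) ?_)
          rcases P.exists_of_mem ht with h | h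
          · exact absurd h (L.f_ne j t t0 (hne1 t hlt))
          · exact h
        have hsub : insert t (((insert 0 X).filter fun s => s < t) ∪
            X.filter fun s => a < s ∧ s < b) ⊆ (insert 0 X).filter fun s => s < t' := by
          intro s hs
          simp only [Finset.mem_insert, Finset.mem_union, Finset.mem_filter] at hs htX ⊢
          rcases hs with rfl | ⟨h1, h2⟩ | ⟨h1, h2, h3⟩
          · exact ⟨htX, hlt⟩
          · exact ⟨h1, h2.trans hlt⟩
          · exact ⟨Or.inr h1, h3.trans hbt⟩
        have hcard := Finset.card_le_card hsub
        rw [Finset.card_insert_of_notMem, Finset.card_union_of_disjoint] at hcard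
        · omega
        · rw [Finset.disjoint_left]
          intro s hs hs'
          exact lt_asymm (Finset.mem_filter.1 hs).2 (hta.trans (Finset.mem_filter.1 hs').2.1)
        · simp only [Finset.mem_union, Finset.mem_filter, lt_irrefl, and_false, false_or, not_and]
          exact fun _ h => absurd h hta.not_gt
      · rwa [Path.Homotopic.Quotient.trans_assoc, Path.mk_subpath_trans] at hreach'
  obtain ⟨l, hl, hreach⟩ := key 1 (by simpa [L.f_one] using P.x_mem)
  refine ⟨l, ?_, ?_⟩
  · have h1 := Finset.card_filter_le (insert 0 X) fun s => s < 1
    have h2 := Finset.card_insert_le 0 X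
    omega
  · have := hreach.move ((Path.refl y).cast p.target rfl) (fun t => hyΓ)
    rwa [Path.subpath_zero_one, Path.mk_cast_trans] at this

end Parameters

end LoopFamily

lemma List.card_length_le (β : Type) [Finite β] (B : ℕ) :
    Finite {l : List β // l.length ≤ B} ∧
      Nat.card {l : List β // l.length ≤ B} ≤ (Nat.card β + 1) ^ B := by
  let φ : {l : List β // l.length ≤ B} → (Fin B → Option β) := fun l i => l.1[(i : ℕ)]?
  have hφ : Function.Injective φ := by
    rintro ⟨l, hl⟩ ⟨l', hl'⟩ h
    refine Subtype.ext (List.ext_getElem? fun i => ?_)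
    by_cases hi : i < B
    · exact congrFun h ⟨i, hi⟩
    · rw [List.getElem?_eq_none (hl.trans (not_lt.1 hi)),
        List.getElem?_eq_none (hl'.trans (not_lt.1 hi))]
  refine ⟨Finite.of_injective φ hφ, (Nat.card_le_card_of_injective φ hφ).trans ?_⟩
  rw [Nat.card_fun, Finite.card_option, Nat.card_fin]

lemma mul_lt_two_mul_pow {n k : ℕ} (hn : 2 ≤ n) (hk : 2 ≤ k) :
    (2 * n + 3 + k) * (2 * (n + 1) * k) < (2 * k) ^ (2 * n) := by
  induction n, hn using Nat.le_induction with
  | base =>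
    have h1 : 4 ≤ k * k := by nlinarith
    have h2 : 2 * (k * k) ≤ k * k * k := by nlinarith
    have h3 : 4 * (k * k) ≤ k * k * k * k := by nlinarith
    have h4 : k * 2 ≤ k * k := by nlinarith
    ring_nf
    nlinarith
  | succ n hn ih =>
    have h1 : 4 ≤ (2 * k) ^ 2 := by nlinarith
    calc (2 * (n + 1) + 3 + k) * (2 * (n + 1 + 1) * k)
        ≤ (2 * (2 * n + 3 + k)) * (2 * (2 * (n + 1) * k)) := by
          refine Nat.mul_le_mul (by omega) ?_
          nlinarith [Nat.zero_le (n * k)]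
      _ = (2 * n + 3 + k) * (2 * (n + 1) * k) * 4 := by ring
      _ < (2 * k) ^ (2 * n) * 4 := by gcongr
      _ ≤ (2 * k) ^ (2 * n) * (2 * k) ^ 2 := by gcongr
      _ = (2 * k) ^ (2 * (n + 1)) := by ring

lemma quadratic_le_two_pow {n : ℕ} (hn : 2 ≤ n) : 18 * n ^ 2 + 44 * n + 27 ≤ 2 ^ (2 * n + 4) := by
  induction n, hn using Nat.le_induction with
  | base => norm_num
  | succ n hn ih =>
    rw [show 2 * (n + 1) + 4 = (2 * n + 4) + 2 by ring, pow_add]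
    nlinarith

lemma exponent_lt {n k : ℕ} (hn : 2 ≤ n) (hk : 1 ≤ k) (h : 3 ≤ n ∨ 2 ≤ k) :
    (2 * n + 3 + k) * (2 + 2 * ((n + 1) * (k - 1))) < (2 * k) ^ (2 * n) := by
  rcases hk.eq_or_lt with rfl | hk2
  · have h3 : 3 ≤ n := by omega
    clear h hn hk
    induction n, h3 using Nat.le_induction with
    | base => norm_num
    | succ n hn ih =>
      have : (2 * 1) ^ (2 * (n + 1)) = (2 * 1) ^ (2 * n) * 4 := by ring
      rw [this]
      simp only [Nat.sub_self, mul_zero] at ih ⊢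
      omega
  · refine lt_of_le_of_lt ?_ (mul_lt_two_mul_pow hn hk2)
    gcongr
    obtain ⟨k, rfl⟩ : ∃ l, k = l + 1 := ⟨k - 1, by omega⟩
    rw [Nat.add_sub_cancel]
    nlinarith

lemma count_lt {n k m : ℕ} (hn : 2 ≤ n) (hk : 1 ≤ k) (hm : m ≤ n + 1) :
    m + ((3 * (m * (1 + (n + 1) * (2 * k) + (m + 1) * (k - 1))) + (n + 1)) * 2 + 1) ^
      (2 + 2 * (m * (k - 1))) < 2 ^ ((2 * k) ^ (2 * n)) := by
  set E := 2 + 2 * ((n + 1) * (k - 1)) with hE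
  have hbase : (3 * (m * (1 + (n + 1) * (2 * k) + (m + 1) * (k - 1))) + (n + 1)) * 2 + 1 ≤
      (18 * n ^ 2 + 44 * n + 27) * k := by
    calc _ ≤ (3 * ((n + 1) * (1 + (n + 1) * (2 * k) + (n + 1 + 1) * (k - 1))) + (n + 1)) * 2 + 1 := by
          gcongr
      _ ≤ _ := by
        obtain ⟨k, rfl⟩ : ∃ l, k = l + 1 := ⟨k - 1, by omega⟩
        rw [Nat.add_sub_cancel]
        nlinarith
  have hpow : m + ((3 * (m * (1 + (n + 1) * (2 * k) + (m + 1) * (k - 1))) + (n + 1)) * 2 + 1) ^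
      (2 + 2 * (m * (k - 1))) ≤ (n + 1) + ((18 * n ^ 2 + 44 * n + 27) * k) ^ E := by
    have h1 : 1 ≤ (18 * n ^ 2 + 44 * n + 27) * k := by nlinarith
    have h2 : 2 + 2 * (m * (k - 1)) ≤ E := by rw [hE]; gcongr
    exact add_le_add hm ((Nat.pow_le_pow_left hbase _).trans (Nat.pow_le_pow_right h1 h2))
  refine hpow.trans_lt ?_
  by_cases hc : 3 ≤ n ∨ 2 ≤ k
  · have hexp := exponent_lt hn hk hc
    rw [← hE] at hexp
    have hk' : k ≤ 2 ^ (k - 1) := by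
      have := Nat.lt_two_pow_self (n := k - 1)
      omega
    have h3 : ((18 * n ^ 2 + 44 * n + 27) * k) ^ E ≤ 2 ^ ((2 * n + 3 + k) * E) := by
      rw [pow_mul]
      refine Nat.pow_le_pow_left ?_ _
      calc _ ≤ 2 ^ (2 * n + 4) * 2 ^ (k - 1) := Nat.mul_le_mul (quadratic_le_two_pow hn) hk'
        _ = 2 ^ (2 * n + 3 + k) := by rw [← pow_add]; congr 1; omega
    have h4 : n + 1 < 2 ^ ((2 * n + 3 + k) * E) := by
      refine Nat.lt_two_pow_self.trans_le (Nat.pow_le_pow_right (by norm_num) ?_)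
      have : 2 ≤ E := by omega
      nlinarith
    calc _ < 2 ^ ((2 * n + 3 + k) * E) + 2 ^ ((2 * n + 3 + k) * E) := by omega
      _ = 2 ^ ((2 * n + 3 + k) * E + 1) := by ring
      _ ≤ _ := Nat.pow_le_pow_right (by norm_num) hexp
  · obtain rfl : n = 2 := by omega
    obtain rfl : k = 1 := by omega
    norm_num [hE]

namespace LoopFamily

variable {J : Type} {x : ℂ} {k : ℕ} (L : LoopFamily J x k)

theorem card_le_of_not_homotopic [Fintype J] [Nonempty J] (hk : 1 ≤ k) {A : Set ℂ}
    (hAfin : A.Finite) {y : {z : ℂ // z ∉ A}} (p : J → Path y y)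
    (hp : ∀ j t, (p j t : ℂ) = L.f j t) (hhom : ∀ i j, i ≠ j → ¬ (p i).Homotopic (p j)) :
    ∃ m ≤ A.ncard + 1, Fintype.card J ≤ m +
      ((3 * (m * (1 + (A.ncard + 1) * (2 * k) + (m + 1) * (k - 1))) + (A.ncard + 1)) * 2 + 1) ^
        (2 + 2 * (m * (k - 1))) := by
  classical
  have := hAfin.to_subtype
  obtain ⟨P⟩ := L.nonempty_parameters hk hAfin fun j t => hp j t ▸ (p j t).2
  obtain ⟨ι, _, _, Γ, hcard, hΓ⟩ := P.exists_compatible hk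
  obtain ⟨code, hcode⟩ := Γ.exists_code
  have hreach := fun j : {j // j ∉ P.H} => hΓ.exists_reach hk j.2 (p j) (hp j) code
  choose l hl hreach using hreach
  have hy : ‖(y : ℂ)‖ < P.R := by
    obtain ⟨j⟩ := ‹Nonempty J›
    have := P.norm_lt j 0
    rwa [← hp, (p j).source] at this
  let φ : {j // j ∉ P.H} → {w : List (ι × Bool) // w.length ≤ 2 + 2 * (P.H.card * (k - 1))} :=
    fun j => ⟨l j, hl j⟩
  have hφ : Function.Injective φ := by
    intro j j' h
    by_contra hne
    have he : l j = l j' := congrArg Subtype.val h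
    have h' := hreach j'
    rw [← he] at h'
    exact hhom j j' (fun h => hne (Subtype.ext h))
      (Path.Homotopic.Quotient.eq.1 (ArcSystem.Reach.eq hAfin hcode hy (hreach j) h'))
  obtain ⟨hfin, hlist⟩ := List.card_length_le (ι × Bool) (2 + 2 * (P.H.card * (k - 1)))
  refine ⟨P.H.card, P.card_H, ?_⟩
  have h1 := (Nat.card_le_card_of_injective φ hφ).trans hlist
  rw [Nat.card_prod, Nat.card_eq_fintype_card (α := Bool), Fintype.card_bool,
    Nat.card_eq_fintype_card, Fintype.card_subtype_compl, Fintype.card_coe] at h1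
  have h2 := Nat.pow_le_pow_left (Nat.add_le_add_right (Nat.mul_le_mul_right 2 hcard) 1)
    (2 + 2 * (P.H.card * (k - 1)))
  omega

end LoopFamily

/-- (`f(n,k) < 2^{(2k)^{2n}}`.) If `γ₁, …, γ_N` are pairwise
non-homotopic `x`-loops in the complement of a set `A` of `n ≥ 2` points, none passing
through `x`, each with fewer than `k` self-intersections and every pair crossing fewer
than `k` times, then `N < 2^{(2k)^{2n}}`. -/
theorem loops_upper_bound (n k N : ℕ) (hn : 2 ≤ n) (hk : 1 ≤ k)
    (A : Set ℂ) (hAfin : A.Finite) (hA : A.ncard = n) (x : ℂ) (hx : x ∉ A)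
    (γ : Fin N → Path (X := {z : ℂ // z ∉ A}) ⟨x, hx⟩ ⟨x, hx⟩)
    (hhom : ∀ i j, i ≠ j → ¬ (γ i).Homotopic (γ j))
    (hbase : ∀ i, AvoidsBase (γ i))
    (hself : ∀ i, SelfIntersLt (γ i) k)
    (hcross : ∀ i j, i ≠ j → CrossingsLt (γ i) (γ j) k) :
    N < 2 ^ ((2 * k) ^ (2 * n)) := by
  rcases Nat.eq_zero_or_pos N with rfl | hN
  · positivity
  have : Nonempty (Fin N) := ⟨⟨0, hN⟩⟩
  let L : LoopFamily (Fin N) x k :=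
    { f := fun j t => γ j t
      continuous_f := fun j => continuous_subtype_val.comp (γ j).continuous
      f_zero := fun j => by rw [(γ j).source]
      f_one := fun j => by rw [(γ j).target]
      f_ne := hbase
      self_lt := fun j => by simpa only [SelfIntersLt, Subtype.ext_iff] using hself j
      cross_lt := fun i j hij => by
        simpa only [CrossingsLt, Subtype.ext_iff] using hcross i j hij }
  obtain ⟨m, hm, hcard⟩ := L.card_le_of_not_homotopic hk hAfin γ (fun _ _ => rfl) hhom
  rw [Fintype.card_fin, hA] at hcard
  rw [hA] at hm
  exact hcard.trans_lt (count_lt hn hk hm)
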